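/- arXiv:1012.2181 — 3 statements merged into one kernel-verified Lean document; each statement's English description precedes it below -/
import Mathlib

section
/- Let m ≥ 1, p = 2, p1 = 7, N = 7^m, and q = 2^{3·7^{m−1}}. Then for every k with 0 ≤ k ≤ 6, the Cayley graph Cay(F_q, D_k) is a strongly regular graph of degree (q−1)/7, where D_k = ∪_{i=0}^{7^{m−1}−1} C_{i + k·7^{m−1}}. -/
open scoped Classical

noncomputable section

section GaussSumDivisibility

variable {F : Type} [Field F] [Fintype F] [CharP F 2]

/-- The inverse of the Teichmüller character, with values in the ring of Witt vectors. -/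
def invTeichmuller (F : Type) [Field F] [Fintype F] [CharP F 2] : MulChar F (WittVector 2 F) where
  toFun x := WittVector.teichmuller 2 x⁻¹
  map_one' := by simp
  map_mul' x y := by simp [mul_comm]
  map_nonunit' x hx := by
    have : x = 0 := by simpa using hx
    simp [this]

theorem invTeichmuller_apply (x : F) :
    invTeichmuller F x = WittVector.teichmuller 2 x⁻¹ := rfl

theorem constantCoeff_invTeichmuller_pow (k : ℕ) {x : F} (hx : x ≠ 0) :
    WittVector.constantCoeff ((invTeichmuller F ^ k) x) = (x⁻¹) ^ k := by
  have h := MulChar.pow_apply_coe (invTeichmuller F) k (Units.mk0 x hx)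
  rw [Units.val_mk0] at h
  rw [h]
  simp [invTeichmuller_apply, ← map_pow, WittVector.constantCoeff]

theorem invTeichmuller_pow_ne_one {k : ℕ} (hk : 0 < k) (hkq : k < Fintype.card F - 1) :
    invTeichmuller F ^ k ≠ 1 := by
  intro h
  have : ∀ x : Fˣ, x ^ k = 1 := by
    intro x
    have h1 := constantCoeff_invTeichmuller_pow k x.ne_zero
    rw [h, MulChar.one_apply_coe, map_one] at h1
    ext
    simpa [eq_comm] using h1
  rw [FiniteField.forall_pow_eq_one_iff] at this
  exact absurd (Nat.le_of_dvd hk this) (by omega)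

theorem two_dvd_iff_constantCoeff (x : WittVector 2 F) :
    2 ∣ x ↔ WittVector.constantCoeff x = 0 := by
  have := WittVector.mem_span_p_iff_coeff_zero_eq_zero (p := 2) x
  rw [Ideal.mem_span_singleton] at this
  exact_mod_cast this

omit [CharP F 2] in
theorem sum_pow_eq_ite {i : ℕ} (hi : 0 < i) :
    ∑ x : F, x ^ i = if Fintype.card F - 1 ∣ i then -1 else 0 := by
  rw [← FiniteField.sum_pow_units F i,
    ← Fintype.sum_subset (s := Finset.univ.image (fun u : Fˣ => (u : F)))]
  · rw [Finset.sum_image (fun _ _ _ _ h => Units.ext h)]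
  · intro x hx
    by_contra hne
    simp only [Finset.mem_image, Finset.mem_univ, true_and, not_exists] at hne
    have hx0 : x ≠ 0 := by rintro rfl; simp [hi.ne'] at hx
    exact hne (Units.mk0 x hx0) rfl

theorem sum_pow_mul_one_sub_pow {k : ℕ} (hk : 2 ≤ k) (hodd : Odd k)
    (hkq : k < Fintype.card F - 1) :
    ∑ x : F, x ^ (Fintype.card F - 2) * (1 - x) ^ (Fintype.card F - k) = 1 := by
  have hq2 : (Fintype.card F : F) = 0 := Nat.cast_card_eq_zero F
  have hk1 : (k : F) = 1 := by
    obtain ⟨j, rfl⟩ := hodd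
    simp [CharTwo.two_eq_zero]
  set q := Fintype.card F with hq
  have key : ∀ x : F, x ^ (q - 2) * (1 - x) ^ (q - k) =
      ∑ j ∈ Finset.range (q - k + 1), x ^ (q - 2 + j) * ((q - k).choose j : F) := by
    intro x
    rw [CharTwo.sub_eq_add, add_comm, add_pow, Finset.mul_sum]
    refine Finset.sum_congr rfl fun j _ => ?_
    rw [one_pow, pow_add]; ring
  simp_rw [key]
  rw [Finset.sum_comm, Finset.sum_eq_single 1]
  · rw [← Finset.sum_mul, sum_pow_eq_ite (by omega), if_pos (by
      rw [← hq, show q - 2 + 1 = q - 1 by omega]), Nat.choose_one_right,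
      Nat.cast_sub (by omega), hq2, hk1]
    ring
  · intro j hj hj1
    rw [← Finset.sum_mul, sum_pow_eq_ite (by omega), if_neg, zero_mul]
    rw [← hq]
    rintro ⟨c, hc⟩
    have hj' : j < q - k + 1 := Finset.mem_range.mp hj
    have hc2 : c < 2 := by
      by_contra h
      have : (q - 1) * 2 ≤ (q - 1) * c := Nat.mul_le_mul_left _ (by omega)
      omega
    interval_cases c <;> omega
  · intro h
    exact absurd (Finset.mem_range.mpr (by omega)) h

theorem isUnit_jacobiSum_invTeichmuller {k : ℕ} (hk : 2 ≤ k) (hodd : Odd k)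
    (hkq : k < Fintype.card F - 1) :
    IsUnit (jacobiSum (invTeichmuller F) (invTeichmuller F ^ (k - 1))) := by
  apply WittVector.isUnit_of_coeff_zero_ne_zero (p := 2)
  change WittVector.constantCoeff _ ≠ 0
  suffices h : WittVector.constantCoeff
      (jacobiSum (invTeichmuller F) (invTeichmuller F ^ (k - 1))) = 1 by
    rw [h]; exact one_ne_zero
  rw [jacobiSum, map_sum]
  refine Eq.trans ?_ (sum_pow_mul_one_sub_pow hk hodd hkq)
  refine Finset.sum_congr rfl fun x _ => ?_
  rw [map_mul]
  by_cases hx : x = 0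
  · subst hx
    rw [MulChar.map_zero, map_zero, zero_mul, zero_pow (by omega), zero_mul]
  by_cases hx1 : 1 - x = 0
  · rw [hx1, MulChar.map_zero, map_zero, mul_zero, zero_pow (by omega), mul_zero]
  have inv_pow_eq : ∀ y : F, y ≠ 0 → ∀ j ≤ Fintype.card F - 1,
      (y⁻¹) ^ j = y ^ (Fintype.card F - 1 - j) := by
    intro y hy j hj
    rw [pow_sub₀ y hy hj, FiniteField.pow_card_sub_one_eq_one y hy, one_mul, inv_pow]
  have h1 := constantCoeff_invTeichmuller_pow 1 hx
  rw [pow_one] at h1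
  rw [h1, constantCoeff_invTeichmuller_pow _ hx1, inv_pow_eq x hx _ (by omega),
    inv_pow_eq _ hx1 _ (by omega)]
  congr 2
  omega

theorem two_dvd_gaussSum_invTeichmuller (hq : 2 < Fintype.card F) (Ψ : AddChar F (WittVector 2 F))
    (hΨ : ∀ x, Ψ x = 1 ∨ Ψ x = -1) : 2 ∣ gaussSum (invTeichmuller F) Ψ := by
  rw [two_dvd_iff_constantCoeff, gaussSum, map_sum]
  have : ∑ x : F, x⁻¹ = 0 := by
    rw [← FiniteField.sum_pow_lt_card_sub_one F 1 (by omega)]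
    exact Fintype.sum_bijective _ (inv_involutive (G := F)).bijective _ _ fun x => (pow_one _).symm
  rw [← this]
  refine Finset.sum_congr rfl fun x _ => ?_
  have hc : WittVector.constantCoeff (Ψ x) = (1 : F) := by
    rcases hΨ x with h | h <;> simp only [h, map_neg, map_one, CharTwo.neg_eq]
  rw [map_mul, hc, mul_one, invTeichmuller_apply]
  simp [WittVector.constantCoeff]

theorem gaussSum_sq_eq_gaussSum {R : Type} [CommRing R] (χ : MulChar F R) (Ψ : AddChar F R)
    (hΨ : ∀ x, Ψ (x ^ 2) = Ψ x) : gaussSum (χ ^ 2) Ψ = gaussSum χ Ψ := by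
  rw [gaussSum, gaussSum]
  refine Fintype.sum_bijective (fun x : F => x ^ 2) (bijective_frobenius F 2) _ _ fun x => ?_
  rw [hΨ, map_pow, MulChar.pow_apply' _ two_ne_zero]

/-- Stickelberger's lower bound for the `2`-adic valuation of a Gauss sum. -/
theorem two_pow_dvd_gaussSum {f : ℕ} (hf : 2 ≤ f) (hcard : Fintype.card F = 2 ^ f)
    (Ψ : AddChar F (WittVector 2 F)) (hval : ∀ x, Ψ x = 1 ∨ Ψ x = -1)
    (hsq : ∀ x, Ψ (x ^ 2) = Ψ x) (k : ℕ) :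
    ∀ e : ℕ, k < 2 ^ f - 1 →
      e * (2 ^ f - 1) ≤ ∑ i ∈ Finset.range f, 2 ^ i * k % (2 ^ f - 1) →
      2 ^ e ∣ gaussSum (invTeichmuller F ^ k) Ψ := by
  have h4 : 4 ≤ 2 ^ f := by
    calc 4 = 2 ^ 2 := rfl
      _ ≤ 2 ^ f := Nat.pow_le_pow_right (by norm_num) hf
  have hone : ∑ i ∈ Finset.range f, 2 ^ i * 1 % (2 ^ f - 1) ≤ 2 ^ f - 1 := by
    rw [← Nat.geomSum_eq le_rfl f |>.trans (Nat.div_one _)]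
    exact Finset.sum_le_sum fun i _ => by rw [mul_one]; exact Nat.mod_le _ _
  have hG1 := two_dvd_gaussSum_invTeichmuller (by omega) Ψ hval
  induction k using Nat.strong_induction_on with
  | _ k ih =>
  intro e hk he
  rcases Nat.eq_zero_or_pos k with rfl | hk0
  · have : e = 0 := by
      simp only [mul_zero, Nat.zero_mod, Finset.sum_const_zero, Nat.le_zero, mul_eq_zero] at he
      omega
    simp [this]
  rcases Nat.even_or_odd' k with ⟨j, rfl | rfl⟩
  · rw [mul_comm 2 j, pow_mul, gaussSum_sq_eq_gaussSum _ _ hsq]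
    refine ih j (by omega) e (by omega) (he.trans (le_of_eq ?_))
    obtain ⟨g, rfl⟩ : ∃ g, f = g + 1 := ⟨f - 1, by omega⟩
    rw [Finset.sum_range_succ, Finset.sum_range_succ']
    congr 1
    · exact Finset.sum_congr rfl fun i _ => by rw [← mul_assoc, ← pow_succ]
    · rw [← mul_assoc, ← pow_succ, pow_zero, one_mul]
      obtain ⟨n, hn⟩ : ∃ n, 2 ^ (g + 1) = n + 1 := ⟨2 ^ (g + 1) - 1, by omega⟩
      rw [hn, Nat.add_sub_cancel, add_mul, one_mul, Nat.mul_add_mod]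
  rcases Nat.eq_zero_or_pos e with rfl | he0
  · simp
  obtain ⟨d, rfl⟩ : ∃ d, e = d + 1 := ⟨e - 1, by omega⟩
  rcases Nat.eq_zero_or_pos j with rfl | hj
  · have : d = 0 := by
      have h := he.trans hone
      by_contra hd
      have : 2 * (2 ^ f - 1) ≤ (d + 1) * (2 ^ f - 1) := Nat.mul_le_mul_right _ (by omega)
      omega
    simpa [this] using hG1
  have hdvd : 2 ^ d ∣ gaussSum (invTeichmuller F ^ (2 * j)) Ψ := by
    refine ih (2 * j) (by omega) d (by omega) ?_
    have hsub : ∑ i ∈ Finset.range f, 2 ^ i * (2 * j + 1) % (2 ^ f - 1) ≤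
        ∑ i ∈ Finset.range f, 2 ^ i * (2 * j) % (2 ^ f - 1) +
        ∑ i ∈ Finset.range f, 2 ^ i * 1 % (2 ^ f - 1) := by
      rw [← Finset.sum_add_distrib]
      exact Finset.sum_le_sum fun i _ => by rw [mul_add, Nat.add_mod]; exact Nat.mod_le _ _
    rw [add_mul, one_mul] at he
    omega
  have hmul := jacobiSum_mul_nontrivial (χ := invTeichmuller F) (φ := invTeichmuller F ^ (2 * j))
    (by rw [← pow_succ']; exact invTeichmuller_pow_ne_one (by omega) (by omega)) Ψ
  have hu := isUnit_jacobiSum_invTeichmuller (F := F) (k := 2 * j + 1) (by omega)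
    ⟨j, rfl⟩ (by omega)
  rw [Nat.add_sub_cancel] at hu
  rw [← pow_succ'] at hmul
  rw [← hu.dvd_mul_right, hmul, pow_succ']
  exact mul_dvd_mul hG1 hdvd

end GaussSumDivisibility

section PowersOfTwo

theorem seven_pow_succ_dvd_eight_pow_sub_one (r : ℕ) : 7 ^ (r + 1) ∣ 8 ^ 7 ^ r - 1 := by
  have h := dvd_sub_pow_of_dvd_sub (R := ℤ) (p := 7) (a := 8) (b := 1) (by norm_num) r
  rw [one_pow] at h
  have h1 : (1 : ℕ) ≤ 8 ^ 7 ^ r := Nat.one_le_pow _ _ (by norm_num)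
  zify [h1]
  exact_mod_cast h

theorem seven_pow_dvd_of_dvd_eight_pow_sub_one {r d : ℕ} (hd : d ≠ 0)
    (h : 7 ^ (r + 1) ∣ 8 ^ d - 1) : 7 ^ r ∣ d := by
  have : Fact (Nat.Prime 7) := ⟨by norm_num⟩
  have hval := padicValNat.pow_sub_pow (p := 7) (x := 8) (y := 1) (by norm_num) (by norm_num)
    (by norm_num) (by norm_num) hd
  have hne : 8 ^ d - 1 ≠ 0 := by
    have : 8 ^ 1 ≤ 8 ^ d := Nat.pow_le_pow_right (by norm_num) (by omega)
    omega
  rw [one_pow, show 8 - 1 = 7 from rfl, padicValNat_self] at hval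
  rw [padicValNat_dvd_iff_le hne, hval] at h
  rw [padicValNat_dvd_iff_le hd]
  omega

theorem sum_eight_pow_mul_mod (r : ℕ) {v : ℕ} (hv : ¬ 7 ∣ v) :
    ∑ j ∈ Finset.range (7 ^ r), 8 ^ j * v % 7 ^ (r + 1) =
      7 * ∑ j ∈ Finset.range (7 ^ r), j + 7 ^ r * (v % 7) := by
  have hmod : ∀ j, 8 ^ j * v % 7 ^ (r + 1) % 7 = v % 7 := by
    intro j
    rw [Nat.mod_mod_of_dvd _ (dvd_pow_self 7 (Nat.succ_ne_zero r)), Nat.mul_mod, Nat.pow_mod]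
    simp
  have hdecomp : ∀ j, 8 ^ j * v % 7 ^ (r + 1) = 7 * (8 ^ j * v % 7 ^ (r + 1) / 7) + v % 7 := by
    intro j
    conv_lhs => rw [← Nat.div_add_mod (8 ^ j * v % 7 ^ (r + 1)) 7, hmod]
  have hinj_lt : ∀ i j, i < j → j < 7 ^ r →
      8 ^ i * v % 7 ^ (r + 1) ≠ 8 ^ j * v % 7 ^ (r + 1) := by
    intro i j hij hj h
    have h1 : 7 ^ (r + 1) ∣ 8 ^ j * v - 8 ^ i * v := (Nat.modEq_iff_dvd' (Nat.mul_le_mul_right _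
      (Nat.pow_le_pow_right (by norm_num) hij.le))).mp h
    have h2 : 8 ^ j * v - 8 ^ i * v = 8 ^ i * v * (8 ^ (j - i) - 1) := by
      rw [Nat.mul_sub, mul_one, mul_right_comm, ← pow_add, Nat.add_sub_cancel' hij.le]
    have hcop : Nat.Coprime (7 ^ (r + 1)) (8 ^ i * v) := by
      apply Nat.Coprime.pow_left
      apply Nat.Coprime.mul_right
      · exact Nat.Coprime.pow_right _ (by norm_num)
      · exact (Nat.Prime.coprime_iff_not_dvd (by norm_num)).mpr hv
    rw [h2] at h1
    have h3 := seven_pow_dvd_of_dvd_eight_pow_sub_one (by omega) (hcop.dvd_of_dvd_mul_left h1)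
    exact absurd (Nat.le_of_dvd (by omega) h3) (by omega)
  have hinj : Set.InjOn (fun j => 8 ^ j * v % 7 ^ (r + 1) / 7) (Finset.range (7 ^ r)) := by
    intro i hi j hj h
    have hi' : i < 7 ^ r := by simpa using hi
    have hj' : j < 7 ^ r := by simpa using hj
    have h' : 8 ^ i * v % 7 ^ (r + 1) = 8 ^ j * v % 7 ^ (r + 1) := by
      have h0 : 8 ^ i * v % 7 ^ (r + 1) / 7 = 8 ^ j * v % 7 ^ (r + 1) / 7 := h
      rw [hdecomp i, hdecomp j, h0]
    rcases lt_trichotomy i j with hlt | heq | hlt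
    · exact absurd h' (hinj_lt i j hlt hj')
    · exact heq
    · exact absurd h'.symm (hinj_lt j i hlt hi')
  have himg : (Finset.range (7 ^ r)).image (fun j => 8 ^ j * v % 7 ^ (r + 1) / 7) =
      Finset.range (7 ^ r) := by
    apply Finset.eq_of_subset_of_card_le
    · intro x hx
      obtain ⟨j, -, rfl⟩ := Finset.mem_image.mp hx
      rw [Finset.mem_range, Nat.div_lt_iff_lt_mul (by norm_num), ← pow_succ]
      exact Nat.mod_lt _ (by positivity)
    · rw [Finset.card_image_of_injOn hinj]
  rw [Finset.sum_congr rfl fun j _ => hdecomp j, Finset.sum_add_distrib, ← Finset.mul_sum,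
    Finset.sum_const, Finset.card_range, smul_eq_mul]
  congr 2
  conv_rhs => rw [← himg, Finset.sum_image hinj]

theorem sum_range_three_mul (g : ℕ → ℕ) (n : ℕ) :
    ∑ i ∈ Finset.range (3 * n), g i =
      ∑ j ∈ Finset.range n, g (3 * j) + ∑ j ∈ Finset.range n, g (3 * j + 1) +
        ∑ j ∈ Finset.range n, g (3 * j + 2) := by
  induction n with
  | zero => simp
  | succ n ih =>
    rw [show 3 * (n + 1) = 3 * n + 1 + 1 + 1 by ring]
    simp only [Finset.sum_range_succ, ih]
    ring

theorem mul_le_sum_two_pow_mul_mod {r b u : ℕ} (hb : 3 * 7 ^ r = 2 * b + 1) (hu : ¬ 7 ∣ u) :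
    b * 7 ^ (r + 1) ≤ ∑ i ∈ Finset.range (3 * 7 ^ r), 2 ^ i * u % 7 ^ (r + 1) := by
  have hpow : ∀ e j, 2 ^ (3 * j + e) * u = 8 ^ j * (2 ^ e * u) := by
    intro e j
    rw [pow_add, pow_mul, mul_assoc]
    norm_num
  have hpow0 : ∀ j, 2 ^ (3 * j) * u = 8 ^ j * u := by
    intro j
    rw [pow_mul]
    norm_num
  have hM := Finset.sum_range_id_mul_two (7 ^ r)
  rw [sum_range_three_mul]
  simp_rw [hpow, hpow0]
  rw [sum_eight_pow_mul_mod r hu, sum_eight_pow_mul_mod r (by omega),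
    sum_eight_pow_mul_mod r (by omega)]
  have hres : 7 ≤ u % 7 + 2 ^ 1 * u % 7 + 2 ^ 2 * u % 7 := by omega
  have hM1 : 1 ≤ 7 ^ r := Nat.one_le_pow _ _ (by norm_num)
  have hres' := Nat.mul_le_mul_left (7 ^ r) hres
  rw [pow_succ]
  generalize 7 ^ r = M at *
  generalize ∑ j ∈ Finset.range M, j = S at *
  obtain ⟨K, rfl⟩ : ∃ K, M = K + 1 := ⟨M - 1, by omega⟩
  rw [Nat.add_sub_cancel] at hM
  nlinarith

end PowersOfTwo

section TwoValued

variable {F : Type} [Field F] [Fintype F] [CharP F 2]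

/-- The values at the characters `x ↦ ψ (c * x)` of the indicator function of `D`. -/
def charValue (ψ : AddChar F ℤ) (D : Finset F) (c : F) : ℤ := ∑ x ∈ D, ψ (c * x)

theorem exists_primitive_addChar (F : Type) [Field F] [Fintype F] [CharP F 2] :
    ∃ ψ : AddChar F ℤ, ψ.IsPrimitive ∧ (∀ x, ψ x = 1 ∨ ψ x = -1) ∧ ∀ x, ψ (x ^ 2) = ψ x := by
  let _ : Algebra (ZMod 2) F := ZMod.algebra F 2
  let φ : AddChar (ZMod 2) ℤ := AddChar.zmodChar 2 (ζ := -1) (by norm_num)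
  have hφ : ∀ a : ZMod 2, φ a = if a = 0 then 1 else -1 := by
    intro a
    fin_cases a
    · exact AddChar.zmodChar_apply _ _
    · exact AddChar.zmodChar_apply _ _
  let ψ : AddChar F ℤ := φ.compAddMonoidHom (Algebra.trace (ZMod 2) F).toAddMonoidHom
  have hψ : ∀ x, ψ x = φ (Algebra.trace (ZMod 2) F x) := fun x => rfl
  refine ⟨ψ, AddChar.IsPrimitive.of_ne_one ?_, ?_, ?_⟩
  · obtain ⟨b, hb⟩ : ∃ b : F, Algebra.trace (ZMod 2) F b ≠ 0 := by
      by_contra! hf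
      have htr := (traceForm_nondegenerate (ZMod 2) F).1 1
      simp_rw [Algebra.traceForm_apply] at htr
      exact one_ne_zero (htr fun y => hf _)
    refine AddChar.ne_one_iff.mpr ⟨b, ?_⟩
    rw [hψ, hφ, if_neg hb]
    norm_num
  · intro x
    rw [hψ, hφ]
    split_ifs <;> simp
  · intro x
    rw [hψ, hψ]
    congr 1
    have h := Algebra.trace_eq_of_algEquiv
      (FiniteField.frobeniusAlgEquivOfAlgebraic (ZMod 2) F) x
    simpa [FiniteField.coe_frobeniusAlgEquivOfAlgebraic] using h

theorem sum_charValue_sq_mul (ψ : AddChar F ℤ) (hψ : ψ.IsPrimitive) (D : Finset F) (z : F) :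
    ∑ c : F, charValue ψ D c ^ 2 * ψ (c * z) =
      Fintype.card F * (D.filter fun d => z - d ∈ D).card := by
  have h1 : ∀ c : F, charValue ψ D c ^ 2 * ψ (c * z) =
      ∑ d ∈ D, ∑ d' ∈ D, ψ (c * (d + d' + z)) := by
    intro c
    rw [charValue, sq, Finset.sum_mul_sum, Finset.sum_mul]
    refine Finset.sum_congr rfl fun d _ => ?_
    rw [Finset.sum_mul]
    refine Finset.sum_congr rfl fun d' _ => ?_
    rw [← AddChar.map_add_eq_mul, ← AddChar.map_add_eq_mul, mul_add, mul_add]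
  simp_rw [h1]
  rw [Finset.sum_comm]
  have h2 : ∀ d ∈ D, ∑ c : F, ∑ d' ∈ D, ψ (c * (d + d' + z)) =
      if z - d ∈ D then (Fintype.card F : ℤ) else 0 := by
    intro d _
    rw [Finset.sum_comm]
    have h3 : ∀ d' ∈ D, ∑ c : F, ψ (c * (d + d' + z)) =
        if z - d = d' then (Fintype.card F : ℤ) else 0 := by
      intro d' _
      rw [AddChar.sum_mulShift _ hψ, Nat.cast_ite, Nat.cast_zero]
      refine if_congr ?_ rfl rfl
      rw [show d + d' + z = (z + d) + d' by ring, CharTwo.add_eq_zero, CharTwo.sub_eq_add]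
    rw [Finset.sum_congr rfl h3, Finset.sum_ite_eq]
  rw [Finset.sum_congr rfl h2, ← Finset.sum_filter, Finset.sum_const, nsmul_eq_mul, mul_comm]

theorem sum_charValue_mul (ψ : AddChar F ℤ) (hψ : ψ.IsPrimitive) (D : Finset F) (z : F) :
    ∑ c : F, charValue ψ D c * ψ (c * z) = if z ∈ D then (Fintype.card F : ℤ) else 0 := by
  simp_rw [charValue, Finset.sum_mul]
  rw [Finset.sum_comm]
  have h3 : ∀ d ∈ D, ∑ c : F, ψ (c * d) * ψ (c * z) =
      if z = d then (Fintype.card F : ℤ) else 0 := by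
    intro d _
    simp_rw [← AddChar.map_add_eq_mul, ← mul_add]
    rw [AddChar.sum_mulShift _ hψ, Nat.cast_ite, Nat.cast_zero]
    exact if_congr (by rw [CharTwo.add_eq_zero, eq_comm]) rfl rfl
  rw [Finset.sum_congr rfl h3, Finset.sum_ite_eq]

omit [Fintype F] [CharP F 2] in
theorem charValue_zero (ψ : AddChar F ℤ) (D : Finset F) : charValue ψ D 0 = D.card := by
  simp [charValue]

/-- A Cayley graph on a field of characteristic two is strongly regular when the nontrivial values
of the indicator function of its connection set satisfy a quadratic equation. -/
theorem isSRGWith_of_quadratic (ψ : AddChar F ℤ) (hψ : ψ.IsPrimitive) (D : Finset F)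
    (h0 : (0 : F) ∉ D) {E A B : ℤ} (hE : E ≠ 0)
    (hquad : ∀ c ≠ 0, E * charValue ψ D c ^ 2 = A * charValue ψ D c + B) :
    ∃ l u : ℕ, (SimpleGraph.fromRel fun x y : F => x - y ∈ D).IsSRGWith
      (Fintype.card F) D.card l u := by
  set G := SimpleGraph.fromRel fun x y : F => x - y ∈ D with hG
  have hadj : ∀ x y, G.Adj x y ↔ x - y ∈ D := by
    intro x y
    rw [hG, SimpleGraph.fromRel_adj]
    constructor
    · rintro ⟨-, h | h⟩
      · exact h
      · rwa [CharTwo.sub_eq_add, add_comm, ← CharTwo.sub_eq_add]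
    · intro h
      refine ⟨?_, Or.inl h⟩
      rintro rfl
      exact h0 (by simpa using h)
  have hq : (Fintype.card F : ℤ) ≠ 0 := by exact_mod_cast Fintype.card_ne_zero
  let cn : F → ℕ := fun z => (D.filter fun d => z - d ∈ D).card
  have hcommon : ∀ v w, Fintype.card (G.commonNeighbors v w) = cn (v - w) := by
    intro v w
    rw [← Set.toFinset_card]
    refine Finset.card_bij (fun z _ => v - z) ?_ ?_ ?_
    · intro z hz
      rw [Set.mem_toFinset, SimpleGraph.mem_commonNeighbors, hadj, hadj] at hz
      rw [Finset.mem_filter]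
      refine ⟨hz.1, ?_⟩
      rw [show v - w - (v - z) = z - w by ring, CharTwo.sub_eq_add, add_comm,
        ← CharTwo.sub_eq_add]
      exact hz.2
    · intro x _ y _ h
      exact sub_right_injective h
    · intro d hd
      rw [Finset.mem_filter] at hd
      refine ⟨v - d, ?_, by ring⟩
      rw [Set.mem_toFinset, SimpleGraph.mem_commonNeighbors, hadj, hadj]
      refine ⟨by rw [show v - (v - d) = d by ring]; exact hd.1, ?_⟩
      rw [show w - (v - d) = -(v - w - d) by ring, CharTwo.neg_eq]
      exact hd.2
  have hformula : ∀ z ≠ 0, E * (Fintype.card F * cn z : ℤ) =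
      A * (if z ∈ D then (Fintype.card F : ℤ) else 0) +
        (E * D.card ^ 2 - A * D.card - B) := by
    intro z hz
    have hall : ∀ c : F, E * (charValue ψ D c ^ 2 * ψ (c * z)) =
        A * (charValue ψ D c * ψ (c * z)) + B * ψ (c * z) +
          if c = 0 then (E * D.card ^ 2 - A * D.card - B) else 0 := by
      intro c
      split_ifs with hc
      · rw [hc, charValue_zero, zero_mul, AddChar.map_zero_eq_one]; ring
      · rw [← mul_assoc, hquad c hc]; ring
    rw [← sum_charValue_sq_mul ψ hψ, Finset.mul_sum, Finset.sum_congr rfl fun c _ => hall c,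
      Finset.sum_add_distrib, Finset.sum_add_distrib, ← Finset.mul_sum, ← Finset.mul_sum,
      sum_charValue_mul ψ hψ, AddChar.sum_mulShift _ hψ, if_neg hz]
    simp
  have hcn : ∀ z z', z ≠ 0 → z' ≠ 0 → (z ∈ D ↔ z' ∈ D) → cn z = cn z' := by
    intro z z' hz hz' hiff
    have h := (hformula z hz).trans ((by rw [if_congr hiff rfl rfl]) : _ = _) |>.trans
      (hformula z' hz').symm
    exact_mod_cast mul_left_cancel₀ hq (mul_left_cancel₀ hE h)
  have hexists : ∀ P : F → Prop, (∀ z z', P z → P z' → cn z = cn z') →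
      ∃ l, ∀ z, P z → cn z = l := by
    intro P hP
    by_cases h : ∃ z, P z
    · obtain ⟨z, hz⟩ := h
      exact ⟨cn z, fun z' hz' => hP z' z hz' hz⟩
    · exact ⟨0, fun z hz => absurd ⟨z, hz⟩ h⟩
  have hne : ∀ z ∈ D, z ≠ 0 := by rintro z hz rfl; exact h0 hz
  obtain ⟨l, hl⟩ := hexists (fun z => z ∈ D)
    fun z z' hz hz' => hcn z z' (hne z hz) (hne z' hz') (iff_of_true hz hz')
  obtain ⟨u, hu⟩ := hexists (fun z => z ≠ 0 ∧ z ∉ D)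
    fun z z' hz hz' => hcn z z' hz.1 hz'.1 (iff_of_false hz.2 hz'.2)
  refine ⟨l, u, ⟨rfl, ?_, ?_, ?_⟩⟩
  · intro v
    rw [← SimpleGraph.card_neighborFinset_eq_degree]
    refine Finset.card_bij (fun z _ => v - z) ?_ ?_ ?_
    · intro z hz
      rwa [SimpleGraph.mem_neighborFinset, hadj] at hz
    · intro x _ y _ h
      exact sub_right_injective h
    · intro d hd
      refine ⟨v - d, ?_, by ring⟩
      rw [SimpleGraph.mem_neighborFinset, hadj, show v - (v - d) = d by ring]
      exact hd
  · intro v w h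
    rw [hcommon]
    exact hl _ ((hadj v w).mp h)
  · intro v w hvw h
    rw [hcommon]
    exact hu _ ⟨sub_ne_zero.mpr hvw, fun hd => h ((hadj v w).mpr hd)⟩

/-- Divisibility of all nontrivial values by a large power of two forces them to take at most two
values. -/
theorem quadratic_of_dvd (ψ : AddChar F ℤ) (hψ : ψ.IsPrimitive) (D : Finset F)
    (h0 : (0 : F) ∉ D) {b : ℕ} (hcard : Fintype.card F = 2 ^ (2 * b + 1)) (hb : b % 3 = 1)
    (hD : 7 * D.card = Fintype.card F - 1)
    (hdvd : ∀ c ≠ 0, (2 : ℤ) ^ b ∣ 7 * charValue ψ D c + 1) (c : F) (hc : c ≠ 0) :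
    49 * charValue ψ D c ^ 2 =
      (7 * 2 ^ b - 14) * charValue ψ D c + (12 * (2 ^ b) ^ 2 + 2 ^ b - 1) := by
  set Q : ℤ := 2 ^ b with hQ
  let g : F → ℤ := fun c => (7 * charValue ψ D c + 1 - 4 * Q) * (7 * charValue ψ D c + 1 + 3 * Q)
  have hqQ : (Fintype.card F : ℤ) = 2 * Q ^ 2 := by
    rw [hcard, hQ]; push_cast; ring
  have hDZ : 7 * (D.card : ℤ) = 2 * Q ^ 2 - 1 := by
    have : 1 ≤ Fintype.card F := Fintype.card_pos
    rw [← hqQ]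
    omega
  have hg : ∀ c ≠ 0, 0 ≤ g c := by
    intro c hc
    obtain ⟨t, ht⟩ := hdvd c hc
    have hQ7 : Q % 7 = 2 := by
      obtain ⟨j, rfl⟩ : ∃ j, b = 3 * j + 1 := ⟨b / 3, by omega⟩
      rw [hQ, pow_succ, pow_mul, Int.mul_emod]
      have h8 : ((2 : ℤ) ^ 3) ^ j % 7 = 1 := by
        have : ((2 : ℤ) ^ 3) ^ j ≡ 1 ^ j [ZMOD 7] := Int.ModEq.pow j (by decide)
        rw [one_pow] at this
        exact this
      rw [h8]; rfl
    have ht7 : t % 7 = 4 := by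
      have h1 : (Q * t) % 7 = 1 := by rw [← ht]; omega
      rw [Int.mul_emod, hQ7] at h1
      omega
    have hge : 0 ≤ (t - 4) * (t + 3) := by
      rcases le_or_gt 4 t with h | h
      · exact mul_nonneg (by omega) (by omega)
      · exact mul_nonneg_of_nonpos_of_nonpos (by omega) (by omega)
    have : g c = Q ^ 2 * ((t - 4) * (t + 3)) := by
      simp only [g]; rw [ht]; ring
    rw [this]
    positivity
  have hsum1 : ∑ c : F, charValue ψ D c = 0 := by
    have h := sum_charValue_mul ψ hψ D 0
    rw [if_neg h0] at h
    simpa using h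
  have hsum2 : ∑ c : F, charValue ψ D c ^ 2 = Fintype.card F * D.card := by
    have h := sum_charValue_sq_mul ψ hψ D 0
    rw [Finset.filter_true_of_mem fun d hd => by simpa [CharTwo.neg_eq] using hd] at h
    simpa using h
  have hgall : ∑ c : F, g c = g 0 := by
    have hexp : ∀ c, g c = 49 * charValue ψ D c ^ 2 + (14 - 7 * Q) * charValue ψ D c +
        (1 - 4 * Q) * (1 + 3 * Q) := by
      intro c; simp only [g]; ring
    rw [Finset.sum_congr rfl fun c _ => hexp c, Finset.sum_add_distrib, Finset.sum_add_distrib,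
      ← Finset.mul_sum, ← Finset.mul_sum, hsum1, hsum2, Finset.sum_const, Finset.card_univ,
      nsmul_eq_mul, hqQ]
    simp only [g, charValue_zero]
    linear_combination (14 * Q ^ 2 - (7 * D.card + 1) - 2 * Q ^ 2 + Q) * hDZ
  have hrest : ∑ c ∈ Finset.univ.erase (0 : F), g c = 0 := by
    have := Finset.add_sum_erase Finset.univ g (Finset.mem_univ (0 : F))
    omega
  have hzero := (Finset.sum_eq_zero_iff_of_nonneg fun c hc => hg c (Finset.ne_of_mem_erase hc)).mp
    hrest c (Finset.mem_erase.mpr ⟨hc, Finset.mem_univ c⟩)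
  simp only [g] at hzero
  linear_combination hzero

end TwoValued

section CyclotomicClasses

variable {F : Type} [Field F] [Fintype F] [CharP F 2]

theorem two_pow_dvd_of_intCast_dvd {b : ℕ} {z : ℤ}
    (h : (2 : WittVector 2 F) ^ b ∣ (z : WittVector 2 F)) :
    (2 : ℤ) ^ b ∣ z := by
  induction b generalizing z with
  | zero => simp
  | succ b ih =>
    have h2 : (2 : WittVector 2 F) ∣ (z : WittVector 2 F) := (dvd_pow_self 2 b.succ_ne_zero).trans h
    rw [two_dvd_iff_constantCoeff, map_intCast, CharP.intCast_eq_zero_iff F 2] at h2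
    obtain ⟨w, rfl⟩ := h2
    have h2ne : (2 : WittVector 2 F) ≠ 0 := by exact_mod_cast WittVector.p_nonzero 2 F
    push_cast at h ⊢
    rw [pow_succ'] at h ⊢
    exact mul_dvd_mul_left 2 (ih ((mul_dvd_mul_iff_left h2ne).mp h))

omit [CharP F 2] in
theorem exists_pow_eq_of_orderOf {γ : Fˣ} (hγ : orderOf γ = Fintype.card F - 1) (x : Fˣ) :
    ∃ e : ℕ, γ ^ e = x := by
  have htop : Subgroup.zpowers γ = ⊤ := by
    apply Subgroup.eq_top_of_card_eq
    rw [Nat.card_zpowers, hγ, Nat.card_eq_fintype_card, Fintype.card_units]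
  have hx : x ∈ Subgroup.zpowers γ := htop ▸ Subgroup.mem_top x
  rw [← mem_powers_iff_mem_zpowers] at hx
  exact hx

theorem invTeichmuller_pow_apply (k : ℕ) (x : Fˣ) :
    (invTeichmuller F ^ k) (x : F) = WittVector.teichmuller 2 (((x⁻¹) ^ k : Fˣ) : F) := by
  rw [MulChar.pow_apply_coe, invTeichmuller_apply, ← map_pow]
  simp

theorem invTeichmuller_pow_apply_eq_one_iff (k : ℕ) (x : Fˣ) :
    (invTeichmuller F ^ k) (x : F) = 1 ↔ x ^ k = 1 := by
  rw [invTeichmuller_pow_apply]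
  constructor
  · intro h
    have h1 : (((x⁻¹) ^ k : Fˣ) : F) = 1 := by
      rw [← WittVector.teichmuller_coeff_zero 2 (((x⁻¹) ^ k : Fˣ) : F), h,
        WittVector.one_coeff_zero]
    rwa [Units.val_eq_one, inv_pow, inv_eq_one] at h1
  · intro h
    rw [inv_pow, h, inv_one, Units.val_one, map_one]

theorem sum_range_pow_eq_ite {R : Type} [CommRing R] [IsDomain R] {N : ℕ} {z : R}
    (hz : z ^ N = 1) : ∑ u ∈ Finset.range N, z ^ u = if z = 1 then (N : R) else 0 := by
  split_ifs with h
  · simp [h]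
  · have := mul_geom_sum z N
    rw [hz, sub_self] at this
    exact (mul_eq_zero.mp this).resolve_left (sub_ne_zero.mpr h)

/-- Orthogonality relation: the sum of an additive character over a coset of the subgroup of
index `N` in terms of Gauss sums. -/
theorem sum_gaussSum_mulShift {γ : Fˣ} (hγ : orderOf γ = Fintype.card F - 1) {n N : ℕ}
    (hnN : n * N = Fintype.card F - 1) (hn : 0 < n) (hN : 0 < N) (Ψ : AddChar F (WittVector 2 F))
    (a : F) :
    ∑ u ∈ Finset.range N, gaussSum (invTeichmuller F ^ (n * u)) (Ψ.mulShift a) =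
      N * ∑ t ∈ Finset.range n, Ψ (a * ((γ ^ (N * t) : Fˣ) : F)) := by
  have hγpow : γ ^ (n * N) = 1 := by rw [hnN, ← hγ, pow_orderOf_eq_one]
  have hinj : Set.InjOn (fun t => ((γ ^ (N * t) : Fˣ) : F)) (Finset.range n) := by
    intro s hs t ht h
    have hs' : s < n := by simpa using hs
    have ht' : t < n := by simpa using ht
    have h1 : γ ^ (N * s) = γ ^ (N * t) := Units.ext h
    have hlt : ∀ i < n, N * i < orderOf γ := fun i hi => by
      rw [hγ, ← hnN, mul_comm n N]
      exact Nat.mul_lt_mul_of_pos_left hi hN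
    exact Nat.eq_of_mul_eq_mul_left hN (pow_injOn_Iio_orderOf (hlt s hs') (hlt t ht') h1)
  have himage : (Finset.range n).image (fun t => ((γ ^ (N * t) : Fˣ) : F)) =
      Finset.univ.filter fun x : F => (invTeichmuller F ^ n) x = 1 := by
    ext x
    simp only [Finset.mem_image, Finset.mem_range, Finset.mem_filter, Finset.mem_univ, true_and]
    constructor
    · rintro ⟨t, -, rfl⟩
      rw [invTeichmuller_pow_apply_eq_one_iff, ← pow_mul, mul_right_comm, mul_comm N n, pow_mul,
        hγpow, one_pow]
    · intro hx
      have hx0 : x ≠ 0 := by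
        rintro rfl
        rw [MulChar.map_zero] at hx
        exact zero_ne_one hx
      obtain ⟨e, he⟩ := exists_pow_eq_of_orderOf hγ (Units.mk0 x hx0)
      rw [← Units.val_mk0 hx0, ← he, invTeichmuller_pow_apply_eq_one_iff, ← pow_mul,
        ← orderOf_dvd_iff_pow_eq_one, hγ, ← hnN, mul_comm n N] at hx
      obtain ⟨s, rfl⟩ := Nat.dvd_of_mul_dvd_mul_right hn hx
      refine ⟨s % n, Nat.mod_lt _ hn, ?_⟩
      rw [← Units.val_mk0 hx0, ← he]
      congr 1
      conv_rhs => rw [← Nat.mod_add_div s n, mul_add, pow_add, ← mul_assoc, mul_comm N n,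
        pow_mul γ (n * N), hγpow, one_pow, mul_one]
  have hchar : ∀ x : F, ∑ u ∈ Finset.range N, (invTeichmuller F ^ (n * u)) x =
      if (invTeichmuller F ^ n) x = 1 then (N : WittVector 2 F) else 0 := by
    intro x
    by_cases hx : x = 0
    · subst hx
      rw [MulChar.map_zero, if_neg zero_ne_one]
      exact Finset.sum_eq_zero fun u _ => MulChar.map_zero _
    · rw [← Units.val_mk0 hx]
      simp_rw [pow_mul, MulChar.pow_apply_coe (invTeichmuller F ^ n)]
      apply sum_range_pow_eq_ite
      rw [← MulChar.pow_apply_coe, ← pow_mul, invTeichmuller_pow_apply_eq_one_iff, hnN,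
        ← Fintype.card_units, pow_card_eq_one]
  simp_rw [gaussSum, AddChar.mulShift_apply]
  rw [Finset.sum_comm]
  simp_rw [← Finset.sum_mul, hchar, ite_mul, zero_mul]
  rw [← Finset.sum_filter, ← himage, Finset.sum_image hinj, Finset.mul_sum]

variable {r n k : ℕ}

/-- A union of `7 ^ r` consecutive cyclotomic classes of order `7 ^ (r + 1)`. -/
def cyclotomicUnion (γ : Fˣ) (r n k : ℕ) : Finset F :=
  (Finset.range (7 ^ r) ×ˢ Finset.range n).image
    fun p => ((γ ^ (p.1 + k * 7 ^ r + 7 ^ (r + 1) * p.2) : Fˣ) : F)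

omit [CharP F 2] in
theorem injOn_cyclotomicUnion {γ : Fˣ} (hγ : orderOf γ = Fintype.card F - 1)
    (hnN : n * 7 ^ (r + 1) = Fintype.card F - 1) :
    Set.InjOn (fun p : ℕ × ℕ => ((γ ^ (p.1 + k * 7 ^ r + 7 ^ (r + 1) * p.2) : Fˣ) : F))
      (Finset.range (7 ^ r) ×ˢ Finset.range n : Finset (ℕ × ℕ)) := by
  rintro ⟨i, s⟩ hp ⟨j, t⟩ hq h
  simp only [Finset.coe_product, Finset.coe_range, Set.mem_prod, Set.mem_Iio] at hp hq
  have h1 : γ ^ (i + k * 7 ^ r + 7 ^ (r + 1) * s) = γ ^ (j + k * 7 ^ r + 7 ^ (r + 1) * t) :=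
    Units.ext h
  rw [add_right_comm, add_right_comm j, pow_add _ _ (k * 7 ^ r), pow_add _ _ (k * 7 ^ r)] at h1
  have h2 := mul_right_cancel h1
  have hM : 7 ^ r < 7 ^ (r + 1) := Nat.pow_lt_pow_right (by norm_num) (Nat.lt_succ_self r)
  have hlt : ∀ i < 7 ^ r, ∀ s < n, i + 7 ^ (r + 1) * s < orderOf γ := by
    intro i hi s hs
    rw [hγ, ← hnN, mul_comm n]
    calc i + 7 ^ (r + 1) * s < 7 ^ (r + 1) + 7 ^ (r + 1) * s := by omega
      _ = 7 ^ (r + 1) * (s + 1) := by ring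
      _ ≤ 7 ^ (r + 1) * n := Nat.mul_le_mul_left _ hs
  have h3 : i + 7 ^ (r + 1) * s = j + 7 ^ (r + 1) * t :=
    pow_injOn_Iio_orderOf (hlt i hp.1 s hp.2) (hlt j hq.1 t hq.2) h2
  have hij : i = j := by
    have := congrArg (· % 7 ^ (r + 1)) h3
    simpa [Nat.add_mul_mod_self_left, Nat.mod_eq_of_lt (hp.1.trans hM),
      Nat.mod_eq_of_lt (hq.1.trans hM)] using this
  subst hij
  rw [Nat.eq_of_mul_eq_mul_left (by positivity) (Nat.add_left_cancel h3)]

omit [CharP F 2] in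
theorem seven_mul_card_cyclotomicUnion {γ : Fˣ} (hγ : orderOf γ = Fintype.card F - 1)
    (hnN : n * 7 ^ (r + 1) = Fintype.card F - 1) :
    7 * (cyclotomicUnion γ r n k).card = Fintype.card F - 1 := by
  rw [cyclotomicUnion, Finset.card_image_of_injOn (injOn_cyclotomicUnion hγ hnN),
    Finset.card_product, Finset.card_range, Finset.card_range, ← hnN, pow_succ]
  ring

omit [Fintype F] [CharP F 2] in
theorem zero_notMem_cyclotomicUnion (γ : Fˣ) : (0 : F) ∉ cyclotomicUnion γ r n k := by
  intro h
  obtain ⟨p, -, hp⟩ := Finset.mem_image.mp h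
  exact Units.ne_zero _ hp

omit [CharP F 2] in
theorem mem_cyclotomicUnion_iff {γ : Fˣ} (hγ : orderOf γ = Fintype.card F - 1)
    (hnN : n * 7 ^ (r + 1) = Fintype.card F - 1) (hn : 0 < n) (x : F) :
    x ∈ cyclotomicUnion γ r n k ↔
      ∃ i < 7 ^ r, ∃ t : ℕ, x = (γ : F) ^ (i + k * 7 ^ r + 7 ^ (r + 1) * t) := by
  simp only [cyclotomicUnion, Finset.mem_image, Finset.mem_product, Finset.mem_range, Prod.exists]
  constructor
  · rintro ⟨i, t, ⟨hi, -⟩, rfl⟩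
    exact ⟨i, hi, t, by rw [Units.val_pow_eq_pow_val]⟩
  · rintro ⟨i, hi, t, rfl⟩
    refine ⟨i, t % n, ⟨hi, Nat.mod_lt _ hn⟩, ?_⟩
    rw [← Units.val_pow_eq_pow_val]
    congr 1
    have hγpow : γ ^ (7 ^ (r + 1) * n) = 1 := by
      rw [mul_comm, hnN, ← hγ, pow_orderOf_eq_one]
    conv_rhs => rw [← Nat.mod_add_div t n, mul_add, ← add_assoc, pow_add, ← mul_assoc, pow_mul,
      hγpow, one_pow, mul_one]

theorem two_pow_dvd_charValue_cyclotomicUnion {b : ℕ} {γ : Fˣ}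
    (hγ : orderOf γ = Fintype.card F - 1) (hcard : Fintype.card F = 2 ^ (3 * 7 ^ r))
    (hnN : n * 7 ^ (r + 1) = Fintype.card F - 1) (hn : 0 < n) (hb : 3 * 7 ^ r = 2 * b + 1)
    (ψ : AddChar F ℤ) (hψ : ψ.IsPrimitive) (hval : ∀ x, ψ x = 1 ∨ ψ x = -1)
    (hsq : ∀ x, ψ (x ^ 2) = ψ x) {c : F} (hc : c ≠ 0) :
    (2 : ℤ) ^ b ∣ 7 * charValue ψ (cyclotomicUnion γ r n k) c + 1 := by
  let Ψ : AddChar F (WittVector 2 F) := (Int.castRingHom (WittVector 2 F)).toMonoidHom.compAddChar ψ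
  have hΨ : ∀ x, Ψ x = (ψ x : WittVector 2 F) := fun x => rfl
  have hΨval : ∀ x, Ψ x = 1 ∨ Ψ x = -1 := by
    intro x
    rcases hval x with h | h <;> simp [hΨ, h]
  have hΨsq : ∀ x, Ψ (x ^ 2) = Ψ x := fun x => by rw [hΨ, hΨ, hsq]
  have h2ne : (2 : WittVector 2 F) ≠ 0 := by exact_mod_cast WittVector.p_nonzero 2 F
  have hΨne : Ψ ≠ 1 := by
    have hψne : ψ ≠ 1 := by
      have := hψ one_ne_zero
      rwa [AddChar.mulShift_one] at this
    obtain ⟨x, hx⟩ := AddChar.ne_one_iff.mp hψne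
    refine AddChar.ne_one_iff.mpr ⟨x, fun h => ?_⟩
    rw [hΨ, (hval x).resolve_left hx] at h
    apply h2ne
    push_cast at h
    linear_combination -h
  have hM1 : 1 ≤ 7 ^ r := Nat.one_le_pow _ _ (by norm_num)
  let a : ℕ → Fˣ := fun i => Units.mk0 c hc * γ ^ (i + k * 7 ^ r)
  have hterm : ∀ u ∈ Finset.range (7 ^ (r + 1)), u ≠ 0 →
      (2 : WittVector 2 F) ^ b ∣ ∑ i ∈ Finset.range (7 ^ r),
        gaussSum (invTeichmuller F ^ (n * u)) (Ψ.mulShift (a i)) := by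
    intro u hu hu0
    have hu' : u < 7 ^ (r + 1) := Finset.mem_range.mp hu
    simp_rw [gaussSum_mulShift_eq, ← Finset.sum_mul]
    by_cases h7 : 7 ∣ u
    · suffices h : ∑ i ∈ Finset.range (7 ^ r), (invTeichmuller F ^ (n * u))⁻¹ (a i : F) = 0 by
        rw [h, zero_mul]
        exact dvd_zero _
      have hsplit : ∀ i, (invTeichmuller F ^ (n * u))⁻¹ (a i : F) =
          (invTeichmuller F ^ (n * u))⁻¹ (c * (γ : F) ^ (k * 7 ^ r)) *
            ((invTeichmuller F ^ (n * u)) ((γ⁻¹ : Fˣ) : F)) ^ i := by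
        intro i
        rw [Units.val_inv_eq_inv_val, ← MulChar.inv_apply', ← map_pow, ← map_mul]
        congr 1
        simp only [a, Units.val_mul, Units.val_mk0, Units.val_pow_eq_pow_val, pow_add]
        ring
      simp_rw [hsplit]
      rw [← Finset.mul_sum, sum_range_pow_eq_ite, if_neg, mul_zero]
      · rw [invTeichmuller_pow_apply_eq_one_iff, inv_pow, inv_eq_one,
          ← orderOf_dvd_iff_pow_eq_one, hγ, ← hnN]
        intro h
        exact absurd (Nat.le_of_dvd (by omega) (Nat.dvd_of_mul_dvd_mul_left hn h)) (by omega)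
      · obtain ⟨v, rfl⟩ := h7
        rw [← MulChar.pow_apply_coe, ← pow_mul, invTeichmuller_pow_apply_eq_one_iff, inv_pow,
          inv_eq_one, ← orderOf_dvd_iff_pow_eq_one, hγ, ← hnN]
        exact ⟨v, by ring⟩
    · refine Dvd.dvd.mul_left ?_ _
      have hq1 : 2 ^ (3 * 7 ^ r) - 1 = n * 7 ^ (r + 1) := by rw [hnN, hcard]
      refine two_pow_dvd_gaussSum (by omega) hcard Ψ hΨval hΨsq (n * u) b ?_ ?_
      · rw [hq1]
        exact Nat.mul_lt_mul_of_pos_left hu' hn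
      · rw [hq1]
        simp_rw [mul_left_comm _ n u, Nat.mul_mod_mul_left]
        rw [← Finset.mul_sum, mul_left_comm]
        exact Nat.mul_le_mul_left n (mul_le_sum_two_pow_mul_mod hb h7)
  have hzero : ∑ i ∈ Finset.range (7 ^ r),
        gaussSum (invTeichmuller F ^ (n * 0)) (Ψ.mulShift (a i)) = -(7 ^ r : ℕ) := by
    simp_rw [gaussSum_mulShift_eq, mul_zero, pow_zero, inv_one, MulChar.one_apply_coe,
      gaussSum_one_left hΨne]
    simp
  have htotal : ∑ u ∈ Finset.range (7 ^ (r + 1)), ∑ i ∈ Finset.range (7 ^ r),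
        gaussSum (invTeichmuller F ^ (n * u)) (Ψ.mulShift (a i)) =
      ((7 ^ (r + 1) * charValue ψ (cyclotomicUnion γ r n k) c : ℤ) : WittVector 2 F) := by
    rw [Finset.sum_comm, Finset.sum_congr rfl fun i _ =>
      sum_gaussSum_mulShift hγ hnN hn (by positivity) Ψ (a i), ← Finset.mul_sum, charValue,
      cyclotomicUnion, Finset.sum_image (injOn_cyclotomicUnion hγ hnN), Finset.sum_product]
    push_cast
    congr 1
    refine Finset.sum_congr rfl fun i _ => Finset.sum_congr rfl fun t _ => ?_
    rw [hΨ]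
    congr 2
    simp only [a, Units.val_mul, Units.val_mk0, Units.val_pow_eq_pow_val]
    ring
  rw [← Finset.add_sum_erase _ _ (Finset.mem_range.mpr (by positivity : 0 < 7 ^ (r + 1))),
    hzero] at htotal
  have hdvd : (2 : WittVector 2 F) ^ b ∣
      ((7 ^ r * (7 * charValue ψ (cyclotomicUnion γ r n k) c + 1) : ℤ) : WittVector 2 F) := by
    have h := Finset.dvd_sum fun u hu =>
      hterm u (Finset.mem_of_mem_erase hu) (Finset.ne_of_mem_erase hu)
    convert h using 1
    rw [neg_add_eq_iff_eq_add] at htotal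
    rw [htotal]
    push_cast
    ring
  have hcop : IsCoprime ((2 : ℤ) ^ b) (7 ^ r) := by
    apply IsCoprime.pow
    exact ⟨-3, 1, by norm_num⟩
  exact hcop.dvd_of_dvd_mul_left (two_pow_dvd_of_intCast_dvd hdvd)

end CyclotomicClasses

theorem SimpleGraph.IsSRGWith.ne_top_of_add_one_lt {V : Type} [Fintype V] {G : SimpleGraph V}
    [DecidableRel G.Adj] {n k l u : ℕ} (h : G.IsSRGWith n k l u) (hk : k + 1 < n) : G ≠ ⊤ := by
  rintro rfl
  have hcard := h.card
  obtain ⟨v⟩ : Nonempty V := Fintype.card_pos_iff.mp (by omega)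
  have hdeg := h.regular v
  have hle : (Finset.univ.erase v).card ≤ k := by
    rw [← hdeg, ← SimpleGraph.card_neighborFinset_eq_degree]
    refine Finset.card_le_card fun w hw => ?_
    rw [SimpleGraph.mem_neighborFinset, SimpleGraph.top_adj]
    exact (Finset.ne_of_mem_erase hw).symm
  rw [Finset.card_erase_of_mem (Finset.mem_univ v), Finset.card_univ] at hle
  omega

theorem SimpleGraph.IsSRGWith.ne_bot_of_pos {V : Type} [Fintype V] [Nonempty V] {G : SimpleGraph V}
    [DecidableRel G.Adj] {n k l u : ℕ} (h : G.IsSRGWith n k l u) (hk : 0 < k) : G ≠ ⊥ := by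
  rintro rfl
  have hdeg := h.regular (Classical.arbitrary V)
  rw [← SimpleGraph.card_neighborSet_eq_degree] at hdeg
  simp at hdeg
  omega

/-- Each `Cay(F_q, D_k)` is a strongly regular graph of degree `(q-1)/7`,
where `q = 2^{3*7^(m-1)}`, `N = 7^m`. -/
theorem cayley_srg_example_14
    (m N q : ℕ) (hm : 1 ≤ m)
    (hN : N = 7 ^ m) (hq : q = 2 ^ (3 * 7 ^ (m - 1)))
    (F : Type) [Field F] [Fintype F] (hF : Fintype.card F = q)
    (γ : Fˣ) (hγ : orderOf γ = q - 1)
    (D : ℕ → Set F)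
    (hD : ∀ k, D k = {x : F | ∃ i < 7 ^ (m - 1), ∃ t : ℕ,
        x = ((γ : F)) ^ (i + k * 7 ^ (m - 1) + N * t)}) :
    ∀ k ≤ 6,
      SimpleGraph.fromRel (fun x y : F => x - y ∈ D k) ≠ ⊤ ∧
      SimpleGraph.fromRel (fun x y : F => x - y ∈ D k) ≠ ⊥ ∧
      ∃ l u : ℕ, (SimpleGraph.fromRel (fun x y : F => x - y ∈ D k)).IsSRGWith
        q ((q - 1) / 7) l u := by
  intro k _
  obtain ⟨r, rfl⟩ : ∃ r, m = r + 1 := ⟨m - 1, by omega⟩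
  rw [Nat.add_sub_cancel] at hq hD
  subst hN
  subst hF
  have : CharP F 2 := charP_of_card_eq_prime_pow hq
  have hM1 : 1 ≤ 7 ^ r := Nat.one_le_pow _ _ (by norm_num)
  have hq8 : 8 ≤ Fintype.card F := by
    calc 8 = 2 ^ 3 := rfl
      _ ≤ 2 ^ (3 * 7 ^ r) := Nat.pow_le_pow_right (by norm_num) (by omega)
      _ = Fintype.card F := hq.symm
  obtain ⟨n, hn⟩ := seven_pow_succ_dvd_eight_pow_sub_one r
  have hnN : n * 7 ^ (r + 1) = Fintype.card F - 1 := by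
    rw [hq, pow_mul, mul_comm, ← hn]
    norm_num
  have hn0 : 0 < n := by
    rcases Nat.eq_zero_or_pos n with rfl | h
    · omega
    · exact h
  obtain ⟨b, hb⟩ : ∃ b, 3 * 7 ^ r = 2 * b + 1 := by
    have : Odd (3 * 7 ^ r) := Odd.mul (by decide) (Odd.pow (by decide))
    exact this
  have hDk : D k = ↑(cyclotomicUnion γ r n k) := by
    ext x
    rw [hD, Finset.mem_coe, mem_cyclotomicUnion_iff hγ hnN hn0]
    rfl
  have hcardD := seven_mul_card_cyclotomicUnion (k := k) hγ hnN
  have h0 := zero_notMem_cyclotomicUnion (r := r) (n := n) (k := k) γ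
  obtain ⟨ψ, hψ, hval, hsq⟩ := exists_primitive_addChar F
  have hquad := quadratic_of_dvd ψ hψ (cyclotomicUnion γ r n k) h0 (hb ▸ hq) (by omega) hcardD
    fun c hc => two_pow_dvd_charValue_cyclotomicUnion hγ hq hnN hn0 hb ψ hψ hval hsq hc
  obtain ⟨l, u, hsrg⟩ := isSRGWith_of_quadratic ψ hψ _ h0 (by norm_num) hquad
  rw [show (cyclotomicUnion γ r n k).card = (Fintype.card F - 1) / 7 by omega] at hsrg
  simp_rw [hDk, Finset.mem_coe]
  exact ⟨hsrg.ne_top_of_add_one_lt (by omega), hsrg.ne_bot_of_pos (by omega), l, u, hsrg⟩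
end
end

section
/- Let m ≥ 1, p = 3, p1 = 107, N = 107^m, and q = 3^{53·107^{m−1}}. Then for every k with 0 ≤ k ≤ 106, the Cayley graph Cay(F_q, D_k) is a strongly regular graph of degree (q−1)/107, where D_k = ∪_{i=0}^{107^{m−1}−1} C_{i + k·107^{m−1}}. -/
open scoped Classical

noncomputable section

theorem sum_range_comp_of_injOn {M : Type*} [AddCommMonoid M] {n : ℕ} (φ : ℕ → ℕ) (g : ℕ → M)
    (hφ : ∀ u < n, φ u < n) (hinj : ∀ u < n, ∀ v < n, φ u = φ v → u = v) :
    ∑ u ∈ Finset.range n, g (φ u) = ∑ u ∈ Finset.range n, g u := by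
  have hi : Set.InjOn φ (Finset.range n : Set ℕ) := fun u hu v hv h =>
    hinj u (by simpa using hu) v (by simpa using hv) h
  have himg : (Finset.range n).image φ = Finset.range n := by
    apply Finset.eq_of_subset_of_card_le
    · intro x hx
      obtain ⟨u, hu, rfl⟩ := Finset.mem_image.1 hx
      exact Finset.mem_range.2 (hφ u (Finset.mem_range.1 hu))
    · rw [Finset.card_image_of_injOn hi]
  conv_rhs => rw [← himg]
  rw [Finset.sum_image hi]

theorem exists_eq_of_injOn_range {n : ℕ} (φ : ℕ → ℕ)
    (hφ : ∀ u < n, φ u < n) (hinj : ∀ u < n, ∀ v < n, φ u = φ v → u = v) {y : ℕ} (hy : y < n) :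
    ∃ u < n, φ u = y := by
  have h := Finset.surj_on_of_inj_on_of_card_le (s := Finset.range n) (t := Finset.range n)
    (fun a _ => φ a) (fun a ha => Finset.mem_range.2 (hφ a (Finset.mem_range.1 ha)))
    (fun a b ha hb => hinj a (Finset.mem_range.1 ha) b (Finset.mem_range.1 hb)) le_rfl y
    (Finset.mem_range.2 hy)
  obtain ⟨a, ha, h⟩ := h
  exact ⟨a, Finset.mem_range.1 ha, h.symm⟩

theorem sum_range_mul_eq {M : Type*} [AddCommMonoid M] (a n : ℕ) (g : ℕ → M) :
    ∑ b ∈ Finset.range (a * n), g b =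
      ∑ i ∈ Finset.range a, ∑ j ∈ Finset.range n, g (j + n * i) := by
  induction a with
  | zero => simp
  | succ a ih =>
    rw [Nat.succ_mul, Finset.sum_range_add, ih, Finset.sum_range_succ]
    simp only [add_comm _ (n * a), mul_comm a n]

theorem sum_range_add_periodic {M : Type*} [AddCancelCommMonoid M] {u : ℕ → M} {f : ℕ}
    (hu : ∀ l, u (l + f) = u l) (j : ℕ) :
    ∑ l ∈ Finset.range f, u (l + j) = ∑ l ∈ Finset.range f, u l := by
  induction j with
  | zero => simp
  | succ j ih =>
    rw [← ih]
    have h1 := Finset.sum_range_succ (fun l => u (l + j)) f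
    have h2 := Finset.sum_range_succ' (fun l => u (l + j)) f
    have h3 : u (f + j) = u (0 + j) := by rw [add_comm f j, hu, zero_add]
    rw [h1, h3] at h2
    simp only [add_right_comm _ 1 j, add_assoc] at h2 ⊢
    exact (add_right_cancel h2).symm

/-- The cyclic shifts of the base-3 expansion of `c`, folded modulo `3 ^ f - 1`. -/
theorem exists_shifts {f : ℕ} (c : ℕ) :
    ∃ u : ℕ → ℕ, (∀ l, u l ≡ 3 ^ l * c [MOD 3 ^ f - 1]) ∧ (c ≠ 0 → ∀ l, 0 < u l) ∧
      (∀ l, u (l + f) = u l) ∧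
      2 * ∑ l ∈ Finset.range f, u l = (Nat.digits 3 c).sum * (3 ^ f - 1) := by
  induction c using Nat.strong_induction_on with
  | _ c ih =>
    rcases Nat.eq_zero_or_pos c with rfl | hc
    · exact ⟨fun _ => 0, by simp [Nat.ModEq], by simp, by simp, by simp⟩
    obtain ⟨u, h1, h2, h3, h4⟩ := ih (c / 3) (by omega)
    have hpow : 3 ^ f ≡ 1 [MOD 3 ^ f - 1] :=
      ((Nat.modEq_iff_dvd' (Nat.one_le_pow f 3 (by norm_num))).2 dvd_rfl).symm
    have hmod : ∀ l, 3 ^ (l % f) ≡ 3 ^ l [MOD 3 ^ f - 1] := fun l => by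
      conv_rhs => rw [← Nat.mod_add_div l f, pow_add, pow_mul]
      simpa using (Nat.ModEq.refl (3 ^ (l % f))).mul (hpow.pow (l / f)).symm
    refine ⟨fun l => u (l + 1) + c % 3 * 3 ^ (l % f), fun l => ?_, fun _ l => ?_, fun l => ?_, ?_⟩
    · have h : 3 ^ l * c = 3 ^ (l + 1) * (c / 3) + c % 3 * 3 ^ l := by
        conv_lhs => rw [← Nat.div_add_mod c 3]
        ring
      rw [h]
      exact (h1 _).add ((hmod l).mul_left _)
    · rcases Nat.eq_zero_or_pos (c % 3) with h | h
      · have := h2 (by omega) (l + 1)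
        positivity
      · positivity
    · simp only [Nat.add_mod_right]
      rw [add_right_comm, h3]
    · have hg := Nat.geomSum_eq (m := 3) (by norm_num) f
      have h5 : 2 * ∑ l ∈ Finset.range f, 3 ^ (l % f) = 3 ^ f - 1 := by
        rw [Finset.sum_congr rfl fun l hl => by
          rw [Nat.mod_eq_of_lt (Finset.mem_range.1 hl)], hg]
        exact Nat.mul_div_cancel' (by simpa using Nat.sub_one_dvd_pow_sub_one 3 f)
      rw [Finset.sum_add_distrib, sum_range_add_periodic h3, ← Finset.mul_sum, mul_add, h4,
        mul_left_comm, h5, Nat.digits_def' (by norm_num) hc, List.sum_cons]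
      ring

theorem exists_shifts_sum {f : ℕ} (c : ℕ → ℕ) (hc : ∃ j < f, c j ≠ 0) :
    ∃ u : ℕ → ℕ, (∀ l, u l ≡ 3 ^ l * ∑ j ∈ Finset.range f, c j * 3 ^ j [MOD 3 ^ f - 1]) ∧
      (∀ l, 0 < u l) ∧
      2 * ∑ l ∈ Finset.range f, u l =
        (∑ j ∈ Finset.range f, (Nat.digits 3 (c j)).sum) * (3 ^ f - 1) := by
  choose u h1 h2 h3 h4 using fun j => exists_shifts (f := f) (c j)
  refine ⟨fun l => ∑ j ∈ Finset.range f, u j (l + j), fun l => ?_, fun l => ?_, ?_⟩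
  · rw [Finset.mul_sum]
    have : ∀ s : Finset ℕ, ∑ j ∈ s, u j (l + j) ≡ ∑ j ∈ s, 3 ^ l * (c j * 3 ^ j)
        [MOD 3 ^ f - 1] := fun s => by
      induction s using Finset.induction_on with
      | empty => simp [Nat.ModEq]
      | insert a s ha ih =>
        rw [Finset.sum_insert ha, Finset.sum_insert ha]
        refine Nat.ModEq.add ?_ ih
        convert h1 a (l + a) using 1
        ring
    exact this _
  · obtain ⟨j, hj, hcj⟩ := hc
    exact lt_of_lt_of_le (h2 j hcj (l + j))
      (Finset.single_le_sum (f := fun j => u j (l + j)) (fun _ _ => Nat.zero_le _)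
        (Finset.mem_range.2 hj))
  · rw [Finset.sum_comm, Finset.mul_sum, Finset.sum_mul]
    exact Finset.sum_congr rfl fun j _ => by rw [sum_range_add_periodic (h3 j), h4]

theorem dvd_three_pow_sub_one_iff {m n : ℕ} (hm : 1 ≤ m) :
    107 ^ m ∣ 3 ^ (53 * n) - 1 ↔ 107 ^ (m - 1) ∣ n := by
  have hp : Nat.Prime 107 := by norm_num
  have h := Nat.emultiplicity_pow_sub_pow hp (by decide) (x := 3 ^ 53) (y := 1) (by norm_num)
    (by norm_num) n
  have h1 : emultiplicity 107 (3 ^ 53 - 1) = 1 := by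
    rw [show (1 : ℕ∞) = ((1 : ℕ) : ℕ∞) by simp, emultiplicity_eq_coe]
    norm_num
  rw [h1, one_pow, ← pow_mul] at h
  obtain ⟨k, rfl⟩ : ∃ k, m = k + 1 := ⟨m - 1, by omega⟩
  rw [pow_dvd_iff_le_emultiplicity, h, Nat.add_sub_cancel, pow_dvd_iff_le_emultiplicity]
  push_cast
  rw [add_comm (1 : ℕ∞)]
  exact ENat.add_le_add_iff_right ENat.one_ne_top

theorem three_pow_mul_injOn {m a : ℕ} (hm : 1 ≤ m) (ha : ¬ 107 ∣ a) {u v : ℕ}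
    (hu : u < 107 ^ (m - 1)) (hv : v < 107 ^ (m - 1))
    (h : 3 ^ (53 * u) * a ≡ 3 ^ (53 * v) * a [MOD 107 ^ m]) : u = v := by
  wlog huv : u ≤ v generalizing u v
  · exact (this hv hu h.symm (by omega)).symm
  have hp : Nat.Prime 107 := by norm_num
  have hca : Nat.Coprime (107 ^ m) a := Nat.Coprime.pow_left _ ((hp.coprime_iff_not_dvd).2 ha)
  have hc3 : Nat.Coprime (107 ^ m) (3 ^ (53 * u)) := Nat.Coprime.pow _ _ (by norm_num)
  have h1 := Nat.ModEq.cancel_right_of_coprime hca h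
  have h2 : 107 ^ m ∣ 3 ^ (53 * v) - 3 ^ (53 * u) :=
    (Nat.modEq_iff_dvd' (Nat.pow_le_pow_right (by norm_num) (by omega))).1 h1
  have h3 : 3 ^ (53 * v) - 3 ^ (53 * u) = 3 ^ (53 * u) * (3 ^ (53 * (v - u)) - 1) := by
    rw [Nat.mul_sub, ← pow_add, mul_one]
    congr 2
    omega
  rw [h3] at h2
  have h4 := (dvd_three_pow_sub_one_iff hm).1 (hc3.dvd_of_dvd_mul_left h2)
  have := Nat.eq_zero_of_dvd_of_lt h4 (by omega)
  omega

theorem three_pow_mul_mod {m a u : ℕ} (hm : 1 ≤ m) :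
    3 ^ (53 * u) * a % 107 ^ m % 107 = a % 107 := by
  rw [Nat.mod_mod_of_dvd _ (dvd_pow_self _ (by omega)), pow_mul]
  have : 3 ^ 53 ≡ 1 [MOD 107] := by decide
  have h := (this.pow u).mul_right a
  rwa [one_pow, one_mul] at h

theorem div_lt_pow_pred {m b : ℕ} (hm : 1 ≤ m) : b % 107 ^ m / 107 < 107 ^ (m - 1) := by
  rw [Nat.div_lt_iff_lt_mul (by norm_num), ← pow_succ, Nat.sub_add_cancel hm]
  exact Nat.mod_lt _ (by positivity)

theorem three_pow_mul_div_injOn {m a : ℕ} (hm : 1 ≤ m) (ha : ¬ 107 ∣ a) {u v : ℕ}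
    (hu : u < 107 ^ (m - 1)) (hv : v < 107 ^ (m - 1))
    (h : 3 ^ (53 * u) * a % 107 ^ m / 107 = 3 ^ (53 * v) * a % 107 ^ m / 107) : u = v := by
  apply three_pow_mul_injOn hm ha hu hv
  have h1 := three_pow_mul_mod (a := a) (u := u) hm
  have h2 := three_pow_mul_mod (a := a) (u := v) hm
  unfold Nat.ModEq
  omega

theorem exists_three_pow_mul_modEq {m a b : ℕ} (hm : 1 ≤ m) (ha : ¬ 107 ∣ a)
    (hab : a ≡ b [MOD 107]) : ∃ l, 3 ^ l * a ≡ b [MOD 107 ^ m] := by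
  obtain ⟨u, _, hu⟩ := exists_eq_of_injOn_range (n := 107 ^ (m - 1))
    (fun u => 3 ^ (53 * u) * a % 107 ^ m / 107) (fun _ _ => div_lt_pow_pred hm)
    (fun u hu v hv h => three_pow_mul_div_injOn hm ha hu hv h)
    (y := b % 107 ^ m / 107) (div_lt_pow_pred hm)
  refine ⟨53 * u, ?_⟩
  have h1 := three_pow_mul_mod (a := a) (u := u) hm
  have h2 : b % 107 ^ m % 107 = b % 107 := Nat.mod_mod_of_dvd _ (dvd_pow_self _ (by omega))
  unfold Nat.ModEq at hab ⊢
  omega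

theorem exists_three_pow_mul_add_modEq {m b : ℕ} (hb : ¬ 107 ^ (m - 1) ∣ b) :
    ∃ l, 3 ^ l * b ≡ b + 107 ^ (m - 1) [MOD 107 ^ m] := by
  have hp : Nat.Prime 107 := by norm_num
  have hb0 : b ≠ 0 := by rintro rfl; exact hb (dvd_zero _)
  obtain ⟨s, a, ha, rfl⟩ := Nat.exists_eq_pow_mul_and_not_dvd hb0 107 (by norm_num)
  have hs : s < m - 1 := by
    by_contra h
    exact hb (dvd_mul_of_dvd_left (pow_dvd_pow _ (by omega)) _)
  have hmod : a ≡ a + 107 ^ (m - 1 - s) [MOD 107] := by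
    have h0 : 107 ^ (m - 1 - s) ≡ 0 [MOD 107] :=
      (Nat.modEq_zero_iff_dvd).2 (dvd_pow_self _ (by omega))
    simpa using (h0.add_left a).symm
  obtain ⟨l, hl⟩ := exists_three_pow_mul_modEq (m := m - s) (by omega) ha hmod
  refine ⟨l, ?_⟩
  have h := Nat.ModEq.mul_left' (107 ^ s) hl
  rw [mul_add, ← pow_add, ← pow_add, show s + (m - s) = m by omega,
    show s + (m - 1 - s) = m - 1 by omega] at h
  rwa [mul_left_comm] at h

theorem sum_three_pow_mod_ge (a : ℕ) (ha : ¬ 107 ∣ a) :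
    2675 ≤ ∑ l ∈ Finset.range 53, 3 ^ l * a % 107 := by
  have h : ∀ r < 107, r ≠ 0 → 2675 ≤ ∑ l ∈ Finset.range 53, (3 ^ l % 107) * r % 107 := by
    decide +kernel
  refine (h (a % 107) (Nat.mod_lt _ (by norm_num)) (by omega)).trans_eq ?_
  exact Finset.sum_congr rfl fun l _ => (Nat.mul_mod _ _ _).symm

theorem sum_three_pow_mul_mod_ge {m a : ℕ} (hm : 1 ≤ m) (ha : ¬ 107 ∣ a) :
    107 ^ m * (53 * 107 ^ (m - 1) - 3) ≤
      2 * ∑ l ∈ Finset.range (53 * 107 ^ (m - 1)), 3 ^ l * a % 107 ^ m := by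
  have hp : Nat.Prime 107 := by norm_num
  set n := 107 ^ (m - 1) with hn
  have hnm : 107 ^ m = 107 * n := by rw [hn, ← pow_succ', Nat.sub_add_cancel hm]
  have hn1 : 1 ≤ n := Nat.one_le_pow _ _ (by norm_num)
  have hinner : ∀ l, ∑ u ∈ Finset.range n, 3 ^ (l + 53 * u) * a % 107 ^ m =
      n * (3 ^ l * a % 107) + 107 * ∑ u ∈ Finset.range n, u := fun l => by
    have hla : ¬ 107 ∣ 3 ^ l * a := fun h => by
      rcases (hp.dvd_mul).1 h with h | h
      · exact absurd (hp.dvd_of_dvd_pow h) (by norm_num)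
      · exact ha h
    rw [← sum_range_comp_of_injOn (fun u => 3 ^ (53 * u) * (3 ^ l * a) % 107 ^ m / 107)
      (fun u => u) (fun _ _ => div_lt_pow_pred hm)
      (fun u hu v hv h => three_pow_mul_div_injOn hm hla hu hv h), Finset.mul_sum]
    have : n * (3 ^ l * a % 107) = ∑ u ∈ Finset.range n, 3 ^ l * a % 107 := by simp
    rw [this, ← Finset.sum_add_distrib]
    refine Finset.sum_congr rfl fun u _ => ?_
    have h1 := three_pow_mul_mod (a := 3 ^ l * a) (u := u) hm
    rw [pow_add, mul_comm (3 ^ l), mul_assoc]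
    omega
  have hsplit : ∀ g : ℕ → ℕ, ∑ l ∈ Finset.range (53 * n), g l =
      ∑ l ∈ Finset.range 53, ∑ u ∈ Finset.range n, g (l + 53 * u) := fun g => by
    rw [Finset.sum_comm, mul_comm, sum_range_mul_eq]
  rw [hsplit, Finset.sum_congr rfl fun l _ => hinner l, Finset.sum_add_distrib, ← Finset.mul_sum,
    Finset.sum_const, Finset.card_range, smul_eq_mul]
  have h1 := sum_three_pow_mod_ge a ha
  have h2 := Finset.sum_range_id_mul_two n
  have h3 : n * 2675 ≤ n * ∑ l ∈ Finset.range 53, 3 ^ l * a % 107 := Nat.mul_le_mul_left _ h1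
  rw [hnm]
  clear_value n
  obtain ⟨k, rfl⟩ : ∃ k, n = k + 1 := ⟨n - 1, by omega⟩
  simp only [Nat.add_sub_cancel] at h2
  rw [show 53 * (k + 1) - 3 = 53 * k + 50 by omega]
  nlinarith

theorem le_sum_digits_of_eq_mul {m Q f : ℕ} (hm : 1 ≤ m) (hf : f = 53 * 107 ^ (m - 1))
    (hQ : 107 ^ m * Q = 3 ^ f - 1) {c : ℕ → ℕ} (hc : ∃ j < f, c j ≠ 0) {a : ℕ}
    (hY : ∑ j ∈ Finset.range f, c j * 3 ^ j = a * Q) (ha : ¬ 107 ∣ a ∨ 107 ^ m ∣ a) :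
    f - 3 ≤ ∑ j ∈ Finset.range f, (Nat.digits 3 (c j)).sum := by
  obtain ⟨u, h1, h2, h3⟩ := exists_shifts_sum c hc
  set W := ∑ j ∈ Finset.range f, (Nat.digits 3 (c j)).sum
  rw [hY, ← hQ] at h1
  rw [← hQ] at h3
  have hf0 : f ≠ 0 := by rw [hf]; positivity
  have hNQ : 0 < 107 ^ m * Q := by
    rw [hQ]
    exact Nat.sub_pos_of_lt (Nat.one_lt_pow hf0 (by norm_num))
  have hQ0 : 0 < Q := Nat.pos_of_mul_pos_left hNQ
  have hN0 : 0 < 107 ^ m := by positivity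
  rcases ha with ha | ha
  · have hdvd : ∀ l, Q ∣ u l := fun l =>
      ((h1 l).dvd_iff (dvd_mul_left Q _)).2 (Dvd.intro_left _ (mul_assoc _ _ _))
    choose v hv using hdvd
    have hle : ∀ l, 3 ^ l * a % 107 ^ m ≤ v l := fun l => by
      have h := h1 l
      rw [hv, ← mul_assoc, mul_comm _ Q, mul_comm _ Q] at h
      have h := Nat.ModEq.mul_left_cancel' hQ0.ne' h
      rw [← h]
      exact Nat.mod_le _ _
    have h4 : 2 * ∑ l ∈ Finset.range f, v l = W * 107 ^ m := by
      apply Nat.eq_of_mul_eq_mul_left hQ0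
      rw [mul_left_comm, Finset.mul_sum, ← Finset.sum_congr rfl fun l _ => hv l, h3]
      ring
    have h5 := sum_three_pow_mul_mod_ge hm ha
    rw [← hf] at h5
    have h6 := Finset.sum_le_sum fun l (_ : l ∈ Finset.range f) => hle l
    apply Nat.le_of_mul_le_mul_left _ hN0
    linarith
  · have hge : ∀ l, 107 ^ m * Q ≤ u l := fun l => by
      apply Nat.le_of_dvd (h2 l)
      refine ((h1 l).dvd_iff dvd_rfl).2 ?_
      exact dvd_mul_of_dvd_right (mul_dvd_mul_right ha Q) _
    have h4 : f * (107 ^ m * Q) ≤ ∑ l ∈ Finset.range f, u l := by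
      simpa using Finset.sum_le_sum fun l (_ : l ∈ Finset.range f) => hge l
    have h5 : f ≤ W := by
      apply Nat.le_of_mul_le_mul_right _ hNQ
      have := Nat.zero_le (f * (107 ^ m * Q))
      linarith
    omega

theorem two_mul_padicValNat_prod_factorial (s : Finset ℕ) (c : ℕ → ℕ) :
    2 * padicValNat 3 (∏ j ∈ s, (c j).factorial) + ∑ j ∈ s, (Nat.digits 3 (c j)).sum =
      ∑ j ∈ s, c j := by
  have : Fact (Nat.Prime 3) := ⟨Nat.prime_three⟩
  induction s using Finset.induction_on with
  | empty => simp
  | insert a s ha ih =>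
    rw [Finset.prod_insert ha, Finset.sum_insert ha, Finset.sum_insert ha,
      padicValNat.mul (Nat.factorial_ne_zero _)
        (Finset.prod_ne_zero_iff.2 fun _ _ => Nat.factorial_ne_zero _)]
    have h1 := sub_one_mul_padicValNat_factorial (p := 3) (c a)
    have h2 := Nat.digit_sum_le 3 (c a)
    omega

theorem three_pow_dvd_multinomial {s : Finset ℕ} {c : ℕ → ℕ} {n e : ℕ}
    (hc : ∑ j ∈ s, c j = 2 * 3 ^ n)
    (hd : 2 * e + 2 ≤ ∑ j ∈ s, (Nat.digits 3 (c j)).sum) : 3 ^ e ∣ Nat.multinomial s c := by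
  have : Fact (Nat.Prime 3) := ⟨Nat.prime_three⟩
  have hm0 : Nat.multinomial s c ≠ 0 := (Nat.multinomial_pos s c).ne'
  have hspec := congrArg (padicValNat 3) (Nat.multinomial_spec s c)
  rw [padicValNat.mul (Finset.prod_ne_zero_iff.2 fun _ _ => Nat.factorial_ne_zero _) hm0,
    hc] at hspec
  have h1 := two_mul_padicValNat_prod_factorial s c
  have h2 := sub_one_mul_padicValNat_factorial (p := 3) (2 * 3 ^ n)
  have h3 : (Nat.digits 3 (2 * 3 ^ n)).sum = 2 := by
    rw [mul_comm, Nat.digits_base_pow_mul (by norm_num) (by norm_num)]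
    simp
  have h4 : 0 < 3 ^ n := by positivity
  rw [padicValNat_dvd_iff_le hm0]
  omega

section TraceKernel

variable {F : Type} [Field F]

/-- The absolute trace of a field with `3 ^ f` elements, as a function into the field itself. -/
def absTrace (f : ℕ) (x : F) : F := ∑ j ∈ Finset.range f, x ^ 3 ^ j

/-- The sum of the two nontrivial additive characters that factor through the trace. -/
def traceKernel (f : ℕ) (x : F) : ℤ := if absTrace f x = 0 then 2 else -1

theorem absTrace_zero (f : ℕ) : absTrace f (0 : F) = 0 := by
  simp [absTrace]

theorem absTrace_neg (f : ℕ) (x : F) : absTrace f (-x) = -absTrace f x := by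
  simp only [absTrace, ← Finset.sum_neg_distrib]
  exact Finset.sum_congr rfl fun j _ => Odd.neg_pow (Odd.pow (by decide)) x

theorem absTrace_add [CharP F 3] (f : ℕ) (x y : F) :
    absTrace f (x + y) = absTrace f x + absTrace f y := by
  have : Fact (Nat.Prime 3) := ⟨Nat.prime_three⟩
  simp only [absTrace, ← Finset.sum_add_distrib, add_pow_char_pow]

theorem traceKernel_zero (f : ℕ) : traceKernel f (0 : F) = 2 := by
  simp [traceKernel, absTrace_zero]

variable [Fintype F]

theorem absTrace_cube {f : ℕ} (hF : Fintype.card F = 3 ^ f) (x : F) :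
    absTrace f (x ^ 3) = absTrace f x := by
  have h1 := Finset.sum_range_succ (fun j => x ^ 3 ^ j) f
  have h2 := Finset.sum_range_succ' (fun j => x ^ 3 ^ j) f
  rw [h1, ← hF, FiniteField.pow_card, pow_zero, pow_one] at h2
  simp only [absTrace, ← pow_mul, ← pow_succ']
  exact (add_right_cancel h2).symm

theorem absTrace_pow_three [CharP F 3] {f : ℕ} (hF : Fintype.card F = 3 ^ f) (x : F) :
    absTrace f x ^ 3 = absTrace f x := by
  have : Fact (Nat.Prime 3) := ⟨Nat.prime_three⟩
  conv_rhs => rw [← absTrace_cube hF]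
  have h := sum_pow_char_pow 3 1 (Finset.range f) fun j => x ^ 3 ^ j
  rw [pow_one] at h
  rw [absTrace, h, absTrace]
  exact Finset.sum_congr rfl fun j _ => pow_right_comm _ _ _

theorem absTrace_cases [CharP F 3] {f : ℕ} (hF : Fintype.card F = 3 ^ f) (x : F) :
    absTrace f x = 0 ∨ absTrace f x = 1 ∨ absTrace f x = -1 := by
  have h : absTrace f x * ((absTrace f x - 1) * (absTrace f x + 1)) = 0 := by
    linear_combination absTrace_pow_three hF x
  rcases mul_eq_zero.1 h with h | h
  · exact Or.inl h
  · rcases mul_eq_zero.1 h with h | h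
    · exact Or.inr (Or.inl (sub_eq_zero.1 h))
    · exact Or.inr (Or.inr (eq_neg_of_add_eq_zero_left h))

theorem exists_absTrace_ne_zero {f : ℕ} (hf : 0 < f) (hF : Fintype.card F = 3 ^ f) :
    ∃ x : F, absTrace f x ≠ 0 := by
  by_contra! h
  let P : Polynomial F := ∑ j ∈ Finset.range f, Polynomial.X ^ 3 ^ j
  have hdeg : P.natDegree ≤ 3 ^ (f - 1) := by
    refine Polynomial.natDegree_sum_le_of_forall_le _ _ fun j hj => ?_
    rw [Polynomial.natDegree_X_pow]
    have := Finset.mem_range.1 hj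
    exact Nat.pow_le_pow_right (by norm_num) (by omega)
  have hP : P = 0 := by
    refine Polynomial.eq_zero_of_natDegree_lt_card_of_eval_eq_zero' P Finset.univ
      (fun x _ => ?_) ?_
    · simpa [P, Polynomial.eval_finsetSum, absTrace] using h x
    · rw [Finset.card_univ, hF]
      exact hdeg.trans_lt (Nat.pow_lt_pow_right (by norm_num) (by omega))
  have hcoeff : P.coeff 1 = 1 := by
    simp only [P, Polynomial.finsetSum_coeff, Polynomial.coeff_X_pow]
    rw [Finset.sum_eq_single_of_mem 0 (Finset.mem_range.2 hf)]
    · simp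
    · intro j _ hj
      rw [if_neg]
      exact (Nat.one_lt_pow hj (by norm_num)).ne
  rw [hP] at hcoeff
  simp at hcoeff

theorem traceKernel_cube {f : ℕ} (hF : Fintype.card F = 3 ^ f) (x : F) :
    traceKernel f (x ^ 3) = traceKernel f x := by
  simp [traceKernel, absTrace_cube hF]

theorem traceKernel_mul [CharP F 3] {f : ℕ} (hF : Fintype.card F = 3 ^ f) (x y : F) :
    traceKernel f x * traceKernel f y = traceKernel f (x + y) + traceKernel f (x - y) := by
  have h3 : (3 : F) = 0 := by exact_mod_cast CharP.cast_eq_zero F 3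
  have h2 : (2 : F) ≠ 0 := fun h => one_ne_zero (α := F) (by linear_combination h3 - h)
  simp only [traceKernel, sub_eq_add_neg x y, absTrace_add, absTrace_neg]
  rcases absTrace_cases hF x with hx | hx | hx <;>
    rcases absTrace_cases hF y with hy | hy | hy <;>
    norm_num [hx, hy, h2]

theorem sum_traceKernel [CharP F 3] {f : ℕ} (hf : 0 < f) (hF : Fintype.card F = 3 ^ f) :
    ∑ x : F, traceKernel f x = 0 := by
  obtain ⟨y, hy⟩ := exists_absTrace_ne_zero hf hF
  have h := Finset.sum_congr rfl fun x (_ : x ∈ Finset.univ) => traceKernel_mul hF x y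
  have hadd : ∑ x : F, traceKernel f (x + y) = ∑ x : F, traceKernel f x :=
    Equiv.sum_comp (Equiv.addRight y) (traceKernel f)
  have hsub : ∑ x : F, traceKernel f (x - y) = ∑ x : F, traceKernel f x :=
    Equiv.sum_comp (Equiv.subRight y) (traceKernel f)
  rw [← Finset.sum_mul, Finset.sum_add_distrib, hadd, hsub] at h
  rw [show traceKernel f y = -1 by simp [traceKernel, hy]] at h
  omega

theorem sum_traceKernel_mul [CharP F 3] {f : ℕ} (hf : 0 < f) (hF : Fintype.card F = 3 ^ f)
    (z : F) : ∑ x : F, traceKernel f (x * z) = if z = 0 then 2 * (3 : ℤ) ^ f else 0 := by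
  split_ifs with hz
  · simp [hz, traceKernel_zero, hF, mul_comm]
  · rw [← sum_traceKernel hf hF]
    exact Equiv.sum_comp (Equiv.mulRight₀ z hz) (traceKernel f)

end TraceKernel

theorem WittVector.p_dvd_iff_coeff_zero {p : ℕ} [Fact p.Prime] {k : Type*} [CommRing k]
    [CharP k p] [PerfectRing k p] (a : WittVector p k) :
    (p : WittVector p k) ∣ a ↔ a.coeff 0 = 0 := by
  constructor
  · rintro ⟨b, rfl⟩
    rw [mul_comm, WittVector.mul_charP_coeff_zero]
  · intro h
    have h1 := WittVector.eq_iterate_verschiebung (x := a) (n := 1) (by simpa using h)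
    obtain ⟨b, hb⟩ := (WittVector.frobenius_bijective p k).2 (a.shift 1)
    refine ⟨b, ?_⟩
    rw [h1, Function.iterate_one, ← hb, WittVector.verschiebung_frobenius, mul_comm]

theorem WittVector.pow_dvd_natCast {p : ℕ} [Fact p.Prime] {k : Type*} [Field k] [CharP k p]
    [PerfectRing k p] {e w : ℕ} (h : (p : WittVector p k) ^ e ∣ (w : WittVector p k)) :
    p ^ e ∣ w := by
  have hp0 : (p : WittVector p k) ≠ 0 := WittVector.p_nonzero p k
  induction e generalizing w with
  | zero => simp
  | succ e ih =>
    have h1 := (WittVector.p_dvd_iff_coeff_zero _).1 ((dvd_pow_self _ (by omega)).trans h)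
    have h2 : ((w : ℕ) : k) = 0 := by
      rw [← h1]
      exact (map_natCast (WittVector.constantCoeff (p := p) (R := k)) w).symm
    obtain ⟨v, rfl⟩ := (CharP.cast_eq_zero_iff k p w).1 h2
    rw [pow_succ', Nat.cast_mul] at h
    rw [pow_succ']
    exact mul_dvd_mul_left p (ih ((mul_dvd_mul_iff_left hp0).1 h))

section Divisibility

variable {F : Type} [Field F] [Fintype F]

theorem pow_dvd_teichmuller_trace_pow_sub [CharP F 3] [Fact (Nat.Prime 3)] {f : ℕ}
    (hF : Fintype.card F = 3 ^ f) (n : ℕ) (y : F) :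
    (3 : WittVector 3 F) ^ (n + 1) ∣
      (∑ j ∈ Finset.range f, WittVector.teichmuller 3 y ^ 3 ^ j) ^ (2 * 3 ^ n) -
        ((if absTrace f y = 0 then 0 else 1 : ℕ) : WittVector 3 F) := by
  set t := ∑ j ∈ Finset.range f, WittVector.teichmuller 3 y ^ 3 ^ j
  have ht : WittVector.constantCoeff t = absTrace f y := by
    simp only [t, map_sum, map_pow, absTrace]
    exact Finset.sum_congr rfl fun j _ => by
      rw [show WittVector.constantCoeff (WittVector.teichmuller 3 y) = y from
        WittVector.teichmuller_coeff_zero 3 y]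
  by_cases hy : absTrace f y = 0
  · have h3 : (3 : WittVector 3 F) ∣ t :=
      (WittVector.p_dvd_iff_coeff_zero (p := 3) t).2 (ht.trans hy)
    have hn : n + 1 ≤ 2 * 3 ^ n := by
      have := Nat.lt_pow_self (n := n) (a := 3) (by norm_num)
      omega
    simpa [hy] using (pow_dvd_pow _ hn).trans (pow_dvd_pow_of_dvd h3 (2 * 3 ^ n))
  · have hy2 : absTrace f y ^ 2 = 1 := by
      rcases absTrace_cases hF y with h | h | h
      · exact absurd h hy
      · simp [h]
      · simp [h]
    have h3 : ((3 : ℕ) : WittVector 3 F) ∣ t ^ 2 - 1 := by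
      refine (WittVector.p_dvd_iff_coeff_zero (p := 3) _).2 ?_
      change WittVector.constantCoeff (t ^ 2 - 1) = 0
      rw [map_sub, map_pow, ht, hy2, map_one, sub_self]
    simpa [hy, pow_mul] using dvd_sub_pow_of_dvd_sub h3 n

/-- A divisibility criterion in the style of McEliece's theorem on cyclic codes. -/
theorem three_pow_dvd_card_absTrace_ne_zero [CharP F 3] [Fact (Nat.Prime 3)] {m Q f e : ℕ}
    (hm : 1 ≤ m) (hf : f = 53 * 107 ^ (m - 1)) (hfe : f = 2 * e + 5)
    (hQ : 107 ^ m * Q = 3 ^ f - 1) (hF : Fintype.card F = 3 ^ f) (D : Finset F)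
    (hD : ∀ Y : ℕ, ∑ d ∈ D, WittVector.teichmuller 3 d ^ Y = 0 ∨
      ∃ a, Y = a * Q ∧ (¬ 107 ∣ a ∨ 107 ^ m ∣ a)) (x : F) :
    3 ^ e ∣ (D.filter fun d => absTrace f (x * d) ≠ 0).card := by
  apply WittVector.pow_dvd_natCast (p := 3) (k := F)
  have hcard : ((D.filter fun d => absTrace f (x * d) ≠ 0).card : WittVector 3 F) =
      ∑ d ∈ D, ((if absTrace f (x * d) = 0 then 0 else 1 : ℕ) : WittVector 3 F) := by
    rw [Finset.card_filter, Nat.cast_sum]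
    exact Finset.sum_congr rfl fun d _ => by simp only [ne_eq, ite_not]
  have hsum : (3 : WittVector 3 F) ^ e ∣
      ∑ d ∈ D, (∑ j ∈ Finset.range f, WittVector.teichmuller 3 (x * d) ^ 3 ^ j) ^ (2 * 3 ^ e) := by
    simp only [Finset.sum_pow_eq_sum_piAntidiag]
    rw [Finset.sum_comm]
    refine Finset.dvd_sum fun c hc => ?_
    rw [Finset.mem_piAntidiag] at hc
    have hterm : ∀ d, ∏ j ∈ Finset.range f, (WittVector.teichmuller 3 (x * d) ^ 3 ^ j) ^ c j =
        WittVector.teichmuller 3 x ^ (∑ j ∈ Finset.range f, c j * 3 ^ j) *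
          WittVector.teichmuller 3 d ^ (∑ j ∈ Finset.range f, c j * 3 ^ j) := fun d => by
      simp only [← pow_mul, map_mul, ← mul_pow, Finset.prod_pow_eq_pow_sum]
      congr 1
      exact Finset.sum_congr rfl fun _ _ => mul_comm _ _
    simp only [hterm, ← Finset.mul_sum]
    rcases hD (∑ j ∈ Finset.range f, c j * 3 ^ j) with h | ⟨a, hY, ha⟩
    · simp [h]
    · have hpos : 0 < 3 ^ e := by positivity
      have hne : ∃ j < f, c j ≠ 0 := by
        by_contra! h
        have := hc.1.symm.trans (Finset.sum_eq_zero fun j hj => h j (Finset.mem_range.1 hj))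
        omega
      have h := le_sum_digits_of_eq_mul hm hf hQ hne hY ha
      have h := three_pow_dvd_multinomial hc.1 (show 2 * e + 2 ≤ _ by omega)
      have h : ((3 ^ e : ℕ) : WittVector 3 F) ∣ (Nat.multinomial (Finset.range f) c : ℕ) :=
        Nat.cast_dvd_cast h
      rw [Nat.cast_pow] at h
      exact dvd_mul_of_dvd_left h _
  have hdiff := Finset.dvd_sum fun d (_ : d ∈ D) =>
    (pow_dvd_pow (3 : WittVector 3 F) (Nat.le_succ e)).trans
      (pow_dvd_teichmuller_trace_pow_sub hF e (x * d))
  rw [Finset.sum_sub_distrib, ← hcard] at hdiff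
  exact (dvd_sub_right hsum).1 hdiff

end Divisibility

section TwoValued

variable {F : Type} [Field F]

/-- The sum of `traceKernel` over the multiples of `x` by elements of `D`. -/
def traceSum (f : ℕ) (D : Finset F) (x : F) : ℤ := ∑ d ∈ D, traceKernel f (x * d)

/-- The number of ways of writing `z` as a difference of two elements of `D`. -/
def diffCount (D : Finset F) (z : F) : ℕ := (D.filter fun d => d - z ∈ D).card

theorem diffCount_zero (D : Finset F) : diffCount D 0 = D.card := by
  simp [diffCount]

theorem diffCount_neg (D : Finset F) (z : F) : diffCount D (-z) = diffCount D z := by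
  refine Finset.card_nbij' (fun d => d + z) (fun d => d - z) ?_ ?_ ?_ ?_
  · intro d hd
    simpa [and_comm] using hd
  · intro d hd
    simpa [and_comm] using hd
  · intro d _
    simp
  · intro d _
    simp

theorem traceSum_zero (f : ℕ) (D : Finset F) : traceSum f D 0 = 2 * D.card := by
  simp [traceSum, traceKernel_zero, mul_comm]

variable [Fintype F] [CharP F 3] {f : ℕ} {D : Finset F}

theorem sum_traceSum_mul (hf : 0 < f) (hF : Fintype.card F = 3 ^ f)
    (hneg : ∀ d ∈ D, -d ∈ D) (z : F) :
    ∑ x : F, traceSum f D x * traceKernel f (x * z) = if z ∈ D then 4 * (3 : ℤ) ^ f else 0 := by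
  simp only [traceSum, Finset.sum_mul, traceKernel_mul hF, ← mul_add, ← mul_sub]
  rw [Finset.sum_comm]
  simp only [Finset.sum_add_distrib, sum_traceKernel_mul hf hF]
  have h1 : ∀ d, d + z = 0 ↔ d = -z := fun d => add_eq_zero_iff_eq_neg
  have h2 : ∀ d, d - z = 0 ↔ d = z := fun d => sub_eq_zero
  have h3 : -z ∈ D ↔ z ∈ D := ⟨fun h => by simpa using hneg _ h, hneg z⟩
  simp only [h1, h2, Finset.sum_ite_eq', h3]
  split_ifs <;> ring

theorem traceSum_sq (hF : Fintype.card F = 3 ^ f) (hneg : ∀ d ∈ D, -d ∈ D) (x : F) :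
    traceSum f D x ^ 2 = 2 * ∑ d ∈ D, ∑ d' ∈ D, traceKernel f (x * (d - d')) := by
  have h : ∀ d, ∑ d' ∈ D, traceKernel f (x * (d + d')) =
      ∑ d' ∈ D, traceKernel f (x * (d - d')) := fun d =>
    Finset.sum_nbij' (fun d' => -d') (fun d' => -d') hneg hneg (by simp) (by simp) (by simp)
  simp only [sq, traceSum, Finset.sum_mul_sum, traceKernel_mul hF, ← mul_add, ← mul_sub,
    Finset.sum_add_distrib, h]
  ring

theorem sum_traceSum_sq_mul (hf : 0 < f) (hF : Fintype.card F = 3 ^ f)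
    (hneg : ∀ d ∈ D, -d ∈ D) (z : F) :
    ∑ x : F, traceSum f D x ^ 2 * traceKernel f (x * z) = 8 * 3 ^ f * diffCount D z := by
  have hcount : ∀ z, ∑ d ∈ D, ∑ d' ∈ D, (if d - d' - z = 0 then 2 * (3 : ℤ) ^ f else 0) =
      2 * 3 ^ f * diffCount D z := fun z => by
    have h : ∀ d d', d - d' - z = 0 ↔ d' = d - z := fun d d' => by
      rw [sub_right_comm, sub_eq_zero, eq_comm]
    simp only [h, Finset.sum_ite_eq', diffCount]
    rw [← Finset.sum_filter, Finset.sum_const, nsmul_eq_mul, mul_comm]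
  have hpoint : ∀ x, traceSum f D x ^ 2 * traceKernel f (x * z) =
      2 * ∑ d ∈ D, ∑ d' ∈ D,
        (traceKernel f (x * (d - d' - -z)) + traceKernel f (x * (d - d' - z))) := fun x => by
    rw [traceSum_sq hF hneg, mul_assoc]
    simp only [Finset.sum_mul, traceKernel_mul hF, ← mul_add, ← mul_sub, sub_neg_eq_add]
  simp only [hpoint]
  rw [← Finset.mul_sum, Finset.sum_comm]
  simp only [Finset.sum_comm (s := (Finset.univ : Finset F)), Finset.sum_add_distrib,
    sum_traceKernel_mul hf hF, hcount, diffCount_neg]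
  ring

theorem sum_traceSum (hf : 0 < f) (hF : Fintype.card F = 3 ^ f)
    (hneg : ∀ d ∈ D, -d ∈ D) (h0 : (0 : F) ∉ D) : ∑ x : F, traceSum f D x = 0 := by
  have h := sum_traceSum_mul hf hF hneg 0
  simp only [mul_zero, traceKernel_zero, h0, if_false, ← Finset.sum_mul] at h
  omega

theorem sum_traceSum_sq (hf : 0 < f) (hF : Fintype.card F = 3 ^ f)
    (hneg : ∀ d ∈ D, -d ∈ D) : ∑ x : F, traceSum f D x ^ 2 = 4 * 3 ^ f * D.card := by
  have h := sum_traceSum_sq_mul hf hF hneg 0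
  simp only [mul_zero, traceKernel_zero, diffCount_zero, ← Finset.sum_mul] at h
  linarith

/-- A symmetric set with two nontrivial character sums is a partial difference set. -/
theorem exists_diffCount_eq (hf : 0 < f) (hF : Fintype.card F = 3 ^ f)
    (hneg : ∀ d ∈ D, -d ∈ D) {A B : ℤ}
    (hAB : ∀ x ≠ 0, traceSum f D x = A ∨ traceSum f D x = B) :
    ∃ l u : ℕ, ∀ z ≠ 0, diffCount D z = if z ∈ D then l else u := by
  set C := (traceSum f D 0 - A) * (traceSum f D 0 - B) with hC
  have key : ∀ z ≠ 0, 8 * 3 ^ f * (diffCount D z : ℤ) =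
      (A + B) * (if z ∈ D then 4 * (3 : ℤ) ^ f else 0) + C * 2 := fun z hz => by
    have h1 : ∑ x : F, (traceSum f D x - A) * (traceSum f D x - B) * traceKernel f (x * z) =
        C * 2 := by
      rw [Finset.sum_eq_single 0]
      · rw [zero_mul, traceKernel_zero]
      · intro x _ hx
        rcases hAB x hx with h | h <;> simp [h]
      · simp
    have h2 : ∑ x : F, (traceSum f D x - A) * (traceSum f D x - B) * traceKernel f (x * z) =
        ∑ x : F, traceSum f D x ^ 2 * traceKernel f (x * z) -
          (A + B) * ∑ x : F, traceSum f D x * traceKernel f (x * z) +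
          A * B * ∑ x : F, traceKernel f (x * z) := by
      rw [Finset.mul_sum, Finset.mul_sum, ← Finset.sum_sub_distrib, ← Finset.sum_add_distrib]
      exact Finset.sum_congr rfl fun x _ => by ring
    rw [h1, sum_traceSum_sq_mul hf hF hneg, sum_traceSum_mul hf hF hneg,
      sum_traceKernel_mul hf hF, if_neg hz] at h2
    linarith
  have hconst : ∀ z ≠ 0, ∀ z' ≠ 0, (z ∈ D ↔ z' ∈ D) → diffCount D z = diffCount D z' :=
    fun z hz z' hz' h => by
      have h1 := key z hz
      simp only [h] at h1
      have h2 := h1.trans (key z' hz').symm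
      exact_mod_cast mul_left_cancel₀ (by positivity) h2
  have hex : ∀ P : Prop, ∃ l, ∀ z ≠ 0, (z ∈ D ↔ P) → diffCount D z = l := fun P => by
    by_cases h : ∃ z ≠ 0, z ∈ D ↔ P
    · obtain ⟨z, hz, hzP⟩ := h
      exact ⟨diffCount D z, fun z' hz' h' => hconst z' hz' z hz (h'.trans hzP.symm)⟩
    · push Not at h
      exact ⟨0, fun z hz hz' => by have := h z hz; tauto⟩
  obtain ⟨l, hl⟩ := hex True
  obtain ⟨u, hu⟩ := hex False
  refine ⟨l, u, fun z hz => ?_⟩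
  split_ifs with h
  · exact hl z hz (by simpa using h)
  · exact hu z hz (by simpa using h)

end TwoValued

section CayleyGraph

variable {F : Type} [Field F] {D : Finset F}

theorem fromRel_sub_adj (hneg : ∀ d ∈ D, -d ∈ D) (h0 : (0 : F) ∉ D) (x y : F) :
    (SimpleGraph.fromRel fun x y : F => x - y ∈ (D : Set F)).Adj x y ↔ x - y ∈ D := by
  rw [SimpleGraph.fromRel_adj]
  constructor
  · rintro ⟨_, h | h⟩
    · exact h
    · simpa using hneg _ h
  · intro h
    refine ⟨?_, Or.inl h⟩
    rintro rfl
    exact h0 (by simpa using h)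

variable [Fintype F]

theorem isSRGWith_of_diffCount (hneg : ∀ d ∈ D, -d ∈ D) (h0 : (0 : F) ∉ D) {l u : ℕ}
    (h : ∀ z ≠ 0, diffCount D z = if z ∈ D then l else u) :
    (SimpleGraph.fromRel fun x y : F => x - y ∈ (D : Set F)).IsSRGWith
      (Fintype.card F) D.card l u := by
  set G := SimpleGraph.fromRel fun x y : F => x - y ∈ (D : Set F)
  have hadj : ∀ x y, G.Adj x y ↔ x - y ∈ D := fromRel_sub_adj hneg h0
  have hcommon : ∀ x y, Fintype.card (G.commonNeighbors x y) = diffCount D (x - y) :=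
    fun x y => by
      rw [← Set.toFinset_card]
      refine Finset.card_nbij' (fun v => x - v) (fun d => x - d) ?_ ?_ ?_ ?_
      · intro v hv
        simpa [SimpleGraph.mem_commonNeighbors, hadj] using hv
      · intro d hd
        have hd := Finset.mem_filter.1 hd
        simp only [Set.coe_toFinset, SimpleGraph.mem_commonNeighbors, hadj, sub_sub_cancel]
        refine ⟨hd.1, ?_⟩
        convert hd.2 using 1
        ring
      · intro v _
        simp
      · intro d _
        simp
  refine ⟨rfl, fun x => ?_, fun x y hxy => ?_, fun x y hne hxy => ?_⟩
  · refine Finset.card_nbij' (fun v => x - v) (fun d => x - d) ?_ ?_ ?_ ?_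
    · intro v hv
      exact (hadj x v).1 ((SimpleGraph.mem_neighborFinset _ _ _).1 (Finset.mem_coe.1 hv))
    · intro d hd
      refine Finset.mem_coe.2 ((SimpleGraph.mem_neighborFinset _ _ _).2 ((hadj _ _).2 ?_))
      rw [sub_sub_cancel]
      exact Finset.mem_coe.1 hd
    · intro v _
      simp
    · intro d _
      simp
  · rw [hcommon, h _ (sub_ne_zero.2 hxy.ne), if_pos ((hadj x y).1 hxy)]
  · rw [hcommon, h _ (sub_ne_zero.2 hne), if_neg (mt (hadj x y).2 hxy)]

end CayleyGraph

section Cyclotomy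

variable {F : Type} [Field F] {g : F} {N n Q f : ℕ}

/-- The union of the `n` consecutive cyclotomic classes of order `N` that start at `g ^ κ`,
where `Q` is the size of each class. -/
def cycUnion (g : F) (N n Q κ : ℕ) : Finset F :=
  (Finset.range n ×ˢ Finset.range Q).image fun p => g ^ (p.1 + κ + N * p.2)

/-- The Gaussian period of the class of `g ^ b`, doubled: `traceKernel` sums two characters. -/
def cycPeriod (f : ℕ) (g : F) (N Q b : ℕ) : ℤ :=
  ∑ t ∈ Finset.range Q, traceKernel f (g ^ (b + N * t))

/-- The sum of `n` consecutive periods. -/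
def cycPeriodSum (f : ℕ) (g : F) (N n Q b : ℕ) : ℤ :=
  ∑ i ∈ Finset.range n, cycPeriod f g N Q (b + i)

theorem pow_eq_one_of_orderOf (hg : orderOf g = N * Q) : g ^ (N * Q) = 1 :=
  hg ▸ pow_orderOf_eq_one g

theorem pow_injOn_of_orderOf (hg : orderOf g = N * Q) (hNQ : N * Q ≠ 0) {a b : ℕ}
    (h : g ^ a = g ^ b) : a ≡ b [MOD N * Q] := by
  have hg0 : g ≠ 0 := by
    rintro rfl
    have := pow_eq_one_of_orderOf hg
    rw [zero_pow hNQ] at this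
    exact zero_ne_one this
  rw [← Units.val_mk0 hg0, orderOf_units] at hg
  rw [← hg]
  apply pow_eq_pow_iff_modEq.1
  ext
  simpa using h

theorem mem_cycUnion (hg : orderOf g = N * Q) (hQ : 0 < Q) (κ : ℕ) (x : F) :
    x ∈ cycUnion g N n Q κ ↔ ∃ i < n, ∃ t : ℕ, x = g ^ (i + κ + N * t) := by
  simp only [cycUnion, Finset.mem_image, Finset.mem_product, Finset.mem_range, Prod.exists]
  constructor
  · rintro ⟨i, t, ⟨hi, _⟩, rfl⟩
    exact ⟨i, hi, t, rfl⟩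
  · rintro ⟨i, hi, t, rfl⟩
    refine ⟨i, t % Q, ⟨hi, Nat.mod_lt _ hQ⟩, ?_⟩
    conv_rhs => rw [← Nat.mod_add_div t Q, mul_add, ← mul_assoc N Q, ← add_assoc, pow_add _ _
      (N * Q * (t / Q)), pow_mul _ (N * Q), pow_eq_one_of_orderOf hg, one_pow, mul_one]

theorem cycUnion_injOn (hg : orderOf g = N * Q) (hnN : n ≤ N) (κ : ℕ) :
    Set.InjOn (fun p : ℕ × ℕ => g ^ (p.1 + κ + N * p.2))
      (Finset.range n ×ˢ Finset.range Q : Finset (ℕ × ℕ)) := by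
  rintro ⟨i, t⟩ hp ⟨i', t'⟩ hp' h
  simp only [Finset.coe_product, Finset.coe_range, Set.mem_prod, Set.mem_Iio] at hp hp'
  have hN : 0 < N := by omega
  have hNQ : N * Q ≠ 0 := Nat.mul_ne_zero (by omega) (by omega)
  have h := pow_injOn_of_orderOf hg hNQ h
  have h : i + N * t ≡ i' + N * t' [MOD N * Q] := by
    apply Nat.ModEq.add_right_cancel' κ
    convert h using 1 <;> ring
  have hlt : ∀ a b, a < n → b < Q → a + N * b < N * Q := fun a b ha hb => by
    calc a + N * b < N + N * b := by omega
      _ = N * (b + 1) := by ring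
      _ ≤ N * Q := Nat.mul_le_mul_left _ hb
  have h := Nat.ModEq.eq_of_lt_of_lt h (hlt _ _ hp.1 hp.2) (hlt _ _ hp'.1 hp'.2)
  have hi : i = i' := by
    have := congrArg (· % N) h
    simpa [Nat.mod_eq_of_lt (hp.1.trans_le hnN), Nat.mod_eq_of_lt (hp'.1.trans_le hnN)] using this
  subst hi
  have ht : t = t' := Nat.eq_of_mul_eq_mul_left hN (by omega)
  rw [ht]

theorem sum_cycUnion {M : Type*} [AddCommMonoid M] (hg : orderOf g = N * Q) (hnN : n ≤ N)
    (κ : ℕ) (h : F → M) :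
    ∑ d ∈ cycUnion g N n Q κ, h d =
      ∑ i ∈ Finset.range n, ∑ t ∈ Finset.range Q, h (g ^ (i + κ + N * t)) := by
  rw [cycUnion, Finset.sum_image (cycUnion_injOn hg hnN κ), Finset.sum_product]

theorem card_cycUnion (hg : orderOf g = N * Q) (hnN : n ≤ N) (κ : ℕ) :
    (cycUnion g N n Q κ).card = n * Q := by
  rw [Finset.card_eq_sum_ones, sum_cycUnion hg hnN]
  simp

theorem traceSum_cycUnion (hg : orderOf g = N * Q) (hnN : n ≤ N) (κ b : ℕ) :
    traceSum f (cycUnion g N n Q κ) (g ^ b) = cycPeriodSum f g N n Q (b + κ) := by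
  rw [traceSum, sum_cycUnion hg hnN, cycPeriodSum]
  refine Finset.sum_congr rfl fun i _ => Finset.sum_congr rfl fun t _ => ?_
  rw [← pow_add]
  congr 2
  ring

theorem zero_notMem_cycUnion (hg : orderOf g = N * Q) (hNQ : N * Q ≠ 0) (κ : ℕ) :
    (0 : F) ∉ cycUnion g N n Q κ := by
  intro h
  obtain ⟨p, _, hp⟩ := Finset.mem_image.1 h
  have hg0 := eq_zero_of_pow_eq_zero hp
  have := pow_eq_one_of_orderOf hg
  rw [hg0, zero_pow hNQ] at this
  exact zero_ne_one this

theorem neg_mem_cycUnion {R : ℕ} (hg : orderOf g = N * Q) (hN : 0 < N) (hR : 0 < R)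
    (hQR : Q = 2 * R) (κ : ℕ) : ∀ d ∈ cycUnion g N n Q κ, -d ∈ cycUnion g N n Q κ := by
  have hneg : g ^ (N * R) = -1 := by
    have h1 : (g ^ (N * R) - 1) * (g ^ (N * R) + 1) = 0 := by
      have h := pow_eq_one_of_orderOf hg
      rw [hQR, mul_left_comm, mul_comm 2, pow_mul] at h
      linear_combination h
    rcases mul_eq_zero.1 h1 with h | h
    · have hle := Nat.le_of_dvd (by positivity) (orderOf_dvd_of_pow_eq_one (sub_eq_zero.1 h))
      rw [hg, hQR] at hle
      have : 0 < N * R := by positivity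
      nlinarith
    · exact eq_neg_of_add_eq_zero_left h
  intro d hd
  rw [mem_cycUnion hg (by omega)] at hd ⊢
  obtain ⟨i, hi, t, rfl⟩ := hd
  refine ⟨i, hi, t + R, ?_⟩
  rw [mul_add, ← add_assoc, pow_add _ _ (N * R), hneg, mul_neg_one]

theorem cycPeriod_add (hg : orderOf g = N * Q) (b : ℕ) :
    cycPeriod f g N Q (b + N) = cycPeriod f g N Q b := by
  have h := sum_range_add_periodic (u := fun t => traceKernel f (g ^ (b + N * t))) (f := Q)
    (fun t => by rw [mul_add, ← add_assoc, pow_add _ _ (N * Q), pow_eq_one_of_orderOf hg, mul_one])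
    1
  rw [cycPeriod, cycPeriod, ← h]
  refine Finset.sum_congr rfl fun t _ => ?_
  congr 2
  ring

theorem cycPeriod_congr (hg : orderOf g = N * Q) {b b' : ℕ} (h : b ≡ b' [MOD N]) :
    cycPeriod f g N Q b = cycPeriod f g N Q b' := by
  have hp : Function.Periodic (cycPeriod f g N Q) N := cycPeriod_add hg
  rw [← hp.map_mod_nat b, ← hp.map_mod_nat b', h]

theorem cycPeriodSum_add (hg : orderOf g = N * Q) (b : ℕ) :
    cycPeriodSum f g N n Q (b + N) = cycPeriodSum f g N n Q b :=
  Finset.sum_congr rfl fun i _ => by rw [add_right_comm, cycPeriod_add hg]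

theorem cycPeriodSum_mul_add {m : ℕ} (hm : 1 ≤ m) (hg : orderOf g = 107 ^ m * Q) (c : ℕ) :
    cycPeriodSum f g (107 ^ m) (107 ^ (m - 1)) Q (107 ^ (m - 1) * (c + 107)) =
      cycPeriodSum f g (107 ^ m) (107 ^ (m - 1)) Q (107 ^ (m - 1) * c) := by
  rw [mul_add, ← pow_succ, Nat.sub_add_cancel hm, cycPeriodSum_add hg]

theorem image_pow_range [Fintype F] (hg : orderOf g = N * Q) (hNQ : N * Q ≠ 0)
    (hF : Fintype.card F = N * Q + 1) :
    (Finset.range (N * Q)).image (fun b => g ^ b) = Finset.univ.erase 0 := by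
  apply Finset.eq_of_subset_of_card_le
  · intro x hx
    obtain ⟨b, _, rfl⟩ := Finset.mem_image.1 hx
    refine Finset.mem_erase.2 ⟨fun h => ?_, Finset.mem_univ _⟩
    have h1 := pow_eq_one_of_orderOf hg
    rw [eq_zero_of_pow_eq_zero h, zero_pow hNQ] at h1
    exact zero_ne_one h1
  · rw [Finset.card_image_of_injOn, Finset.card_erase_of_mem (Finset.mem_univ _),
      Finset.card_univ, hF, Finset.card_range, Nat.add_sub_cancel]
    intro a ha b hb h
    exact Nat.ModEq.eq_of_lt_of_lt (pow_injOn_of_orderOf hg hNQ h) (by simpa using ha)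
      (by simpa using hb)

theorem exists_pow_eq [Fintype F] (hg : orderOf g = N * Q) (hNQ : N * Q ≠ 0)
    (hF : Fintype.card F = N * Q + 1) {x : F} (hx : x ≠ 0) : ∃ b, g ^ b = x := by
  have h : x ∈ Finset.univ.erase (0 : F) := Finset.mem_erase.2 ⟨hx, Finset.mem_univ _⟩
  rw [← image_pow_range hg hNQ hF] at h
  obtain ⟨b, _, hb⟩ := Finset.mem_image.1 h
  exact ⟨b, hb⟩

theorem sum_eq_zero_add_sum_pow [Fintype F] (hg : orderOf g = N * Q) (hNQ : N * Q ≠ 0)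
    (hF : Fintype.card F = N * Q + 1) (h : F → ℤ) :
    ∑ x : F, h x = h 0 + ∑ b ∈ Finset.range (N * Q), h (g ^ b) := by
  rw [← Finset.add_sum_erase _ _ (Finset.mem_univ (0 : F)), ← image_pow_range hg hNQ hF,
    Finset.sum_image]
  intro a ha b hb h
  exact Nat.ModEq.eq_of_lt_of_lt (pow_injOn_of_orderOf hg hNQ h) (by simpa using ha)
    (by simpa using hb)

variable [Fintype F]

theorem cycPeriod_three_mul (hg : orderOf g = N * Q) (hF : Fintype.card F = 3 ^ f)
    (hQ : Nat.Coprime Q 3) (b : ℕ) :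
    cycPeriod f g N Q (3 * b) = cycPeriod f g N Q b := by
  rcases Nat.eq_zero_or_pos Q with rfl | hQ0
  · simp [cycPeriod]
  rw [cycPeriod, ← sum_range_comp_of_injOn (fun t => 3 * t % Q) _
    (fun _ _ => Nat.mod_lt _ hQ0) fun u hu v hv h =>
      Nat.ModEq.eq_of_lt_of_lt (Nat.ModEq.cancel_left_of_coprime hQ h) hu hv]
  refine Finset.sum_congr rfl fun t _ => ?_
  rw [← traceKernel_cube hF (g ^ (b + N * t)), ← pow_mul]
  congr 1
  have h : g ^ (N * (3 * t)) = g ^ (N * (3 * t % Q)) := by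
    conv_lhs => rw [← Nat.mod_add_div (3 * t) Q, mul_add, ← mul_assoc N Q, pow_add,
      pow_mul _ (N * Q), pow_eq_one_of_orderOf hg, one_pow, mul_one]
  rw [pow_add, ← h, ← pow_add]
  congr 1
  ring

theorem cycPeriod_three_pow_mul (hg : orderOf g = N * Q) (hF : Fintype.card F = 3 ^ f)
    (hQ : Nat.Coprime Q 3) (l b : ℕ) :
    cycPeriod f g N Q (3 ^ l * b) = cycPeriod f g N Q b := by
  induction l with
  | zero => simp
  | succ l ih => rw [pow_succ', mul_assoc, cycPeriod_three_mul hg hF hQ, ih]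

end Cyclotomy

section IndexTwo

variable {F : Type} [Field F] [Fintype F] {g : F} {m Q f : ℕ}

theorem cycPeriod_add_of_not_dvd (hg : orderOf g = 107 ^ m * Q) (hF : Fintype.card F = 3 ^ f)
    (hQ : Nat.Coprime Q 3) {b : ℕ} (hb : ¬ 107 ^ (m - 1) ∣ b) :
    cycPeriod f g (107 ^ m) Q (b + 107 ^ (m - 1)) = cycPeriod f g (107 ^ m) Q b := by
  obtain ⟨l, hl⟩ := exists_three_pow_mul_add_modEq hb
  rw [← cycPeriod_congr hg hl, cycPeriod_three_pow_mul hg hF hQ]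

theorem cycPeriodSum_succ (hg : orderOf g = 107 ^ m * Q) (hF : Fintype.card F = 3 ^ f)
    (hQ : Nat.Coprime Q 3) {b : ℕ} (hb : ¬ 107 ^ (m - 1) ∣ b) :
    cycPeriodSum f g (107 ^ m) (107 ^ (m - 1)) Q (b + 1) =
      cycPeriodSum f g (107 ^ m) (107 ^ (m - 1)) Q b := by
  have h1 := Finset.sum_range_succ (fun i => cycPeriod f g (107 ^ m) Q (b + i)) (107 ^ (m - 1))
  have h2 := Finset.sum_range_succ' (fun i => cycPeriod f g (107 ^ m) Q (b + i)) (107 ^ (m - 1))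
  rw [h1, cycPeriod_add_of_not_dvd hg hF hQ hb] at h2
  simp only [cycPeriodSum, add_assoc, add_comm 1]
  exact (add_right_cancel h2).symm

theorem cycPeriodSum_add_mul_succ (hg : orderOf g = 107 ^ m * Q)
    (hF : Fintype.card F = 3 ^ f) (hQ : Nat.Coprime Q 3) (i : ℕ) {j : ℕ}
    (hj : j < 107 ^ (m - 1)) :
    cycPeriodSum f g (107 ^ m) (107 ^ (m - 1)) Q (j + 107 ^ (m - 1) * i + 1) =
      cycPeriodSum f g (107 ^ m) (107 ^ (m - 1)) Q (107 ^ (m - 1) * (i + 1)) := by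
  have h : ∀ j < 107 ^ (m - 1),
      cycPeriodSum f g (107 ^ m) (107 ^ (m - 1)) Q (j + 107 ^ (m - 1) * i + 1) =
        cycPeriodSum f g (107 ^ m) (107 ^ (m - 1)) Q (107 ^ (m - 1) * i + 1) := by
    intro j hj
    induction j with
    | zero => rw [zero_add]
    | succ j ih =>
      rw [← ih (by omega), add_right_comm j 1, cycPeriodSum_succ hg hF hQ]
      intro hdvd
      rw [add_right_comm, Nat.dvd_add_left (dvd_mul_right _ _)] at hdvd
      exact absurd (Nat.le_of_dvd (by omega) hdvd) (by omega)
  rw [h j hj, ← h (107 ^ (m - 1) - 1) (by omega)]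
  congr 1
  have : 1 ≤ 107 ^ (m - 1) := Nat.one_le_pow _ _ (by norm_num)
  rw [mul_add]
  omega

theorem cycPeriodSum_mul_three (hg : orderOf g = 107 ^ m * Q) (hF : Fintype.card F = 3 ^ f)
    (hQ : Nat.Coprime Q 3) (c : ℕ) :
    cycPeriodSum f g (107 ^ m) (107 ^ (m - 1)) Q (107 ^ (m - 1) * (3 * c)) =
      cycPeriodSum f g (107 ^ m) (107 ^ (m - 1)) Q (107 ^ (m - 1) * c) := by
  have hshift : ∀ i, i + 1 < 107 ^ (m - 1) → ∀ c,
      cycPeriod f g (107 ^ m) Q (107 ^ (m - 1) * c + (i + 1)) =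
        cycPeriod f g (107 ^ m) Q (i + 1) := by
    intro i hi c
    induction c with
    | zero => simp
    | succ c ih =>
      rw [← ih, mul_add, mul_one, add_right_comm, cycPeriod_add_of_not_dvd hg hF hQ]
      rw [Nat.dvd_add_right (dvd_mul_right _ _)]
      intro hdvd
      exact absurd (Nat.le_of_dvd (by omega) hdvd) (by omega)
  have hn : 1 ≤ 107 ^ (m - 1) := Nat.one_le_pow _ _ (by norm_num)
  have hsplit : ∀ c, cycPeriodSum f g (107 ^ m) (107 ^ (m - 1)) Q (107 ^ (m - 1) * c) =
      ∑ i ∈ Finset.range (107 ^ (m - 1) - 1), cycPeriod f g (107 ^ m) Q (i + 1) +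
        cycPeriod f g (107 ^ m) Q (107 ^ (m - 1) * c) := fun c => by
    have h := Finset.sum_range_succ'
      (fun i => cycPeriod f g (107 ^ m) Q (107 ^ (m - 1) * c + i)) (107 ^ (m - 1) - 1)
    rw [Nat.sub_add_cancel hn] at h
    rw [cycPeriodSum, h, add_zero]
    congr 1
    exact Finset.sum_congr rfl fun i hi => hshift i (by have := Finset.mem_range.1 hi; omega) c
  rw [hsplit, hsplit, mul_left_comm, cycPeriod_three_mul hg hF hQ]

theorem eq_of_three_mul_invariant {M : Type*} {v : ℕ → M} (hper : ∀ c, v (c + 107) = v c)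
    (h3 : ∀ c, v (3 * c) = v c) (c : ℕ) :
    v c = if c % 107 = 0 then v 0 else if c ^ 53 % 107 = 1 then v 1 else v 2 := by
  have hmod : ∀ c, v (c % 107) = v c := Function.Periodic.map_mod_nat hper
  have hpow : ∀ l c, v (3 ^ l * c % 107) = v c := fun l c => by
    rw [hmod]
    induction l with
    | zero => simp
    | succ l ih => rw [pow_succ', mul_assoc, h3, ih]
  have hdec : ∀ c < 107, c ≠ 0 →
      if c ^ 53 % 107 = 1 then ∃ l < 53, 3 ^ l * 1 % 107 = c
        else ∃ l < 53, 3 ^ l * 2 % 107 = c := by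
    decide +kernel
  split_ifs with h0 h1
  · rw [← hmod, h0]
  · have h := hdec (c % 107) (Nat.mod_lt _ (by norm_num)) h0
    rw [← Nat.pow_mod, if_pos h1] at h
    obtain ⟨l, _, hl⟩ := h
    rw [← hmod, ← hl, hpow]
  · have h := hdec (c % 107) (Nat.mod_lt _ (by norm_num)) h0
    rw [← Nat.pow_mod, if_neg h1] at h
    obtain ⟨l, _, hl⟩ := h
    rw [← hmod, ← hl, hpow]

theorem sum_of_three_mul_invariant {v : ℕ → ℤ} (hper : ∀ c, v (c + 107) = v c)
    (h3 : ∀ c, v (3 * c) = v c) (H : ℤ → ℤ) :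
    ∑ c ∈ Finset.range 107, H (v c) = H (v 0) + 53 * H (v 1) + 53 * H (v 2) := by
  have h : ∀ c ∈ Finset.range 107, H (v c) =
      (if c = 0 then H (v 0) else 0) + (if c ^ 53 % 107 = 1 then H (v 1) else 0) +
        (if c ≠ 0 ∧ c ^ 53 % 107 ≠ 1 then H (v 2) else 0) := fun c hc => by
    have hc := Finset.mem_range.1 hc
    rw [eq_of_three_mul_invariant hper h3 c, Nat.mod_eq_of_lt hc]
    by_cases h0 : c = 0
    · subst h0
      norm_num
    · by_cases h1 : c ^ 53 % 107 = 1 <;> simp [h0, h1]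
  have c0 : ((Finset.range 107).filter fun c => c = 0).card = 1 := by decide +kernel
  have c1 : ((Finset.range 107).filter fun c => c ^ 53 % 107 = 1).card = 53 := by
    decide +kernel
  have c2 : ((Finset.range 107).filter fun c => c ≠ 0 ∧ c ^ 53 % 107 ≠ 1).card = 53 := by
    decide +kernel
  rw [Finset.sum_congr rfl h, Finset.sum_add_distrib, Finset.sum_add_distrib,
    ← Finset.sum_filter, ← Finset.sum_filter, ← Finset.sum_filter, Finset.sum_const,
    Finset.sum_const, Finset.sum_const, c0, c1, c2]
  simp

theorem cycPeriodSum_cases (hm : 1 ≤ m) (hg : orderOf g = 107 ^ m * Q)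
    (hF : Fintype.card F = 3 ^ f) (hQ : Nat.Coprime Q 3) (b : ℕ) :
    ∃ c < 3, cycPeriodSum f g (107 ^ m) (107 ^ (m - 1)) Q b =
      cycPeriodSum f g (107 ^ m) (107 ^ (m - 1)) Q (107 ^ (m - 1) * c) := by
  have hN : 1 ≤ 107 ^ m := Nat.one_le_pow _ _ (by norm_num)
  have h := cycPeriodSum_add_mul_succ hg hF hQ ((b + 107 ^ m - 1) / 107 ^ (m - 1))
    (Nat.mod_lt (b + 107 ^ m - 1) (by positivity : 0 < 107 ^ (m - 1)))
  rw [Nat.mod_add_div, Nat.sub_add_cancel (by omega), cycPeriodSum_add hg] at h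
  rw [h, eq_of_three_mul_invariant
    (v := fun c => cycPeriodSum f g (107 ^ m) (107 ^ (m - 1)) Q (107 ^ (m - 1) * c))
    (cycPeriodSum_mul_add hm hg) (cycPeriodSum_mul_three hg hF hQ)]
  split_ifs
  · exact ⟨0, by norm_num, rfl⟩
  · exact ⟨1, by norm_num, rfl⟩
  · exact ⟨2, by norm_num, rfl⟩

theorem sum_cycPeriodSum (hm : 1 ≤ m) (hg : orderOf g = 107 ^ m * Q)
    (hF : Fintype.card F = 3 ^ f) (hQ : Nat.Coprime Q 3) (H : ℤ → ℤ) {v : ℕ → ℤ}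
    (hv : ∀ c, v c = cycPeriodSum f g (107 ^ m) (107 ^ (m - 1)) Q (107 ^ (m - 1) * c)) :
    ∑ b ∈ Finset.range (107 ^ m * Q), H (cycPeriodSum f g (107 ^ m) (107 ^ (m - 1)) Q b) =
      (107 ^ (m - 1) * Q : ℕ) * (H (v 0) + 53 * H (v 1) + 53 * H (v 2)) := by
  have hper : ∀ c, v (c + 107) = v c := fun c => by rw [hv, hv, cycPeriodSum_mul_add hm hg]
  have h3 : ∀ c, v (3 * c) = v c := fun c => by rw [hv, hv, cycPeriodSum_mul_three hg hF hQ]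
  have hperiod : Function.Periodic (cycPeriodSum f g (107 ^ m) (107 ^ (m - 1)) Q)
    (Q * 107 ^ m) := Function.Periodic.nat_mul (cycPeriodSum_add hg) Q
  have hvperiod : ∀ i c, v (c + 107 * i + 1) = v (c + 1) := fun i c => by
    have h : Function.Periodic v (i * 107) := Function.Periodic.nat_mul hper i
    rw [add_right_comm, mul_comm, h]
  rw [← sum_range_add_periodic (fun l => by rw [mul_comm, hperiod]) 1,
    show 107 ^ m * Q = Q * 107 * 107 ^ (m - 1) by
      rw [mul_assoc, ← pow_succ', Nat.sub_add_cancel hm, mul_comm],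
    sum_range_mul_eq, Finset.sum_congr rfl fun i _ => Finset.sum_congr rfl fun j hj => by
      rw [cycPeriodSum_add_mul_succ hg hF hQ i (Finset.mem_range.1 hj), ← hv]]
  simp only [Finset.sum_const, Finset.card_range, ← Finset.smul_sum]
  rw [sum_range_mul_eq]
  simp only [hvperiod, Finset.sum_const, Finset.card_range]
  rw [sum_range_add_periodic (u := fun c => H (v c)) (fun l => by rw [hper]) 1,
    sum_of_three_mul_invariant hper h3]
  simp only [nsmul_eq_mul]
  push_cast
  ring

end IndexTwo

section Teichmuller

theorem geom_sum_eq_zero {R : Type*} [CommRing R] [IsDomain R] {x : R} {n : ℕ} (hx : x ≠ 1)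
    (hn : x ^ n = 1) : ∑ i ∈ Finset.range n, x ^ i = 0 := by
  have h := mul_geom_sum x n
  rw [hn, sub_self] at h
  exact (mul_eq_zero.1 h).resolve_left (sub_ne_zero.2 hx)

variable {F : Type} [Field F] [Fact (Nat.Prime 3)] {g : F} {Q : ℕ}

theorem orderOf_teichmuller (x : F) : orderOf (WittVector.teichmuller 3 x) = orderOf x := by
  refine orderOf_injective (WittVector.teichmuller 3) (fun a b h => ?_) x
  simpa using congrArg (fun w => WittVector.coeff w 0) h

theorem sum_teichmuller_pow [CharP F 3] {m : ℕ} (hm : 1 ≤ m) (hg : orderOf g = 107 ^ m * Q)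
    (hNQ : 107 ^ m * Q ≠ 0) (κ Y : ℕ) :
    ∑ d ∈ cycUnion g (107 ^ m) (107 ^ (m - 1)) Q κ, WittVector.teichmuller 3 d ^ Y = 0 ∨
      ∃ a, Y = a * Q ∧ (¬ 107 ∣ a ∨ 107 ^ m ∣ a) := by
  set w := WittVector.teichmuller 3 g with hw
  have hwo : orderOf w = 107 ^ m * Q := (orderOf_teichmuller g).trans hg
  have hN : 0 < 107 ^ m := by positivity
  rw [sum_cycUnion hg (Nat.pow_le_pow_right (by norm_num) (Nat.sub_le _ _))]
  have hterm : ∀ i t, WittVector.teichmuller 3 (g ^ (i + κ + 107 ^ m * t)) ^ Y =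
      w ^ (κ * Y) * ((w ^ Y) ^ i * (w ^ (107 ^ m * Y)) ^ t) := fun i t => by
    rw [map_pow, ← hw]
    ring
  simp only [hterm, ← Finset.mul_sum]
  by_cases hY : w ^ (107 ^ m * Y) = 1
  · have hdvd : 107 ^ m * Q ∣ 107 ^ m * Y := hwo ▸ orderOf_dvd_of_pow_eq_one hY
    obtain ⟨a, rfl⟩ := Nat.dvd_of_mul_dvd_mul_left hN hdvd
    refine or_iff_not_imp_right.2 fun h => ?_
    push Not at h
    obtain ⟨⟨c, rfl⟩, hna⟩ := h a (mul_comm _ _)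
    have hgeom : ∑ i ∈ Finset.range (107 ^ (m - 1)), (w ^ (Q * (107 * c))) ^ i = 0 := by
      apply geom_sum_eq_zero
      · intro h1
        have h2 : 107 ^ m * Q ∣ 107 * c * Q := by
          rw [← hwo, mul_comm (107 * c)]
          exact orderOf_dvd_of_pow_eq_one h1
        exact hna (Nat.dvd_of_mul_dvd_mul_right (Nat.pos_of_ne_zero (right_ne_zero_of_mul hNQ)) h2)
      · rw [← pow_mul, show Q * (107 * c) * 107 ^ (m - 1) = 107 ^ (m - 1 + 1) * Q * c by ring,
          Nat.sub_add_cancel hm, ← hwo, pow_mul, pow_orderOf_eq_one, one_pow]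
    simp only [hY, one_pow, Finset.sum_const, Finset.card_range]
    simp only [mul_one, nsmul_eq_mul, mul_comm _ (Q : WittVector 3 F)]
    simp only [← Finset.mul_sum, hgeom, mul_zero]
  · left
    have hgeom : ∑ t ∈ Finset.range Q, (w ^ (107 ^ m * Y)) ^ t = 0 := by
      apply geom_sum_eq_zero hY
      rw [← pow_mul, show 107 ^ m * Y * Q = 107 ^ m * Q * Y by ring, ← hwo, pow_mul,
        pow_orderOf_eq_one, one_pow]
    simp only [hgeom, mul_zero, Finset.sum_const_zero]

end Teichmuller

section Valuation

theorem traceSum_eq {F : Type} [Field F] (f : ℕ) (D : Finset F) (x : F) :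
    traceSum f D x = 2 * D.card - 3 * (D.filter fun d => absTrace f (x * d) ≠ 0).card := by
  have h : ∀ d, traceKernel f (x * d) = 2 - 3 * if absTrace f (x * d) ≠ 0 then 1 else 0 :=
    fun d => by
      rw [traceKernel]
      split_ifs <;> simp_all
  simp only [traceSum, h, Finset.sum_sub_distrib, ← Finset.mul_sum, Finset.sum_boole,
    Finset.sum_const, nsmul_eq_mul]
  ring

/-- Three integers that satisfy the two moment identities and are congruent modulo `3 * 3 ^ e`
cannot be distinct. -/
theorem eq_or_eq_of_moments {s k a b c : ℤ} (hs : s ≠ 0) (hk : 107 * k = 27 * s ^ 2 - 1)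
    (ha : s ∣ a - 2 * k) (hb : s ∣ b - 2 * k) (hc : s ∣ c - 2 * k)
    (h1 : a + 53 * b + 53 * c = -2)
    (h2 : a ^ 2 + 53 * b ^ 2 + 53 * c ^ 2 = 4 * (27 * s ^ 2) - 4 * k) : a = b ∨ a = c := by
  obtain ⟨x, hx⟩ := dvd_sub ha hb
  obtain ⟨y, hy⟩ := dvd_sub ha hc
  have hx : a - b = s * x := by linarith
  have hy : a - c = s * y := by linarith
  have hbc : c - b = s * (x - y) := by linarith
  have key : s ^ 2 * (x ^ 2 + y ^ 2 + 53 * (x - y) ^ 2) = s ^ 2 * 216 := by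
    have hsq : 53 * (a - b) ^ 2 + 53 * (a - c) ^ 2 + 53 ^ 2 * (c - b) ^ 2 =
        107 * (a ^ 2 + 53 * b ^ 2 + 53 * c ^ 2) - (a + 53 * b + 53 * c) ^ 2 := by ring
    rw [hx, hy, hbc, h1, h2] at hsq
    nlinarith
  have key := mul_left_cancel₀ (pow_ne_zero 2 hs) key
  have hd : x - y ≤ 2 ∧ -2 ≤ x - y := ⟨by nlinarith [sq_nonneg x, sq_nonneg y],
    by nlinarith [sq_nonneg x, sq_nonneg y]⟩
  have hyb : y ≤ 14 ∧ -14 ≤ y := ⟨by nlinarith [sq_nonneg x, sq_nonneg (x - y)],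
    by nlinarith [sq_nonneg x, sq_nonneg (x - y)]⟩
  have hxy : x = 0 ∨ y = 0 := by
    obtain ⟨z, rfl⟩ : ∃ z, x = y + z := ⟨x - y, by ring⟩
    rw [add_sub_cancel_left] at hd key
    obtain ⟨hd1, hd2⟩ := hd
    obtain ⟨hy1, hy2⟩ := hyb
    interval_cases z <;> interval_cases y <;> omega
  rcases hxy with rfl | rfl
  · left; linarith
  · right; linarith

end Valuation

section Main

variable {F : Type} [Field F] [Fintype F] {g : F} {m Q f e : ℕ}

theorem exists_cycPeriodSum_eq (hm : 1 ≤ m) (hf : f = 53 * 107 ^ (m - 1)) (hfe : f = 2 * e + 5)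
    (hF : Fintype.card F = 3 ^ f) (hNQ : 107 ^ m * Q = 3 ^ f - 1) (hg : orderOf g = 3 ^ f - 1)
    {R : ℕ} (hR : 0 < R) (hQR : Q = 2 * R) [CharP F 3] :
    ∃ A B : ℤ, ∀ b, cycPeriodSum f g (107 ^ m) (107 ^ (m - 1)) Q b = A ∨
      cycPeriodSum f g (107 ^ m) (107 ^ (m - 1)) Q b = B := by
  have : Fact (Nat.Prime 3) := ⟨Nat.prime_three⟩
  have hg' : orderOf g = 107 ^ m * Q := hg.trans hNQ.symm
  have hf0 : 0 < f := by omega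
  have hN : 0 < 107 ^ m := by positivity
  have hNQ0 : 107 ^ m * Q ≠ 0 := Nat.mul_ne_zero hN.ne' (by omega)
  have hF' : Fintype.card F = 107 ^ m * Q + 1 := by omega
  have hnN : 107 ^ (m - 1) ≤ 107 ^ m := Nat.pow_le_pow_right (by norm_num) (Nat.sub_le _ _)
  have hQ3 : Nat.Coprime Q 3 := by
    rw [Nat.coprime_comm, Nat.prime_three.coprime_iff_not_dvd]
    intro h
    have h1 : 3 ∣ 3 ^ f - 1 := hNQ ▸ h.mul_left _
    have h2 : 3 ∣ 3 ^ f := dvd_pow_self 3 hf0.ne'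
    omega
  set n := 107 ^ (m - 1) with hn
  have hnQ : 107 * (n * Q) = 3 ^ f - 1 := by
    rw [← hNQ, ← mul_assoc, hn, ← pow_succ', Nat.sub_add_cancel hm]
  set D := cycUnion g (107 ^ m) n Q 0
  have hcard : D.card = n * Q := card_cycUnion hg' hnN 0
  have hneg : ∀ d ∈ D, -d ∈ D := neg_mem_cycUnion hg' hN hR hQR 0
  have h0 : (0 : F) ∉ D := zero_notMem_cycUnion hg' hNQ0 0
  have hT : ∀ b, traceSum f D (g ^ b) = cycPeriodSum f g (107 ^ m) n Q b := fun b =>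
    traceSum_cycUnion hg' hnN 0 b
  set v : ℕ → ℤ := fun c => cycPeriodSum f g (107 ^ m) n Q (n * c)
  have hq : (107 * (n * Q : ℕ) : ℤ) = 27 * (3 ^ (e + 1)) ^ 2 - 1 := by
    have h3 : 3 ^ f = 27 * (3 ^ (e + 1)) ^ 2 := by rw [hfe]; ring
    have : 107 * (n * Q) + 1 = 27 * (3 ^ (e + 1)) ^ 2 := by omega
    have := congrArg (Nat.cast : ℕ → ℤ) this
    push_cast at this ⊢
    linarith
  have h3 : (3 : ℤ) ^ f = 27 * (3 ^ (e + 1)) ^ 2 := by rw [hfe]; ring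
  have hdvd : ∀ c, (3 : ℤ) ^ (e + 1) ∣ v c - 2 * (n * Q : ℕ) := fun c => by
    change _ ∣ cycPeriodSum f g (107 ^ m) n Q (n * c) - _
    rw [← hT, traceSum_eq, hcard, sub_sub_cancel_left, dvd_neg, pow_succ']
    exact mul_dvd_mul_left 3 (by
      exact_mod_cast three_pow_dvd_card_absTrace_ne_zero hm hf hfe hNQ hF D
        (sum_teichmuller_pow hm hg' hNQ0 0) _)
  have hk0 : ((n * Q : ℕ) : ℤ) ≠ 0 := by
    have : 0 < 107 ^ (m - 1) := by positivity
    exact_mod_cast Nat.mul_ne_zero this.ne' (by omega)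
  have h1 : v 0 + 53 * v 1 + 53 * v 2 = -2 := by
    have h := sum_traceSum hf0 hF hneg h0
    rw [sum_eq_zero_add_sum_pow hg' hNQ0 hF', traceSum_zero, hcard] at h
    simp only [hT] at h
    have h' := sum_cycPeriodSum hm hg' hF hQ3 (fun x => x) (v := v) fun _ => rfl
    rw [h', mul_comm 2, ← mul_add] at h
    have := (mul_eq_zero.1 h).resolve_left hk0
    linarith
  have h2 : v 0 ^ 2 + 53 * v 1 ^ 2 + 53 * v 2 ^ 2 =
      4 * (27 * (3 ^ (e + 1)) ^ 2) - 4 * (n * Q : ℕ) := by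
    have h := sum_traceSum_sq hf0 hF hneg
    rw [sum_eq_zero_add_sum_pow hg' hNQ0 hF', traceSum_zero, hcard] at h
    simp only [hT] at h
    have h' := sum_cycPeriodSum hm hg' hF hQ3 (fun x => x ^ 2) (v := v) fun _ => rfl
    rw [h', h3] at h
    apply mul_left_cancel₀ hk0
    linarith
  have hcases : ∀ b, cycPeriodSum f g (107 ^ m) n Q b = v 0 ∨
      cycPeriodSum f g (107 ^ m) n Q b = v 1 ∨ cycPeriodSum f g (107 ^ m) n Q b = v 2 :=
    fun b => by
      obtain ⟨c, hc, h⟩ := cycPeriodSum_cases hm hg' hF hQ3 b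
      interval_cases c
      · exact Or.inl h
      · exact Or.inr (Or.inl h)
      · exact Or.inr (Or.inr h)
  rcases eq_or_eq_of_moments (by positivity) hq (hdvd 0) (hdvd 1) (hdvd 2) h1 h2 with h | h
  · exact ⟨v 1, v 2, fun b => by have := hcases b; rw [h] at this; tauto⟩
  · exact ⟨v 1, v 2, fun b => by have := hcases b; rw [h] at this; tauto⟩

end Main

/-- Each `Cay(F_q, D_k)` is a strongly regular graph of degree `(q-1)/107`,
where `q = 3^{53*107^(m-1)}`, `N = 107^m`. -/
theorem cayley_srg_example_15
    (m N q : ℕ) (hm : 1 ≤ m)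
    (hN : N = 107 ^ m) (hq : q = 3 ^ (53 * 107 ^ (m - 1)))
    (F : Type) [Field F] [Fintype F] (hF : Fintype.card F = q)
    (γ : Fˣ) (hγ : orderOf γ = q - 1)
    (D : ℕ → Set F)
    (hD : ∀ k, D k = {x : F | ∃ i < 107 ^ (m - 1), ∃ t : ℕ,
        x = ((γ : F)) ^ (i + k * 107 ^ (m - 1) + N * t)}) :
    ∀ k ≤ 106,
      SimpleGraph.fromRel (fun x y : F => x - y ∈ D k) ≠ ⊤ ∧
      SimpleGraph.fromRel (fun x y : F => x - y ∈ D k) ≠ ⊥ ∧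
      ∃ l u : ℕ, (SimpleGraph.fromRel (fun x y : F => x - y ∈ D k)).IsSRGWith
        q ((q - 1) / 107) l u := by
  subst hN
  set f := 53 * 107 ^ (m - 1) with hf
  set n := 107 ^ (m - 1) with hn
  have : Fact (Nat.Prime 3) := ⟨Nat.prime_three⟩
  have hn0 : 0 < n := by positivity
  have hF3 : Fintype.card F = 3 ^ f := hF.trans hq
  have : CharP F 3 := charP_of_card_eq_prime_pow hF3
  have hodd : Odd f := Nat.odd_mul.2 ⟨by norm_num, Odd.pow (by norm_num)⟩
  obtain ⟨e, he⟩ : ∃ e, f = 2 * e + 5 := by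
    obtain ⟨c, hc⟩ := hodd
    exact ⟨c - 2, by omega⟩
  obtain ⟨Q, hNQ⟩ : 107 ^ m ∣ 3 ^ f - 1 := (dvd_three_pow_sub_one_iff hm).2 dvd_rfl
  have hpow : 1 < 3 ^ f := Nat.one_lt_pow (by omega) (by norm_num)
  have hNQ0 : 107 ^ m * Q ≠ 0 := by omega
  have hQ0 : 0 < Q := Nat.pos_of_ne_zero (right_ne_zero_of_mul hNQ0)
  have hN0 : 0 < 107 ^ m := by positivity
  obtain ⟨R, hQR⟩ : 2 ∣ Q := by
    have h2 : Odd (3 ^ f) := Odd.pow (by norm_num)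
    have h : Even (107 ^ m * Q) := hNQ ▸ h2.tsub_odd odd_one
    have hNodd : Odd (107 ^ m) := Odd.pow (by norm_num)
    exact (Nat.even_mul.1 h |>.resolve_left (Nat.not_even_iff_odd.2 hNodd)).two_dvd
  have hR : 0 < R := by omega
  have hg : orderOf (γ : F) = 3 ^ f - 1 := by rw [orderOf_units, hγ, hq]
  have hg' : orderOf (γ : F) = 107 ^ m * Q := hg.trans hNQ
  have hF' : Fintype.card F = 107 ^ m * Q + 1 := by omega
  have hnN : n ≤ 107 ^ m := Nat.pow_le_pow_right (by norm_num) (Nat.sub_le _ _)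
  have hnQ : 107 * (n * Q) = 3 ^ f - 1 := by
    rw [hNQ, ← mul_assoc, hn, ← pow_succ', Nat.sub_add_cancel hm]
  obtain ⟨A, B, hAB⟩ := exists_cycPeriodSum_eq hm hf he hF3 hNQ.symm hg hR hQR
  intro k _
  set S := cycUnion (γ : F) (107 ^ m) n Q (k * n)
  have hDS : D k = (S : Set F) := by
    rw [hD]
    ext x
    exact (mem_cycUnion hg' hQ0 _ x).symm
  have hneg : ∀ d ∈ S, -d ∈ S := neg_mem_cycUnion hg' hN0 hR hQR _
  have h0 : (0 : F) ∉ S := zero_notMem_cycUnion hg' hNQ0 _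
  have hcard : S.card = n * Q := card_cycUnion hg' hnN _
  obtain ⟨l, u, hlu⟩ := exists_diffCount_eq (f := f) (D := S) (A := A) (B := B) (by omega) hF3
    hneg fun x hx => by
      obtain ⟨b, rfl⟩ := exists_pow_eq hg' hNQ0 hF' hx
      rw [traceSum_cycUnion hg' hnN]
      exact hAB _
  have hsrg := isSRGWith_of_diffCount hneg h0 hlu
  have hpos : 0 < n * Q := Nat.mul_pos hn0 hQ0
  rw [hDS]
  refine ⟨fun htop => ?_, fun hbot => ?_, l, u, ?_⟩
  · have hsub : Finset.univ.erase 0 ⊆ S := fun x hx => by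
      have h := (fromRel_sub_adj hneg h0 x 0).1 (by
        rw [htop, SimpleGraph.top_adj]
        exact Finset.ne_of_mem_erase hx)
      rwa [sub_zero] at h
    have h := Finset.card_le_card hsub
    rw [Finset.card_erase_of_mem (Finset.mem_univ _), Finset.card_univ, hcard] at h
    omega
  · obtain ⟨d, hd⟩ := Finset.card_pos.1 (hcard ▸ hpos)
    have h := (fromRel_sub_adj hneg h0 d 0).2 (by rwa [sub_zero])
    rw [hbot] at h
    exact h
  · rw [hF, hcard, show n * Q = (q - 1) / 107 by omega] at hsrg
    convert hsrg
end
end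

section
/- Let m ≥ 1, p = 5, p1 = 19, N = 19^m, and q = 5^{9·19^{m−1}}. Then for every k with 0 ≤ k ≤ 18, the Cayley graph Cay(F_q, D_k) is a strongly regular graph of degree (q−1)/19, where D_k = ∪_{i=0}^{19^{m−1}−1} C_{i + k·19^{m−1}}. -/
open scoped Classical

noncomputable section

lemma orderOf_five_zmod (n : ℕ) : orderOf (5 : ZMod (19 ^ (n + 1))) = 9 * 19 ^ n := by
  have h9 : orderOf ((5 : ZMod (19 ^ (n + 1))) ^ 9) = 19 ^ n := by
    have := ZMod.orderOf_one_add_mul_prime (p := 19) (by norm_num) (by norm_num) 102796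
      (by norm_num) n
    rw [← this]
    congr 1
    norm_num
  have hdvd : 9 ∣ orderOf (5 : ZMod (19 ^ (n + 1))) := by
    have h19 : orderOf (5 : ZMod 19) = 9 :=
      orderOf_eq_of_pow_and_pow_div_prime (by norm_num) (by decide) (by
        intro p hp hp9
        have : p = 3 := (Nat.prime_dvd_prime_iff_eq hp Nat.prime_three).1
          (hp.dvd_of_dvd_pow (by simpa using hp9 : p ∣ 3 ^ 2))
        subst this
        decide)
    have := orderOf_map_dvd (ZMod.castHom (dvd_pow_self 19 n.succ_ne_zero) (ZMod 19)).toMonoidHom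
      (5 : ZMod (19 ^ (n + 1)))
    rwa [RingHom.toMonoidHom_eq_coe, MonoidHom.coe_coe, map_ofNat, h19] at this
  rw [orderOf_pow_of_dvd (by norm_num) hdvd] at h9
  rw [← h9, Nat.mul_div_cancel' hdvd]

lemma two_mul_sum_residues_le (A : Finset ℕ)
    (hA : A = {1, 4, 5, 6, 7, 9, 11, 16, 17} ∨ A = {2, 3, 8, 10, 12, 13, 14, 15, 18}) (M : ℕ) :
    2 * ∑ r ∈ Finset.range (19 * M), (if r % 19 ∈ A then r else 0) ≤ 19 * M * (9 * M + 1) := by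
  induction M with
  | zero => simp
  | succ M ih =>
    have h : ∑ r ∈ Finset.range 19, (if (19 * M + r) % 19 ∈ A then 19 * M + r else 0)
        ≤ 171 * M + 95 := by
      rcases hA with rfl | rfl <;>
      · simp [Finset.sum_range_succ]
        omega
    rw [mul_add, mul_one, Finset.sum_range_add, mul_add]
    nlinarith

/-- The residues `u * 5 ^ i` modulo `19 ^ (n + 1)` sum to at most what the larger of the two
cosets of the quadratic residues gives. -/
lemma two_mul_sum_orbit_le (n u : ℕ) (hu : ¬ 19 ∣ u) :
    2 * ∑ i ∈ Finset.range (9 * 19 ^ n), (u * 5 ^ i % 19 ^ (n + 1))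
      ≤ 19 ^ (n + 1) * (9 * 19 ^ n + 1) := by
  obtain ⟨A, hA, hmem⟩ : ∃ A : Finset ℕ,
      (A = {1, 4, 5, 6, 7, 9, 11, 16, 17} ∨ A = {2, 3, 8, 10, 12, 13, 14, 15, 18}) ∧
      ∀ i, u * 5 ^ i % 19 ∈ A := by
    have h1 : (u % 19) ∈ ({1, 4, 5, 6, 7, 9, 11, 16, 17} : Finset ℕ) ∨
        (u % 19) ∈ ({2, 3, 8, 10, 12, 13, 14, 15, 18} : Finset ℕ) := by
      simp only [Finset.mem_insert, Finset.mem_singleton]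
      omega
    rcases h1 with h1 | h1
    · refine ⟨_, Or.inl rfl, fun i => ?_⟩
      induction i with
      | zero => simpa using h1
      | succ i ih =>
        rw [pow_succ, ← mul_assoc]
        simp only [Finset.mem_insert, Finset.mem_singleton] at ih ⊢
        omega
    · refine ⟨_, Or.inr rfl, fun i => ?_⟩
      induction i with
      | zero => simpa using h1
      | succ i ih =>
        rw [pow_succ, ← mul_assoc]
        simp only [Finset.mem_insert, Finset.mem_singleton] at ih ⊢
        omega
  have hinj : Set.InjOn (fun i => u * 5 ^ i % 19 ^ (n + 1)) (Finset.range (9 * 19 ^ n)) := by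
    intro i hi j hj hij
    simp only [Finset.coe_range, Set.mem_Iio] at hi hj
    have hcop : Nat.gcd (19 ^ (n + 1)) u = 1 :=
      Nat.Coprime.pow_left _ ((Nat.Prime.coprime_iff_not_dvd (by norm_num)).2 hu)
    have h := Nat.ModEq.cancel_left_of_coprime hcop hij
    have h' : (5 : ZMod (19 ^ (n + 1))) ^ i = 5 ^ j := by
      exact_mod_cast (ZMod.natCast_eq_natCast_iff _ _ _).2 h
    rw [← orderOf_five_zmod] at hi hj
    exact pow_injOn_Iio_orderOf hi hj h'
  calc 2 * ∑ i ∈ Finset.range (9 * 19 ^ n), (u * 5 ^ i % 19 ^ (n + 1))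
      = 2 * ∑ r ∈ (Finset.range (9 * 19 ^ n)).image (fun i => u * 5 ^ i % 19 ^ (n + 1)), r := by
        rw [Finset.sum_image hinj]
    _ ≤ 2 * ∑ r ∈ (Finset.range (19 * 19 ^ n)).filter (fun r => r % 19 ∈ A), r := by
        refine Nat.mul_le_mul_left _ (Finset.sum_le_sum_of_subset ?_)
        intro r hr
        simp only [Finset.mem_image, Finset.mem_range] at hr
        obtain ⟨i, -, rfl⟩ := hr
        rw [Finset.mem_filter, Finset.mem_range,
          Nat.mod_mod_of_dvd _ (dvd_pow_self 19 n.succ_ne_zero), ← pow_succ']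
        exact ⟨Nat.mod_lt _ (by positivity), hmem i⟩
    _ ≤ _ := by
        rw [Finset.sum_filter, pow_succ']
        exact two_mul_sum_residues_le A hA _

instance Nat.fact_prime_five : Fact (Nat.Prime 5) := ⟨Nat.prime_five⟩

section GaussSum

variable {F R : Type*} [Field F] [Fintype F] [CommRing R] [IsDomain R]

lemma gaussSum_mul_dvd {ψ : AddChar F R} (hψ : ψ ≠ 1) (χ χ' : MulChar F R) :
    gaussSum (χ * χ') ψ ∣ gaussSum χ ψ * gaussSum χ' ψ := by
  by_cases h : χ * χ' = 1
  · rw [h, gaussSum_one_left hψ]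
    exact (isUnit_one.neg).dvd
  · exact ⟨_, (jacobiSum_mul_nontrivial h ψ).symm⟩

lemma gaussSum_pow_dvd {ψ : AddChar F R} (hψ : ψ ≠ 1) (χ : MulChar F R) (n : ℕ) :
    gaussSum (χ ^ n) ψ ∣ gaussSum χ ψ ^ n := by
  induction n with
  | zero =>
    rw [pow_zero, gaussSum_one_left hψ]
    exact (isUnit_one.neg).dvd
  | succ n ih =>
    rw [pow_succ, pow_succ]
    exact (gaussSum_mul_dvd hψ _ _).trans (mul_dvd_mul_right ih _)

omit [IsDomain R] in
lemma gaussSum_pow_char {p : ℕ} [Fact p.Prime] [CharP F p] {ψ : AddChar F R}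
    (hψ : ∀ x, ψ (x ^ p) = ψ x) (χ : MulChar F R) :
    gaussSum (χ ^ p) ψ = gaussSum χ ψ := by
  have hp : p ≠ 0 := (Fact.out : p.Prime).ne_zero
  unfold gaussSum
  rw [← (bijective_frobenius F p).sum_comp (fun x => χ x * ψ x)]
  simp [frobenius_def, hψ, MulChar.pow_apply' _ hp]

/-- The Horner scheme for the base `p` expansion of `u / N`. -/
lemma gaussSum_pow_div_dvd {p : ℕ} [Fact p.Prime] [CharP F p] {ψ : AddChar F R}
    (hψ : ψ ≠ 1) (hψp : ∀ x, ψ (x ^ p) = ψ x) (χ : MulChar F R) {u N : ℕ} (hu : u < N)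
    (j : ℕ) :
    gaussSum (χ ^ (u * p ^ j / N)) ψ ∣
      gaussSum χ ψ ^ (∑ i ∈ Finset.range j, p * (u * p ^ i % N) / N) := by
  induction j with
  | zero =>
    rw [pow_zero, mul_one, Nat.div_eq_of_lt hu, pow_zero, gaussSum_one_left hψ]
    exact (isUnit_one.neg).dvd
  | succ j ih =>
    have hdiv : u * p ^ (j + 1) / N = u * p ^ j / N * p + p * (u * p ^ j % N) / N := by
      conv_lhs => rw [pow_succ, ← mul_assoc, ← Nat.div_add_mod (u * p ^ j) N, add_mul, mul_assoc,
        Nat.mul_add_div (by omega), mul_comm (u * p ^ j % N)]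
    rw [hdiv, pow_add, pow_mul, Finset.sum_range_succ, pow_add]
    refine (gaussSum_mul_dvd hψ _ _).trans (mul_dvd_mul ?_ (gaussSum_pow_dvd hψ _ _))
    rwa [gaussSum_pow_char hψp]

end GaussSum

lemma mul_sum_digits_eq (p u N j : ℕ) (hj : u * p ^ j % N = u % N) :
    N * ∑ i ∈ Finset.range j, p * (u * p ^ i % N) / N + ∑ i ∈ Finset.range j, u * p ^ i % N
      = p * ∑ i ∈ Finset.range j, u * p ^ i % N := by
  have h1 : ∑ i ∈ Finset.range j, u * p ^ (i + 1) % N = ∑ i ∈ Finset.range j, u * p ^ i % N := by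
    have h := Finset.sum_range_succ (fun i => u * p ^ i % N) j
    rw [Finset.sum_range_succ', hj, pow_zero, mul_one] at h
    exact Nat.add_right_cancel h
  rw [← h1, Finset.mul_sum, ← Finset.sum_add_distrib, h1, Finset.mul_sum]
  refine Finset.sum_congr rfl fun i _ => ?_
  conv_rhs => rw [← Nat.div_add_mod (p * (u * p ^ i % N)) N]
  rw [pow_succ, mul_comm p, Nat.mod_mul_mod, mul_assoc u]

/-- Divisibility by `5 ^ e` can be tested after multiplication by an element that survives in
residue characteristic `5`. -/
lemma five_pow_dvd_of_dvd_mul {R K : Type*} [CommRing R] [IsDomain R] [Field K] [CharP K 5]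
    (φ : R →+* K) {π w : R} (hπ : π ≠ 0) (hφπ : φ π = 0) (hw : π ^ 4 * w = 5) (hφw : φ w ≠ 0)
    (e : ℕ) (v : R) (hv : φ v ≠ 0) (n : ℤ) (h : π ^ (4 * e) ∣ v * n) : (5 : ℤ) ^ e ∣ n := by
  induction e generalizing v n with
  | zero => simp
  | succ e ih =>
    have h0 : φ v * n = 0 := by
      obtain ⟨c, hc⟩ := h
      have := congrArg φ hc
      simpa [hφπ] using this
    have h5 : (5 : ℤ) ∣ n := by
      have h1 : (n : K) = 0 := by simpa [hv] using h0
      exact_mod_cast (CharP.intCast_eq_zero_iff K 5 n).1 h1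
    obtain ⟨n', rfl⟩ := h5
    rw [pow_succ']
    refine mul_dvd_mul_left _ (ih (v * w) (by simp [hv, hφw]) n' ?_)
    rw [mul_add, pow_add, mul_comm] at h
    refine (mul_dvd_mul_iff_left (pow_ne_zero (4 * 1) hπ)).1 (h.trans (dvd_of_eq ?_))
    push_cast
    rw [← hw]
    ring

lemma IsPrimitiveRoot.sub_one_pow_four_mul {R : Type*} [CommRing R] [IsDomain R] {ζ : R}
    (hζ : IsPrimitiveRoot ζ 5) : (ζ - 1) ^ 4 * (ζ ^ 2 * (ζ + 1) ^ 2) = 5 := by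
  have h : 1 + ζ + ζ ^ 2 + ζ ^ 3 + ζ ^ 4 = 0 := by
    simpa [Finset.sum_range_succ] using hζ.geom_sum_eq_zero (by norm_num)
  linear_combination (ζ ^ 4 - 3 * ζ ^ 3 + ζ ^ 2 + 5 * ζ - 5) * h

section Trace

variable {F R K : Type*} [Field F] [Fintype F] [Algebra (ZMod 5) F] [CommRing R]

/-- The additive character `x ↦ ζ ^ Tr x`. -/
def traceChar (F : Type*) [Field F] [Algebra (ZMod 5) F] {ζ : R} (hζ : ζ ^ 5 = 1) :
    AddChar F R :=
  (AddChar.zmodChar 5 hζ).compAddMonoidHom (Algebra.trace (ZMod 5) F).toAddMonoidHom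

omit [Fintype F] in
lemma traceChar_apply {ζ : R} (hζ : ζ ^ 5 = 1) (x : F) :
    traceChar F hζ x = ζ ^ (Algebra.trace (ZMod 5) F x).val := rfl

lemma traceChar_pow_five {ζ : R} (hζ : ζ ^ 5 = 1) (x : F) :
    traceChar F hζ (x ^ 5) = traceChar F hζ x := by
  have : CharP F 5 := charP_of_injective_algebraMap (algebraMap (ZMod 5) F).injective 5
  have h : Algebra.trace (ZMod 5) F (x ^ 5) = Algebra.trace (ZMod 5) F x := by
    have := Algebra.trace_eq_of_algEquiv
      (FiniteField.frobeniusAlgEquiv (ZMod 5) F 5) x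
    simpa using this
  rw [traceChar_apply, traceChar_apply, h]

lemma traceChar_ne_one {ζ : R} (hζ : IsPrimitiveRoot ζ 5) :
    traceChar F hζ.pow_eq_one ≠ 1 := by
  obtain ⟨x, hx⟩ := Algebra.trace_surjective (ZMod 5) F 1
  intro h
  have h1 : ζ = 1 := by
    have := DFunLike.congr_fun h x
    rwa [traceChar_apply, hx, AddChar.one_apply, show (1 : ZMod 5).val = 1 from rfl,
      pow_one] at this
  exact hζ.ne_one (by norm_num) h1

lemma sum_inv_mul_trace :
    ∑ x : F, x⁻¹ * algebraMap (ZMod 5) F (Algebra.trace (ZMod 5) F x) = -1 := by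
  have hcard : Fintype.card F = 5 ^ Module.finrank (ZMod 5) F := by
    simpa using Module.card_eq_pow_finrank (K := ZMod 5) (V := F)
  have hfin : 0 < Module.finrank (ZMod 5) F := Module.finrank_pos
  simp_rw [FiniteField.algebraMap_trace_eq_sum_pow, Finset.mul_sum]
  rw [Finset.sum_comm, Finset.sum_eq_single_of_mem 0 (Finset.mem_range.2 hfin)]
  · have h : ∀ x : F, x⁻¹ * x ^ Nat.card (ZMod 5) ^ 0 = 1 - if x = 0 then 1 else 0 := by
      intro x
      by_cases hx : x = 0 <;> simp [hx]
    rw [Finset.sum_congr rfl fun x _ => h x, Finset.sum_sub_distrib]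
    simp
  · intro i hi hi0
    rw [← FiniteField.sum_pow_lt_card_sub_one F (5 ^ i - 1) ?_]
    · have h2 : 2 ≤ 5 ^ i := (by norm_num : 2 ≤ 5).trans (Nat.le_self_pow hi0 5)
      refine Finset.sum_congr rfl fun x _ => ?_
      by_cases hx : x = 0
      · simp [hx, show 5 ^ i - 1 ≠ 0 by omega]
      · rw [Nat.card_zmod, pow_sub₀ _ hx (by omega), pow_one, mul_comm]
    · rw [hcard]
      have := Nat.pow_lt_pow_right (by norm_num : 1 < 5) (Finset.mem_range.1 hi)
      exact Nat.sub_lt_sub_right (Nat.one_le_pow _ _ (by norm_num)) this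

/-- Stickelberger's congruence for the inverse of the Teichmüller character `ω`: its Gauss sum is
exactly divisible by `ζ - 1`. -/
lemma exists_gaussSum_inv_eq [IsDomain R] [Field K] {φ : R →+* K} {ι : F →+* K}
    {ω : MulChar F R} (hω : ∀ x, φ (ω x) = ι x) {ζ : R} (hζ : ζ ^ 5 = 1)
    (hF : 2 < Fintype.card F) :
    ∃ u, gaussSum ω⁻¹ (traceChar F hζ) = (ζ - 1) * u ∧ φ u = -1 := by
  have : CharP F 5 := charP_of_injective_algebraMap (algebraMap (ZMod 5) F).injective 5
  have : CharP K 5 := charP_of_injective_ringHom ι.injective 5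
  have hφζ : φ ζ = 1 := by
    have h : (φ ζ - 1) ^ 5 = 0 := by rw [sub_pow_char, ← map_pow, hζ]; simp
    exact sub_eq_zero.1 (pow_eq_zero_iff (by norm_num) |>.1 h)
  have hne : ω⁻¹ ≠ 1 := by
    rw [Ne, inv_eq_one]
    rintro rfl
    obtain ⟨x, -, hx⟩ : ∃ x ∈ (Finset.univ : Finset F), x ∉ ({0, 1} : Finset F) :=
      Finset.exists_mem_notMem_of_card_lt_card
        (Finset.card_le_two.trans_lt (by rwa [Finset.card_univ]))
    simp only [Finset.mem_insert, Finset.mem_singleton, not_or] at hx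
    have := hω x
    rw [MulChar.one_apply (isUnit_iff_ne_zero.2 hx.1), map_one, ← map_one ι] at this
    exact hx.2 (ι.injective this).symm
  refine ⟨∑ x, ω⁻¹ x * ∑ i ∈ Finset.range (Algebra.trace (ZMod 5) F x).val, ζ ^ i, ?_, ?_⟩
  · rw [← sub_zero (gaussSum _ _), ← MulChar.sum_eq_zero_of_ne_one hne, gaussSum,
      ← Finset.sum_sub_distrib, Finset.mul_sum]
    refine Finset.sum_congr rfl fun x _ => ?_
    rw [traceChar_apply, mul_left_comm, mul_geom_sum]
    ring
  · rw [map_sum, ← map_one ι, ← map_neg, ← sum_inv_mul_trace, map_sum]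
    refine Finset.sum_congr rfl fun x _ => ?_
    rw [map_mul, MulChar.inv_apply', hω, map_mul]
    congr 1
    rw [map_sum]
    simp only [map_pow, hφζ, one_pow, Finset.sum_const, Finset.card_range, nsmul_eq_mul, mul_one]
    conv_rhs => rw [← ZMod.natCast_zmod_val (Algebra.trace (ZMod 5) F x), map_natCast, map_natCast]

end Trace

/-- A Teichmüller lift of the multiplicative group of a finite field of characteristic `p` to a
domain of characteristic zero that also contains a primitive `p`-th root of unity. -/
lemma exists_teichmuller (p : ℕ) [Fact p.Prime] (F : Type) [Field F] [Fintype F]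
    [Algebra (ZMod p) F] :
    ∃ (R : Type) (_ : CommRing R) (_ : IsDomain R) (_ : CharZero R) (K : Type) (_ : Field K)
      (φ : R →+* K) (ι : F →+* K) (ω : MulChar F R) (ζ : R),
      IsPrimitiveRoot ζ p ∧ ∀ x, φ (ω x) = ι x := by
  have hp : p.Prime := Fact.out
  let R := integralClosure ℤ ℂ
  have hnu : ¬ IsUnit (p : R) := by
    intro h
    obtain ⟨r, hr⟩ := h.exists_right_inv
    have hr' : (p : ℂ) * (r : ℂ) = 1 := by
      have := congrArg (Subtype.val) hr
      simpa using this
    have hp0 : (p : ℂ) ≠ 0 := by exact_mod_cast hp.ne_zero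
    have hint : IsIntegral ℤ (algebraMap ℚ ℂ ((p : ℚ)⁻¹)) := by
      have : algebraMap ℚ ℂ ((p : ℚ)⁻¹) = r := by
        simp only [map_inv₀, map_natCast]
        field_simp
        exact hr'.symm
      rw [this]
      exact r.2
    obtain ⟨n, hn⟩ := IsIntegrallyClosed.isIntegral_iff.1
      ((isIntegral_algebraMap_iff (algebraMap ℚ ℂ).injective).1 hint)
    have h1 : (p : ℤ) * n = 1 := by
      have : (p : ℚ) * n = 1 := by
        have hp0 : (p : ℚ) ≠ 0 := by exact_mod_cast hp.ne_zero
        have hn' : (n : ℚ) = (p : ℚ)⁻¹ := by simpa using hn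
        rw [hn', mul_inv_cancel₀ hp0]
      exact_mod_cast this
    have := Int.isUnit_iff.1 (IsUnit.of_mul_eq_one _ h1)
    have := hp.two_le
    omega
  obtain ⟨P, hP, hpP⟩ := Ideal.exists_le_maximal (Ideal.span {(p : R)})
    (by rwa [Ne, Ideal.span_singleton_eq_top])
  let _ : Field (R ⧸ P) := Ideal.Quotient.field P
  let K := AlgebraicClosure (R ⧸ P)
  let φ : R →+* K := (algebraMap (R ⧸ P) K).comp (Ideal.Quotient.mk P)
  have hK : (p : K) = 0 := by
    have h : Ideal.Quotient.mk P (p : R) = 0 :=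
      Ideal.Quotient.eq_zero_iff_mem.2 (hpP (Ideal.mem_span_singleton_self _))
    have := congrArg (algebraMap (R ⧸ P) K) h
    simpa using this
  have : CharP K p := (CharP.charP_iff_prime_eq_zero hp).2 hK
  let _ : Algebra (ZMod p) K := ZMod.algebra K p
  let ι : F →ₐ[ZMod p] K := IsAlgClosed.lift
  obtain ⟨g, hg⟩ := IsCyclic.exists_generator (α := Fˣ)
  have hcard : orderOf g = Fintype.card F - 1 := by
    rw [orderOf_eq_card_of_forall_mem_zpowers hg, Nat.card_eq_fintype_card, Fintype.card_units]
  have hpos : 0 < Fintype.card F - 1 := hcard ▸ orderOf_pos g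
  have hroot : ∀ n : ℕ, n ≠ 0 → ∃ r : R, IsPrimitiveRoot r n := by
    intro n hn
    have h := Complex.isPrimitiveRoot_exp n hn
    exact ⟨⟨_, h.isIntegral (Nat.pos_of_ne_zero hn)⟩,
      IsPrimitiveRoot.of_map_of_injective (f := R.val) h Subtype.val_injective⟩
  obtain ⟨ρ, hρ⟩ := hroot _ hpos.ne'
  obtain ⟨ζ, hζ⟩ := hroot p hp.ne_zero
  obtain ⟨η, hη, hηι⟩ : ∃ η : R, η ^ (Fintype.card F - 1) = 1 ∧ φ η = ι g := by
    have h := congrArg (Polynomial.eval₂ φ (ι g)) (Polynomial.X_pow_sub_one_eq_prod hpos hρ)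
    have hg1 : (g : F) ^ (Fintype.card F - 1) = 1 := by
      rw [← hcard, ← Units.val_pow_eq_pow_val, pow_orderOf_eq_one, Units.val_one]
    simp only [Polynomial.eval₂_sub, Polynomial.eval₂_pow, Polynomial.eval₂_X,
      Polynomial.eval₂_one, Polynomial.eval₂_finsetProd, Polynomial.eval₂_C, ← map_pow, hg1,
      map_one, sub_self] at h
    obtain ⟨η, hη, h0⟩ := Finset.prod_eq_zero_iff.1 h.symm
    exact ⟨η, (Polynomial.mem_nthRootsFinset hpos 1).1 hη, (sub_eq_zero.1 h0).symm⟩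
  let η' : Rˣ := Units.ofPowEqOne η _ hη hpos.ne'
  have hη' : orderOf η' ∣ orderOf g := by
    rw [hcard]
    exact orderOf_dvd_of_pow_eq_one (Units.ext (by simp [η']))
  let f : Fˣ →* Rˣ := monoidHomOfForallMemZpowers hg hη'
  refine ⟨R, inferInstance, inferInstance, inferInstance, K, inferInstance, φ, ι,
    MulChar.ofUnitHom f, ζ, hζ, fun x => ?_⟩
  by_cases hx : x = 0
  · rw [hx, MulChar.map_zero, map_zero, map_zero]
  · obtain ⟨x, rfl⟩ : IsUnit x := isUnit_iff_ne_zero.2 hx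
    obtain ⟨n, rfl⟩ := (mem_powers_iff_mem_zpowers).2 (hg x)
    rw [MulChar.ofUnitHom_coe, map_pow, monoidHomOfForallMemZpowers_apply_gen]
    simp only [Units.val_pow_eq_pow_val, map_pow]
    congr 1

section CharacterSums

variable {F R : Type*} [Field F] [Fintype F] [CommRing R] [IsDomain R]

lemma sum_charSum_mul {ψ : AddChar F R} (hψ : ψ.IsPrimitive) (D : Finset F) (z : F) :
    ∑ b, (∑ x ∈ D, ψ (b * x)) * ψ (-(b * z)) = if z ∈ D then (Fintype.card F : R) else 0 := by
  simp_rw [Finset.sum_mul, ← AddChar.map_add_eq_mul]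
  rw [Finset.sum_comm]
  simp_rw [← sub_eq_add_neg, ← mul_sub, AddChar.sum_mulShift _ hψ, sub_eq_zero]
  simp

lemma sum_charSum_sq_mul {ψ : AddChar F R} (hψ : ψ.IsPrimitive) (D : Finset F) (z : F) :
    ∑ b, (∑ x ∈ D, ψ (b * x)) ^ 2 * ψ (-(b * z))
      = (Fintype.card F : R) * (D.filter fun x => z - x ∈ D).card := by
  have h : ∀ b, (∑ x ∈ D, ψ (b * x)) ^ 2 * ψ (-(b * z))
      = ∑ y ∈ D, (∑ x ∈ D, ψ (b * x)) * ψ (-(b * (z - y))) := by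
    intro b
    have h' : (∑ x ∈ D, ψ (b * x)) * ψ (-(b * z)) = ∑ y ∈ D, ψ (-(b * (z - y))) := by
      rw [Finset.sum_mul]
      refine Finset.sum_congr rfl fun y _ => ?_
      rw [← AddChar.map_add_eq_mul]
      congr 1
      ring
    rw [sq, mul_assoc, h', Finset.mul_sum]
  rw [Finset.sum_congr rfl fun b _ => h b, Finset.sum_comm]
  simp_rw [sum_charSum_mul hψ]
  rw [← Finset.sum_filter, Finset.sum_const, nsmul_eq_mul, mul_comm]

/-- If the nontrivial character values of `D` satisfy a common quadratic equation, the number of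
representations of a nonzero `z` as a sum of two elements of `D` depends only on whether
`z ∈ D`. -/
lemma card_filter_sub_mem_eq [CharZero R] {ψ : AddChar F R} (hψ : ψ.IsPrimitive) (D : Finset F)
    {A B C : R} (hC : C ≠ 0)
    (h : ∀ b ≠ 0, C * (∑ x ∈ D, ψ (b * x)) ^ 2 = A * (∑ x ∈ D, ψ (b * x)) + B)
    {z z' : F} (hz : z ≠ 0) (hz' : z' ≠ 0) (hzz' : z ∈ D ↔ z' ∈ D) :
    (D.filter fun x => z - x ∈ D).card = (D.filter fun x => z' - x ∈ D).card := by
  have key : ∀ z ≠ 0, C * ((Fintype.card F : R) * (D.filter fun x => z - x ∈ D).card)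
      = A * (if z ∈ D then (Fintype.card F : R) else 0)
        + (C * (D.card : R) ^ 2 - A * D.card - B) := by
    intro z hz
    have hB : ∑ b : F, ψ (-(b * z)) = 0 := by
      simp_rw [← mul_neg]
      rw [AddChar.sum_mulShift _ hψ, if_neg (neg_ne_zero.2 hz), Nat.cast_zero]
    rw [← sum_charSum_sq_mul hψ, ← sum_charSum_mul hψ, Finset.mul_sum, Finset.mul_sum,
      ← sub_eq_iff_eq_add', ← Finset.sum_sub_distrib]
    rw [← sub_zero (Finset.sum _ _), ← mul_zero B, ← hB, Finset.mul_sum, ← Finset.sum_sub_distrib,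
      Finset.sum_eq_single_of_mem 0 (Finset.mem_univ _)]
    · simp
    · intro b _ hb
      linear_combination ψ (-(b * z)) * h b hb
  have hq : (Fintype.card F : R) ≠ 0 := by exact_mod_cast Fintype.card_ne_zero
  have := (key z hz).trans ((by simp only [hzz'] : _ = _).trans (key z' hz').symm)
  exact_mod_cast mul_left_cancel₀ hq (mul_left_cancel₀ hC this)

end CharacterSums

lemma mod_nineteen_of_mul_eq {P : ℤ} (hP : 5 * P ^ 2 % 19 = 1) :
    (∀ w', P * w' % 19 = 1 → w' % 19 = 9) ∨ (∀ w', P * w' % 19 = 1 → w' % 19 = 10) := by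
  have hP' : P % 19 = 17 ∨ P % 19 = 2 := by
    have : 5 * (P % 19) ^ 2 % 19 = 1 := by rw [← hP]; simp [Int.mul_emod, pow_two]
    have h1 := Int.emod_nonneg P (by norm_num : (19 : ℤ) ≠ 0)
    have h2 := Int.emod_lt_of_pos P (by norm_num : (0 : ℤ) < 19)
    generalize P % 19 = r at *
    interval_cases r <;> simp_all
  rcases hP' with hP' | hP'
  · left
    intro w' hw'
    rw [Int.mul_emod, hP'] at hw'
    omega
  · right
    intro w' hw'
    rw [Int.mul_emod, hP'] at hw'
    omega

/-- Values whose first two moments and residues are those of a two-valued distribution are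
two-valued. -/
lemma exists_quadratic_of_moments {α : Type*} [Fintype α] [Zero α] (s : α → ℤ) {q k P : ℤ}
    (hcard : (Fintype.card α : ℤ) = q) (hs0 : s 0 = k) (hqk : q = 19 * k + 1)
    (hqP : q = 5 * P ^ 2) (h1 : ∑ b, s b = 0) (h2 : ∑ b, s b ^ 2 = q * k)
    (hdvd : ∀ b ≠ 0, P ∣ 19 * s b + 1) :
    ∃ A B : ℤ, ∀ b ≠ 0, 361 * s b ^ 2 = A * s b + B := by
  obtain ⟨ε, hε⟩ : ∃ ε : ℤ, ∀ b ≠ 0,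
      0 ≤ (19 * s b + 1) ^ 2 + ε * P * (19 * s b + 1) - 90 * P ^ 2 := by
    rcases mod_nineteen_of_mul_eq (P := P) (by omega) with h | h
    · refine ⟨1, fun b hb => ?_⟩
      obtain ⟨w, hw⟩ := hdvd b hb
      have hw9 := h w (by omega)
      have : 0 ≤ (w - 9) * (w + 10) := by
        rcases le_or_gt 9 w with h9 | h9
        · exact mul_nonneg (by omega) (by omega)
        · exact mul_nonneg_of_nonpos_of_nonpos (by omega) (by omega)
      rw [hw]
      nlinarith [mul_nonneg (sq_nonneg P) this]
    · refine ⟨-1, fun b hb => ?_⟩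
      obtain ⟨w, hw⟩ := hdvd b hb
      have hw9 := h w (by omega)
      have : 0 ≤ (w - 10) * (w + 9) := by
        rcases le_or_gt 10 w with h9 | h9
        · exact mul_nonneg (by omega) (by omega)
        · exact mul_nonneg_of_nonpos_of_nonpos (by omega) (by omega)
      rw [hw]
      nlinarith [mul_nonneg (sq_nonneg P) this]
  have hsum : ∑ b ∈ Finset.univ.erase (0 : α),
      ((19 * s b + 1) ^ 2 + ε * P * (19 * s b + 1) - 90 * P ^ 2) = 0 := by
    have e : ∀ b, (19 * s b + 1) ^ 2 + ε * P * (19 * s b + 1) - 90 * P ^ 2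
        = 361 * s b ^ 2 + (38 + 19 * (ε * P)) * s b + (1 + ε * P - 90 * P ^ 2) := fun b => by ring
    rw [Finset.sum_erase_eq_sub (Finset.mem_univ _), hs0, Finset.sum_congr rfl fun b _ => e b,
      Finset.sum_add_distrib, Finset.sum_add_distrib, ← Finset.mul_sum, ← Finset.mul_sum, h1, h2,
      Finset.sum_const, Finset.card_univ, nsmul_eq_mul, hcard]
    have hP : 90 * P ^ 2 = 18 * q := by rw [hqP]; ring
    rw [hP, hqk]
    ring
  refine ⟨-(38 + 19 * (ε * P)), -(1 + ε * P - 90 * P ^ 2), fun b hb => ?_⟩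
  have := (Finset.sum_eq_zero_iff_of_nonneg fun b hb => hε b (Finset.ne_of_mem_erase hb)).1 hsum b
    (Finset.mem_erase.2 ⟨hb, Finset.mem_univ _⟩)
  linear_combination this

section Periods

variable {F R K : Type*} [Field F] [Fintype F] [Algebra (ZMod 5) F] [CommRing R] [IsDomain R]
  [Field K] {φ : R →+* K} {ι : F →+* K} {ω : MulChar F R}

omit [Algebra (ZMod 5) F] [IsDomain R] in
lemma isPrimitiveRoot_of_lift (hω : ∀ x, φ (ω x) = ι x) {γ : Fˣ}
    (hγ : orderOf γ = Fintype.card F - 1) : IsPrimitiveRoot (ω γ) (Fintype.card F - 1) where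
  pow_eq_one := by
    rw [← map_pow, ← hγ, ← Units.val_pow_eq_pow_val, pow_orderOf_eq_one, Units.val_one, map_one]
  dvd_of_pow_eq_one l hl := by
    rw [← hγ]
    refine orderOf_dvd_of_pow_eq_one (Units.ext (ι.injective ?_))
    rw [Units.val_pow_eq_pow_val, map_pow, ← hω, ← map_pow, hl, map_one, Units.val_one, map_one]

/-- The Gauss sums of all characters of order `19 ^ (n + 1)` have the divisibility predicted by
Stickelberger's theorem. -/
lemma exists_dvd_mul_gaussSum (hω : ∀ x, φ (ω x) = ι x) {ζ : R} (hζ : IsPrimitiveRoot ζ 5)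
    {γ : Fˣ} (hγ : orderOf γ = Fintype.card F - 1) {n e A : ℕ} (he : 9 * 19 ^ n = 2 * e + 1)
    (hF : Fintype.card F = 5 ^ (9 * 19 ^ n)) (hA : 19 ^ (n + 1) * A + 1 = 5 ^ (9 * 19 ^ n)) :
    ∃ v, φ v ≠ 0 ∧ ∀ u < 19 ^ (n + 1), ¬ 19 ∣ u → ∀ b ≠ 0,
      (ζ - 1) ^ (4 * e) ∣
        v * gaussSum ((ω ^ A) ^ u) ((traceChar F hζ.pow_eq_one).mulShift b) := by
  have : CharP F 5 := charP_of_injective_algebraMap (algebraMap (ZMod 5) F).injective 5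
  have hψ := traceChar_ne_one (F := F) hζ
  have hψp := traceChar_pow_five (F := F) hζ.pow_eq_one
  have hprim := AddChar.IsPrimitive.of_ne_one hψ
  have hpos : 0 < 19 ^ n := by positivity
  have hF2 : 2 < Fintype.card F := by
    rw [hF]
    exact (by norm_num : 2 < 5).trans_le (Nat.le_self_pow (by omega) 5)
  obtain ⟨w, hw, hφw⟩ := exists_gaussSum_inv_eq hω hζ.pow_eq_one hF2
  refine ⟨w ^ (4 * e + 4), by simp [hφw], fun u hu hu19 b hb => ?_⟩
  set ψ := traceChar F hζ.pow_eq_one with hψdef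
  have hπ : ζ - 1 ≠ 0 := sub_ne_zero.2 (hζ.ne_one (by norm_num))
  have hu0 : 0 < u := Nat.pos_of_ne_zero (by rintro rfl; exact hu19 (dvd_zero _))
  have hA0 : 0 < A := by
    rcases Nat.eq_zero_or_pos A with rfl | h
    · rw [mul_zero, zero_add, ← hF] at hA
      omega
    · exact h
  have hne : (ω ^ A) ^ u ≠ 1 := by
    intro h
    have h1 : ω γ ^ (A * u) = 1 := by
      have := congrArg (fun χ : MulChar F R => χ γ) h
      simpa [← pow_mul, MulChar.pow_apply_coe] using this
    have h2 := Nat.le_of_dvd (Nat.mul_pos hA0 hu0)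
      ((isPrimitiveRoot_of_lift hω hγ).dvd_of_pow_eq_one _ h1)
    rw [hF, ← hA, Nat.add_sub_cancel, mul_comm] at h2
    exact absurd (Nat.le_of_mul_le_mul_left h2 hA0) (by omega)
  have hdiv : u * 5 ^ (9 * 19 ^ n) / 19 ^ (n + 1) = A * u := by
    rw [← hA, show u * (19 ^ (n + 1) * A + 1) = 19 ^ (n + 1) * (A * u) + u by ring,
      Nat.mul_add_div (by positivity), Nat.div_eq_of_lt hu, add_zero]
  have hmod : u * 5 ^ (9 * 19 ^ n) % 19 ^ (n + 1) = u % 19 ^ (n + 1) := by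
    rw [← hA, show u * (19 ^ (n + 1) * A + 1) = 19 ^ (n + 1) * (A * u) + u by ring,
      Nat.mul_add_mod]
  have hdigits : ∑ i ∈ Finset.range (9 * 19 ^ n), 5 * (u * 5 ^ i % 19 ^ (n + 1)) / 19 ^ (n + 1)
      ≤ 4 * e + 4 := by
    have h1 := mul_sum_digits_eq 5 u (19 ^ (n + 1)) (9 * 19 ^ n) hmod
    have h2 := two_mul_sum_orbit_le n u hu19
    refine Nat.le_of_mul_le_mul_left (c := 19 ^ (n + 1)) ?_ (by positivity)
    rw [he] at h1 h2 ⊢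
    generalize 19 ^ (n + 1) = N at *
    nlinarith
  obtain ⟨c, hc⟩ := (gaussSum_pow_div_dvd hψ hψp ω⁻¹ hu (9 * 19 ^ n)).trans
    (pow_dvd_pow _ hdigits)
  have hq' : gaussSum ((ω ^ A) ^ u)⁻¹ ψ * gaussSum ((ω ^ A) ^ u) ψ⁻¹ = (Fintype.card F : R) := by
    simpa using gaussSum_mul_gaussSum_eq_card (inv_ne_one.2 hne) hprim
  rw [hdiv, inv_pow, pow_mul, hw, mul_pow] at hc
  have hmain : (ζ - 1) ^ (4 * e) ∣ w ^ (4 * e + 4) * gaussSum ((ω ^ A) ^ u) ψ⁻¹ := by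
    refine ⟨c * (ζ ^ 2 * (ζ + 1) ^ 2) ^ (2 * e + 1),
      mul_left_cancel₀ (pow_ne_zero (4 * e + 4) hπ) ?_⟩
    rw [← mul_assoc, hc, mul_right_comm, hq', hF, he, Nat.cast_pow, Nat.cast_ofNat,
      ← hζ.sub_one_pow_four_mul, mul_pow, ← pow_mul]
    ring
  have hinv : ψ⁻¹ = ψ.mulShift ((-1 : Fˣ) : F) := by
    ext x
    simp [AddChar.mulShift_apply, AddChar.inv_apply]
  rw [hinv] at hmain
  obtain ⟨b, rfl⟩ : IsUnit b := isUnit_iff_ne_zero.2 hb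
  rw [gaussSum_mulShift_eq, ← gaussSum_mulShift _ _ (-1), mul_left_comm, mul_left_comm (w ^ _)]
  exact (hmain.mul_left _).mul_left _

lemma geom_sum_eq_ite {y : R} {N : ℕ} (hy : y ^ N = 1) :
    ∑ u ∈ Finset.range N, y ^ u = if y = 1 then (N : R) else 0 := by
  split_ifs with h
  · simp [h]
  · have := mul_geom_sum y N
    rw [hy, sub_self] at this
    exact (mul_eq_zero.1 this).resolve_left (sub_ne_zero.2 h)

/-- The union of `M` consecutive cyclotomic classes of order `N`, starting at class `k`. -/
def classUnion (γ : Fˣ) (M N k : ℕ) : Finset F :=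
  Finset.univ.filter fun x => ∃ i < M, ∃ t : ℕ, x = (γ : F) ^ (i + k + N * t)

omit [Algebra (ZMod 5) F] in
lemma exists_pow_eq_of_orderOf_eq {γ : Fˣ} (hγ : orderOf γ = Fintype.card F - 1) (g : Fˣ) :
    ∃ j : ℕ, γ ^ j = g := by
  have hcard : Nat.card (Subgroup.zpowers γ) = Nat.card Fˣ := by
    rw [Nat.card_zpowers, hγ, Nat.card_eq_fintype_card, Fintype.card_units]
  refine mem_powers_iff_mem_zpowers.2 ?_
  rw [Subgroup.eq_top_of_card_eq _ hcard]
  trivial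

omit [Algebra (ZMod 5) F] in
lemma mul_mem_classUnion {γ : Fˣ} (hγ : orderOf γ = Fintype.card F - 1) {M N k : ℕ}
    (hN : N ∣ Fintype.card F - 1) (hN4 : N.Coprime 4) {x y : F} (hy : y ^ 4 = 1)
    (hx : x ∈ classUnion γ M N k) : y * x ∈ classUnion γ M N k := by
  simp only [classUnion, Finset.mem_filter, Finset.mem_univ, true_and] at hx ⊢
  obtain ⟨i, hi, t, rfl⟩ := hx
  obtain ⟨g, rfl⟩ : IsUnit y := IsUnit.of_pow_eq_one hy (by norm_num)
  obtain ⟨j, rfl⟩ := exists_pow_eq_of_orderOf_eq hγ g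
  have hj : γ ^ (j * 4) = 1 := by
    rw [pow_mul]
    exact Units.ext (by simpa using hy)
  obtain ⟨r, rfl⟩ : N ∣ j :=
    hN4.dvd_of_dvd_mul_right (hN.trans (hγ ▸ orderOf_dvd_of_pow_eq_one hj))
  exact ⟨i, hi, t + r, by rw [Units.val_pow_eq_pow_val, ← pow_add]; ring_nf⟩

omit [Algebra (ZMod 5) F] in
lemma sum_sum_char_eq_ite {γ : Fˣ} (hγ : orderOf γ = Fintype.card F - 1)
    {M N : ℕ} (k : ℕ) (hM : M ≤ N) (hN : N ∣ Fintype.card F - 1) {θ : MulChar F R}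
    (hθ : IsPrimitiveRoot (θ γ) N) (x : F) :
    ∑ i ∈ Finset.range M, ∑ u ∈ Finset.range N, (θ ^ u) x * θ (γ⁻¹ : Fˣ) ^ ((i + k) * u)
      = if x ∈ classUnion γ M N k then (N : R) else 0 := by
  have hθγ : θ γ * θ (γ⁻¹ : Fˣ) = 1 := by rw [← map_mul, Units.mul_inv, map_one]
  by_cases hx : x = 0
  · have : x ∉ classUnion γ M N k := by
      simp [classUnion, hx, eq_comm]
    rw [if_neg this, hx]
    simp_rw [MulChar.map_zero, zero_mul, Finset.sum_const_zero]
  have hterm : ∀ j i, ∑ u ∈ Finset.range N,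
      (θ ^ u) ((γ : F) ^ j) * θ (γ⁻¹ : Fˣ) ^ ((i + k) * u)
      = if j ≡ i + k [MOD N] then (N : R) else 0 := by
    intro j i
    have h1 : ∀ u, (θ ^ u) ((γ : F) ^ j) * θ (γ⁻¹ : Fˣ) ^ ((i + k) * u)
        = (θ γ ^ j * θ (γ⁻¹ : Fˣ) ^ (i + k)) ^ u := by
      intro u
      rw [map_pow, MulChar.pow_apply_coe, mul_pow, ← pow_mul, ← pow_mul, ← pow_mul, mul_comm u j]
    have h2 : (θ γ ^ j * θ (γ⁻¹ : Fˣ) ^ (i + k)) ^ N = 1 := by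
      have h3 : θ (γ⁻¹ : Fˣ) ^ N = 1 := by
        have := congrArg (· ^ N) hθγ
        simpa [mul_pow, hθ.pow_eq_one] using this
      rw [mul_pow, pow_right_comm, pow_right_comm _ _ N, hθ.pow_eq_one, h3, one_pow, one_pow,
        mul_one]
    have h4 : θ γ ^ j * θ (γ⁻¹ : Fˣ) ^ (i + k) = 1 ↔ j ≡ i + k [MOD N] := by
      rw [hθ.eq_orderOf, show θ γ = (Units.mkOfMulEqOne _ _ hθγ : Rˣ) from rfl, orderOf_units,
        ← pow_eq_pow_iff_modEq, Units.ext_iff]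
      have h5 : θ γ ^ (i + k) * θ (γ⁻¹ : Fˣ) ^ (i + k) = 1 := by
        rw [← mul_pow, hθγ, one_pow]
      rw [← h5]
      simpa using mul_left_inj' (right_ne_zero_of_mul_eq_one h5)
    simp_rw [h1, geom_sum_eq_ite h2, h4]
  split_ifs with hD
  · simp only [classUnion, Finset.mem_filter, Finset.mem_univ, true_and] at hD
    obtain ⟨i₀, hi₀, t, rfl⟩ := hD
    simp_rw [hterm]
    rw [Finset.sum_eq_single_of_mem i₀ (Finset.mem_range.2 hi₀), if_pos]
    · simp [Nat.ModEq]
    · intro i hi hne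
      rw [if_neg]
      intro h
      have h' : i₀ + k ≡ i + k [MOD N] := by simpa [Nat.ModEq] using h
      exact hne ((Nat.ModEq.add_right_cancel' k h').eq_of_lt_of_lt (by omega)
        ((Finset.mem_range.1 hi).trans_le hM)).symm
  · obtain ⟨g, rfl⟩ : IsUnit x := isUnit_iff_ne_zero.2 hx
    obtain ⟨j, rfl⟩ := exists_pow_eq_of_orderOf_eq hγ g
    simp only [Units.val_pow_eq_pow_val]
    simp_rw [hterm]
    refine Finset.sum_eq_zero fun i hi => if_neg fun h => hD ?_
    have hle : i + k ≤ j + (Fintype.card F - 1) * (i + k) := by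
      have : 0 < Fintype.card F - 1 := hγ ▸ orderOf_pos γ
      nlinarith
    have hmod : i + k ≡ j + (Fintype.card F - 1) * (i + k) [MOD N] := by
      have : (Fintype.card F - 1) * (i + k) ≡ 0 [MOD N] :=
        (Nat.modEq_zero_iff_dvd).2 (hN.mul_right _)
      simpa using h.symm.trans ((Nat.ModEq.refl j).add this.symm)
    obtain ⟨t, ht⟩ := (Nat.modEq_iff_dvd' hle).1 hmod
    simp only [classUnion, Finset.mem_filter, Finset.mem_univ, true_and]
    refine ⟨i, Finset.mem_range.1 hi, t, ?_⟩
    have : i + k + N * t = j + (Fintype.card F - 1) * (i + k) := by omega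
    rw [this, pow_add, pow_mul, ← hγ]
    simp [← Units.val_pow_eq_pow_val, pow_orderOf_eq_one]

omit [Fintype F] in
lemma exists_int_eq_charSum {ζ : R} (hζ : IsPrimitiveRoot ζ 5) {D : Finset F}
    (hD : ∀ c : ZMod 5, c ≠ 0 → ∀ x ∈ D, algebraMap (ZMod 5) F c * x ∈ D) (b : F) :
    ∃ s : ℤ, (s : R) = ∑ x ∈ D, traceChar F hζ.pow_eq_one (b * x) := by
  set T : F → ZMod 5 := fun x => Algebra.trace (ZMod 5) F (b * x) with hT
  have hsmul : ∀ (c : ZMod 5) x, T (algebraMap (ZMod 5) F c * x) = c * T x := by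
    intro c x
    simp only [hT]
    rw [mul_left_comm, ← Algebra.smul_def, map_smul, smul_eq_mul]
  have hcard : ∀ t : ZMod 5, t ≠ 0 →
      (D.filter fun x => T x = t).card = (D.filter fun x => T x = 1).card := by
    intro t ht
    have hinv : algebraMap (ZMod 5) F t * algebraMap (ZMod 5) F t⁻¹ = 1 := by
      rw [← map_mul, mul_inv_cancel₀ ht, map_one]
    refine Finset.card_nbij' (fun x => algebraMap (ZMod 5) F t⁻¹ * x)
      (fun x => algebraMap (ZMod 5) F t * x) ?_ ?_ ?_ ?_
    · intro x hx
      simp only [Finset.coe_filter, Set.mem_ofPred_eq] at hx ⊢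
      exact ⟨hD _ (inv_ne_zero ht) _ hx.1, by rw [hsmul, hx.2, inv_mul_cancel₀ ht]⟩
    · intro x hx
      simp only [Finset.coe_filter, Set.mem_ofPred_eq] at hx ⊢
      exact ⟨hD _ ht _ hx.1, by rw [hsmul, hx.2, mul_one]⟩
    · intro x _
      simp only
      rw [← mul_assoc, hinv, one_mul]
    · intro x _
      simp only
      rw [← mul_assoc, mul_comm (algebraMap (ZMod 5) F t⁻¹), hinv, one_mul]
  have hfib : ∑ x ∈ D, traceChar F hζ.pow_eq_one (b * x)
      = ∑ t : ZMod 5, ((D.filter fun x => T x = t).card : R) * ζ ^ t.val := by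
    rw [← Finset.sum_fiberwise D T]
    refine Finset.sum_congr rfl fun t _ => ?_
    rw [← nsmul_eq_mul, ← Finset.sum_const]
    refine Finset.sum_congr rfl fun x hx => ?_
    rw [traceChar_apply, ← (Finset.mem_filter.1 hx).2]
  have hgeom : ∑ t : ZMod 5, ζ ^ t.val = 0 := by
    rw [← hζ.geom_sum_eq_zero (by norm_num), Finset.sum_range]
    rfl
  refine ⟨(D.filter fun x => T x = 0).card - (D.filter fun x => T x = 1).card, ?_⟩
  have hsplit : ∀ t : ZMod 5, ((D.filter fun x => T x = t).card : R) * ζ ^ t.val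
      = ((D.filter fun x => T x = 1).card : R) * ζ ^ t.val
        + if t = 0 then (((D.filter fun x => T x = 0).card : R)
          - (D.filter fun x => T x = 1).card) else 0 := by
    intro t
    split_ifs with ht
    · subst ht
      simp
    · rw [hcard t ht, add_zero]
  rw [hfib, Finset.sum_congr rfl fun t _ => hsplit t, Finset.sum_add_distrib, ← Finset.mul_sum,
    hgeom]
  simp

omit [Algebra (ZMod 5) F] in
lemma mul_card_classUnion [CharZero R] {γ : Fˣ} (hγ : orderOf γ = Fintype.card F - 1)
    {M N : ℕ} (k : ℕ) (hM : M ≤ N) (hN : N ∣ Fintype.card F - 1) {θ : MulChar F R}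
    (hθ : IsPrimitiveRoot (θ γ) N) :
    N * (classUnion γ M N k).card = M * (Fintype.card F - 1) := by
  have hN0 : N ≠ 0 := by
    rintro rfl
    have : 0 < Fintype.card F - 1 := hγ ▸ orderOf_pos γ
    rw [zero_dvd_iff] at hN
    omega
  have h : ((N * (classUnion γ M N k).card : ℕ) : R) = ((M * (Fintype.card F - 1) : ℕ) : R) :=
    calc ((N * (classUnion γ M N k).card : ℕ) : R)
        = ∑ x, if x ∈ classUnion γ M N k then (N : R) else 0 := by
          rw [← Finset.sum_filter, Finset.filter_mem_eq_inter, Finset.univ_inter,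
            Finset.sum_const, nsmul_eq_mul, Nat.cast_mul, mul_comm]
      _ = ∑ i ∈ Finset.range M, ∑ u ∈ Finset.range N,
            (∑ x, (θ ^ u) x) * θ (γ⁻¹ : Fˣ) ^ ((i + k) * u) := by
          simp_rw [← sum_sum_char_eq_ite hγ k hM hN hθ, Finset.sum_mul]
          rw [Finset.sum_comm]
          exact Finset.sum_congr rfl fun i _ => Finset.sum_comm
      _ = ∑ i ∈ Finset.range M, ((Fintype.card F - 1 : ℕ) : R) := by
          refine Finset.sum_congr rfl fun i _ => ?_
          rw [Finset.sum_eq_single_of_mem 0 (Finset.mem_range.2 (Nat.pos_of_ne_zero hN0))]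
          · rw [pow_zero, MulChar.sum_one_eq_card_units, mul_zero, pow_zero, mul_one,
              Fintype.card_units]
          · intro u hu hu0
            rw [MulChar.sum_eq_zero_of_ne_one, zero_mul]
            intro h
            have h1 := congrArg (fun χ : MulChar F R => χ γ) h
            simp only [MulChar.pow_apply_coe, MulChar.one_apply_coe] at h1
            exact absurd (Nat.le_of_dvd (Nat.pos_of_ne_zero hu0) (hθ.dvd_of_pow_eq_one _ h1))
              (by simpa using hu)
      _ = _ := by simp
  exact_mod_cast h

lemma five_pow_dvd_charSum (hω : ∀ x, φ (ω x) = ι x) {ζ : R} (hζ : IsPrimitiveRoot ζ 5)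
    {γ : Fˣ} (hγ : orderOf γ = Fintype.card F - 1) {n e A : ℕ} (he : 9 * 19 ^ n = 2 * e + 1)
    (hF : Fintype.card F = 5 ^ (9 * 19 ^ n)) (hA : 19 ^ (n + 1) * A + 1 = 5 ^ (9 * 19 ^ n))
    (k : ℕ) {b : F} (hb : b ≠ 0) {s : ℤ}
    (hs : (s : R) = ∑ x ∈ classUnion γ (19 ^ n) (19 ^ (n + 1)) k,
      traceChar F hζ.pow_eq_one (b * x)) :
    (5 : ℤ) ^ e ∣ 19 * s + 1 := by
  have : CharP F 5 := charP_of_injective_algebraMap (algebraMap (ZMod 5) F).injective 5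
  have : CharP K 5 := charP_of_injective_ringHom ι.injective 5
  have hφζ : φ ζ = 1 := by
    have h : (φ ζ - 1) ^ 5 = 0 := by rw [sub_pow_char, ← map_pow, hζ.pow_eq_one]; simp
    exact sub_eq_zero.1 (pow_eq_zero_iff (by norm_num) |>.1 h)
  have hcardA : Fintype.card F - 1 = A * 19 ^ (n + 1) := by
    rw [hF, ← hA, Nat.add_sub_cancel, mul_comm]
  have hθ : IsPrimitiveRoot ((ω ^ A) γ) (19 ^ (n + 1)) := by
    rw [MulChar.pow_apply_coe]
    exact (isPrimitiveRoot_of_lift hω hγ).pow (hγ ▸ orderOf_pos γ) hcardA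
  obtain ⟨v, hv, hdvd⟩ := exists_dvd_mul_gaussSum hω hζ hγ he hF hA
  set ψ := traceChar F hζ.pow_eq_one with hψdef
  have hψb : ψ.mulShift b ≠ 1 := AddChar.IsPrimitive.of_ne_one (traceChar_ne_one hζ) hb
  set θ := ω ^ A
  set c : ℕ → R := fun u => ∑ i ∈ Finset.range (19 ^ n), θ (γ⁻¹ : Fˣ) ^ ((i + k) * u) with hc
  have hθγ : θ γ * θ (γ⁻¹ : Fˣ) = 1 := by rw [← map_mul, Units.mul_inv, map_one]
  have hc0 : c 0 = 19 ^ n := by simp [hc]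
  have hc19 : ∀ u < 19 ^ (n + 1), u ≠ 0 → 19 ∣ u → c u = 0 := by
    rintro u hu hu0 ⟨u', rfl⟩
    have h1 : (θ (γ⁻¹ : Fˣ) ^ (19 * u')) ^ (19 ^ n) = 1 := by
      have h := congrArg (fun y => (y ^ (19 * u')) ^ (19 ^ n)) hθγ
      simp only [mul_pow, one_pow] at h
      rwa [← pow_mul (θ γ), show 19 * u' * 19 ^ n = 19 ^ (n + 1) * u' by ring, pow_mul,
        hθ.pow_eq_one, one_pow, one_mul] at h
    have h2 : θ (γ⁻¹ : Fˣ) ^ (19 * u') ≠ 1 := by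
      intro h
      have h' := congrArg (fun y => y ^ (19 * u')) hθγ
      simp only [mul_pow, one_pow, h, mul_one] at h'
      exact absurd (Nat.le_of_dvd (Nat.pos_of_ne_zero hu0) (hθ.dvd_of_pow_eq_one _ h')) (by omega)
    have h3 := geom_sum_eq_ite h1
    rw [if_neg h2] at h3
    simp only [hc]
    simp_rw [mul_comm _ (19 * u'), mul_add, pow_add, pow_mul _ (19 * u')]
    rw [← Finset.sum_mul, h3, zero_mul]
  have hexp : (19 : R) ^ (n + 1) * s
      = ∑ u ∈ Finset.range (19 ^ (n + 1)), c u * gaussSum (θ ^ u) (ψ.mulShift b) := by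
    have hind := sum_sum_char_eq_ite hγ k (Nat.pow_le_pow_right (by norm_num) n.le_succ)
      (hcardA ▸ dvd_mul_left _ _) hθ
    calc (19 : R) ^ (n + 1) * s
        = ∑ x, (if x ∈ classUnion γ (19 ^ n) (19 ^ (n + 1)) k then ((19 ^ (n + 1) : ℕ) : R) else 0)
            * ψ (b * x) := by
          simp_rw [ite_mul, zero_mul]
          rw [← Finset.sum_filter, Finset.filter_mem_eq_inter, Finset.univ_inter, hs,
            Finset.mul_sum]
          simp
      _ = ∑ x, ∑ u ∈ Finset.range (19 ^ (n + 1)), c u * ((θ ^ u) x * ψ (b * x)) := by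
          refine Finset.sum_congr rfl fun x _ => ?_
          rw [← hind, Finset.sum_comm, Finset.sum_mul]
          refine Finset.sum_congr rfl fun u _ => ?_
          rw [← Finset.mul_sum]
          ring
      _ = _ := by
          rw [Finset.sum_comm]
          refine Finset.sum_congr rfl fun u _ => ?_
          rw [← Finset.mul_sum]
          rfl
  have hmain : (ζ - 1) ^ (4 * e) ∣ v * ((19 ^ n * (19 * s + 1) : ℤ) : R) := by
    have h0 : 0 ∈ Finset.range (19 ^ (n + 1)) := Finset.mem_range.2 (by positivity)
    have hsum : ((19 ^ n * (19 * s + 1) : ℤ) : R)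
        = ∑ u ∈ (Finset.range (19 ^ (n + 1))).erase 0,
          c u * gaussSum (θ ^ u) (ψ.mulShift b) := by
      rw [Finset.sum_erase_eq_sub h0, ← hexp, hc0, pow_zero, gaussSum_one_left hψb]
      push_cast
      ring
    rw [hsum, Finset.mul_sum]
    refine Finset.dvd_sum fun u hu => ?_
    obtain ⟨hu0, hu⟩ := Finset.mem_erase.1 hu
    rw [Finset.mem_range] at hu
    by_cases h19 : 19 ∣ u
    · simp [hc19 u hu hu0 h19]
    · rw [mul_left_comm]
      exact (hdvd u hu h19 b hb).mul_left _
  have h5 := five_pow_dvd_of_dvd_mul φ (sub_ne_zero.2 (hζ.ne_one (by norm_num)))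
    (by simp [hφζ]) hζ.sub_one_pow_four_mul (by
      rw [map_mul, map_pow, map_pow, map_add, hφζ, map_one]
      intro h
      have : ((4 : ℕ) : K) = 0 := by linear_combination h
      exact absurd ((CharP.cast_eq_zero_iff K 5 4).1 this) (by norm_num)) e v hv _ hmain
  exact (IsCoprime.pow (by norm_num)).dvd_of_dvd_mul_left h5

end Periods

lemma isSRGWith_of_card_filter_eq {F : Type*} [Field F] [Fintype F] {D : Finset F}
    (hneg : ∀ x ∈ D, -x ∈ D) {l u : ℕ}
    (hl : ∀ z ∈ D, (D.filter fun x => z - x ∈ D).card = l)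
    (hu : ∀ z ≠ 0, z ∉ D → (D.filter fun x => z - x ∈ D).card = u)
    (G : SimpleGraph F) [DecidableRel G.Adj] (hG : ∀ x y, G.Adj x y ↔ x - y ∈ D) :
    G.IsSRGWith (Fintype.card F) D.card l u := by
  have hcommon : ∀ v w, Fintype.card (G.commonNeighbors v w)
      = (D.filter fun x => (v - w) - x ∈ D).card := by
    intro v w
    rw [← Set.toFinset_card]
    refine Finset.card_nbij' (fun y => v - y) (fun x => v - x) ?_ ?_ ?_ ?_
    · intro y hy
      simp only [Set.coe_toFinset, SimpleGraph.mem_commonNeighbors, hG] at hy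
      simp only [Finset.coe_filter, Set.mem_ofPred_eq]
      refine ⟨hy.1, ?_⟩
      have := hneg _ hy.2
      rwa [neg_sub, show y - w = v - w - (v - y) by ring] at this
    · intro x hx
      simp only [Finset.coe_filter, Set.mem_ofPred_eq] at hx
      simp only [Set.coe_toFinset, SimpleGraph.mem_commonNeighbors, hG]
      refine ⟨by simpa using hx.1, ?_⟩
      have := hneg _ hx.2
      rwa [show -(v - w - x) = w - (v - x) by ring] at this
    · intro y _
      simp
    · intro x _
      simp
  refine ⟨rfl, fun v => ?_, fun v w h => ?_, fun v w hne h => ?_⟩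
  · rw [← SimpleGraph.card_neighborFinset_eq_degree]
    refine Finset.card_nbij' (fun y => v - y) (fun x => v - x) ?_ ?_ ?_ ?_ <;> intro x hx <;>
      simp_all
  · rw [hcommon]
    exact hl _ ((hG v w).1 h)
  · rw [hcommon]
    exact hu _ (sub_ne_zero.2 hne) fun h' => h ((hG v w).2 h')

lemma exists_isSRGWith_classUnion {F : Type} [Field F] [Fintype F] {n : ℕ} (k : ℕ)
    (hF : Fintype.card F = 5 ^ (9 * 19 ^ n)) {γ : Fˣ} (hγ : orderOf γ = Fintype.card F - 1)
    (G : SimpleGraph F) [DecidableRel G.Adj]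
    (hG : ∀ x y, G.Adj x y ↔ x ≠ y ∧ (x - y ∈ classUnion γ (19 ^ n) (19 ^ (n + 1)) k ∨
      y - x ∈ classUnion γ (19 ^ n) (19 ^ (n + 1)) k)) :
    G ≠ ⊤ ∧ G ≠ ⊥ ∧ ∃ l u, G.IsSRGWith (Fintype.card F) ((Fintype.card F - 1) / 19) l u := by
  have : CharP F 5 := charP_of_card_eq_prime_pow hF
  let _ : Algebra (ZMod 5) F := ZMod.algebra F 5
  obtain ⟨R, _, _, _, K, _, φ, ι, ω, ζ, hζ, hω⟩ := exists_teichmuller 5 F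
  obtain ⟨e, he⟩ : ∃ e, 9 * 19 ^ n = 2 * e + 1 :=
    (Odd.mul (by decide) (Odd.pow (by decide)) : Odd (9 * 19 ^ n))
  obtain ⟨A, hA⟩ : ∃ A, 19 ^ (n + 1) * A + 1 = 5 ^ (9 * 19 ^ n) := by
    have h : ((5 ^ (9 * 19 ^ n) : ℕ) : ZMod (19 ^ (n + 1))) = ((1 : ℕ) : ZMod (19 ^ (n + 1))) := by
      rw [Nat.cast_pow, Nat.cast_ofNat, ← orderOf_five_zmod, pow_orderOf_eq_one, Nat.cast_one]
    have hpos : 1 ≤ 5 ^ (9 * 19 ^ n) := Nat.one_le_pow _ _ (by norm_num)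
    obtain ⟨A, hA⟩ := (Nat.modEq_iff_dvd' hpos).1 ((ZMod.natCast_eq_natCast_iff _ _ _).1 h.symm)
    exact ⟨A, by omega⟩
  have hcardA : Fintype.card F - 1 = A * 19 ^ (n + 1) := by
    rw [hF, ← hA, Nat.add_sub_cancel, mul_comm]
  have hN : 19 ^ (n + 1) ∣ Fintype.card F - 1 := hcardA ▸ dvd_mul_left _ _
  have hq0 : 0 < Fintype.card F - 1 := hγ ▸ orderOf_pos γ
  set D := classUnion γ (19 ^ n) (19 ^ (n + 1)) k with hD
  have hmul : ∀ y : F, y ^ 4 = 1 → ∀ x ∈ D, y * x ∈ D := fun y hy x hx =>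
    mul_mem_classUnion hγ hN (Nat.Coprime.pow_left _ (by norm_num)) hy hx
  have hneg : ∀ x ∈ D, -x ∈ D := fun x hx => by
    simpa using hmul (-1) (by norm_num) x hx
  have h0 : (0 : F) ∉ D := by
    intro h
    simp only [hD, classUnion, Finset.mem_filter] at h
    obtain ⟨-, i, -, t, h⟩ := h
    exact pow_ne_zero _ γ.ne_zero h.symm
  have hcard : 19 * D.card = Fintype.card F - 1 := by
    have hθ : IsPrimitiveRoot ((ω ^ A) γ) (19 ^ (n + 1)) := by
      rw [MulChar.pow_apply_coe]
      exact (isPrimitiveRoot_of_lift hω hγ).pow hq0 hcardA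
    have h := mul_card_classUnion hγ k (Nat.pow_le_pow_right (by norm_num) n.le_succ) hN hθ
    refine Nat.eq_of_mul_eq_mul_left (show 0 < 19 ^ n by positivity) ?_
    rw [← mul_assoc, ← pow_succ]
    exact h
  have hprim := AddChar.IsPrimitive.of_ne_one (traceChar_ne_one (F := F) hζ)
  have hint := exists_int_eq_charSum hζ (D := D) (fun c hc x hx => hmul _ (by
    rw [← map_pow, ZMod.pow_card_sub_one_eq_one hc, map_one]) x hx)
  choose s hs using hint
  set ψ := traceChar F hζ.pow_eq_one with hψ
  obtain ⟨B, C, hBC⟩ := exists_quadratic_of_moments s (q := Fintype.card F) (k := D.card)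
    (P := 5 ^ e) rfl
    (by
      have := hs 0
      simp only [zero_mul, AddChar.map_zero_eq_one, Finset.sum_const, nsmul_eq_mul, mul_one] at this
      exact_mod_cast this)
    (by omega)
    (by rw [hF, he]; push_cast; ring)
    (by
      have h := sum_charSum_mul hprim D 0
      simp only [← hs, mul_zero, neg_zero, AddChar.map_zero_eq_one, mul_one, if_neg h0] at h
      exact_mod_cast h)
    (by
      have h := sum_charSum_sq_mul hprim D 0
      simp only [← hs, mul_zero, neg_zero, AddChar.map_zero_eq_one, mul_one, zero_sub] at h
      rw [Finset.filter_true_of_mem hneg] at h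
      exact_mod_cast h)
    (fun b hb => five_pow_dvd_charSum hω hζ hγ he hF hA k hb (hs b))
  have hconst : ∀ z z' : F, z ≠ 0 → z' ≠ 0 → (z ∈ D ↔ z' ∈ D) →
      (D.filter fun x => z - x ∈ D).card = (D.filter fun x => z' - x ∈ D).card := by
    intro z z' hz hz' h
    refine card_filter_sub_mem_eq hprim D (A := (B : R)) (B := (C : R)) (C := 361) (by norm_num)
      (fun b hb => ?_) hz hz' h
    rw [← hs]
    exact_mod_cast hBC b hb
  have hG' : ∀ x y, G.Adj x y ↔ x - y ∈ D := by
    intro x y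
    rw [hG]
    constructor
    · rintro ⟨-, h | h⟩
      · exact h
      · simpa using hneg _ h
    · intro h
      exact ⟨fun hxy => h0 (by simpa [hxy] using h), Or.inl h⟩
  obtain ⟨z₁, hz₁⟩ : D.Nonempty := Finset.card_pos.1 (by omega)
  obtain ⟨z₂, hz₂⟩ : ∃ z, z ∉ insert 0 D := by
    by_contra! h
    have h1 := Finset.card_insert_le 0 D
    rw [Finset.eq_univ_iff_forall.2 h, Finset.card_univ] at h1
    omega
  rw [Finset.mem_insert, not_or] at hz₂
  refine ⟨fun h => hz₂.2 ?_, fun h => ?_, (D.filter fun x => z₁ - x ∈ D).card,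
    (D.filter fun x => z₂ - x ∈ D).card, ?_⟩
  · simpa using (hG' z₂ 0).1 (by rw [h]; simpa using hz₂.1)
  · have := (hG' z₁ 0).2 (by simpa using hz₁)
    rw [h] at this
    exact this
  · rw [← hcard, Nat.mul_div_cancel_left _ (by norm_num)]
    exact isSRGWith_of_card_filter_eq hneg
      (fun z hz => hconst z z₁ (fun h => h0 (h ▸ hz)) (fun h => h0 (h ▸ hz₁)) (by simp [hz, hz₁]))
      (fun z hz0 hz => hconst z z₂ hz0 hz₂.1 (by simp [hz, hz₂.2])) G hG'

/-- Each `Cay(F_q, D_k)` is a strongly regular graph of degree `(q-1)/19`,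
where `q = 5^{9*19^(m-1)}`, `N = 19^m`. -/
theorem cayley_srg_example_16
    (m N q : ℕ) (hm : 1 ≤ m)
    (hN : N = 19 ^ m) (hq : q = 5 ^ (9 * 19 ^ (m - 1)))
    (F : Type) [Field F] [Fintype F] (hF : Fintype.card F = q)
    (γ : Fˣ) (hγ : orderOf γ = q - 1)
    (D : ℕ → Set F)
    (hD : ∀ k, D k = {x : F | ∃ i < 19 ^ (m - 1), ∃ t : ℕ,
        x = ((γ : F)) ^ (i + k * 19 ^ (m - 1) + N * t)}) :
    ∀ k ≤ 18,
      SimpleGraph.fromRel (fun x y : F => x - y ∈ D k) ≠ ⊤ ∧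
      SimpleGraph.fromRel (fun x y : F => x - y ∈ D k) ≠ ⊥ ∧
      ∃ l u : ℕ, (SimpleGraph.fromRel (fun x y : F => x - y ∈ D k)).IsSRGWith
        q ((q - 1) / 19) l u := by
  intro k _
  obtain ⟨n, rfl⟩ := Nat.exists_eq_add_of_le' hm
  subst hN hq
  rw [← hF] at hγ ⊢
  refine exists_isSRGWith_classUnion (k * 19 ^ n) hF hγ _ fun x y => ?_
  simp [SimpleGraph.fromRel_adj, hD, classUnion]
end
end
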